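/- arXiv:math/0609723 — 4 statements merged into one kernel-verified Lean document; each statement's English description precedes it below -/
import Mathlib

section
/- Stickelberger's theorem for the p-th cyclotomic field: for every ideal class c of the ring of integers O_K of K = ℚ(ζ_p), the product ∏_{i=0}^{p-2} (σ^i(c))^{v_{-i}} is the trivial class; that is, the Stickelberger element P(σ) = Σ_{i=0}^{p-2} v_{-i}·σ^i annihilates the ideal class group Cl(K) of K. -/
section stickhelpers
open NumberField Finset nonZeroDivisors Polynomial

section gen
variable {p : ℕ} [hp : Fact p.Prime] {K : Type*} [Field K] [NumberField K]
    [IsCyclotomicExtension {p} ℚ K] {ζ : K} (hζ : IsPrimitiveRoot ζ p)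

lemma stick_exists_poly (y : 𝓞 K) : ∃ h : ℤ[X], aeval hζ.toInteger h = y := by
  have := hζ.integralPowerBasis.exists_eq_aeval' y
  obtain ⟨h, hh⟩ := this
  exact ⟨h, by rw [hh, hζ.integralPowerBasis_gen]⟩

lemma stick_root_prim {F : Type*} [Field F] (φ : 𝓞 K →+* F) (h : (p : F) ≠ 0) :
    IsPrimitiveRoot (φ hζ.toInteger) p := by
  have : NeZero (p : F) := ⟨h⟩
  rw [← isRoot_cyclotomic_iff]
  have h1 := hζ.toInteger_isPrimitiveRoot.isRoot_cyclotomic hp.out.pos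
  have := h1.map (f := φ)
  simpa using this

lemma stick_liesOver (ℓ : ℕ) (hℓ : ℓ.Prime) (I : Ideal (𝓞 K)) [I.IsPrime]
    (hI : (ℓ : 𝓞 K) ∈ I) : I.LiesOver (Ideal.span {(ℓ : ℤ)}) := by
  have : Fact ℓ.Prime := ⟨hℓ⟩
  have : (Ideal.span {(ℓ : ℤ)}).IsMaximal := Int.ideal_span_isMaximal_of_prime ℓ
  constructor
  refine Ideal.IsMaximal.eq_of_le this ?_ ?_
  · exact (Ideal.IsPrime.under ℤ I).ne_top
  · rw [Ideal.span_singleton_le_iff_mem]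
    simpa [Ideal.under, Ideal.mem_comap] using hI

lemma stick_unram (ℓ : ℕ) (hℓ : ℓ.Prime) (hne : ℓ ≠ p) (I : Ideal (𝓞 K)) [I.IsPrime]
    (hI : (ℓ : 𝓞 K) ∈ I) : (ℓ : 𝓞 K) ∉ I ^ 2 := by
  have : Fact ℓ.Prime := ⟨hℓ⟩
  have := stick_liesOver ℓ hℓ I hI
  have h := IsCyclotomicExtension.Rat.ramificationIdx_eq_of_not_dvd (p := ℓ) (m := p) (K := K) (P := I)
    (fun h => hne ((Nat.prime_dvd_prime_iff_eq hℓ hp.out).1 h))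
  intro h2
  have h0 : (Ideal.span {(ℓ : ℤ)}) ≠ ⊥ := by
    simpa using hℓ.ne_zero
  rw [← Ideal.ramificationIdx'_eq_ramificationIdx (Ideal.span {(ℓ : ℤ)}) I h0] at h
  refine (Ideal.ramificationIdx'_ne_one_iff (p := Ideal.span {(ℓ : ℤ)}) (P := I) ?_).2 ?_ h
  · rw [Ideal.map_span]; simpa [Ideal.span_singleton_le_iff_mem] using hI
  · rw [Ideal.map_span]; simpa [Ideal.span_singleton_le_iff_mem] using h2

lemma stick_above_p (I : Ideal (𝓞 K)) [I.IsPrime] (hI : (p : 𝓞 K) ∈ I) :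
    I = Ideal.span {hζ.toInteger - 1} := by
  have := stick_liesOver p hp.out I hI
  exact IsCyclotomicExtension.Rat.eq_span_zeta_sub_one_of_liesOver' p K hζ I

lemma stick_coeff {r : ℕ} [Fact r.Prime] {F : Type*} [Field F] [Finite F] [Algebra (ZMod r) F]
    (x : F) (hx : x ^ p = 1) (h1 : 1 < (minpoly (ZMod r) x).natDegree) :
    (minpoly (ZMod r) x).coeff 0 = (-1) ^ (minpoly (ZMod r) x).natDegree := by
  have hint : IsIntegral (ZMod r) x := Algebra.IsIntegral.isIntegral x
  have hx0 : x ≠ 0 := by rintro rfl; simp [hp.out.ne_zero] at hx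
  have : CharP F r := charP_of_injective_algebraMap (algebraMap (ZMod r) F).injective r
  have hnd : ¬ p ∣ r - 1 := by
    intro hd
    have : x ^ r = x := by
      obtain ⟨k, hk⟩ := hd
      have : r = r - 1 + 1 := by have := (Fact.out : r.Prime).one_lt; omega
      rw [this, pow_succ, hk, pow_mul, hx]; simp
    rw [← Subfield.mem_bot_iff_pow_eq_self F r, mem_bot_iff_intCast r] at this
    obtain ⟨n, rfl⟩ := this
    have : ((n : F)) = algebraMap (ZMod r) F n := by simp
    rw [this, minpoly.eq_X_sub_C, natDegree_X_sub_C] at h1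
    exact absurd h1 (lt_irrefl _)
  let pb := IntermediateField.adjoin.powerBasis hint
  have hg : pb.gen ^ p = 1 := by
    apply (algebraMap _ F).injective
    simpa [pb] using hx
  have hN := Algebra.PowerBasis.norm_gen_eq_coeff_zero_minpoly pb
  have hmin : minpoly (ZMod r) pb.gen = minpoly (ZMod r) x := by
    simp [pb, IntermediateField.minpoly_gen]
  have hdim : pb.dim = (minpoly (ZMod r) x).natDegree := by simp [pb]
  rw [hmin, hdim] at hN
  set N := Algebra.norm (ZMod r) pb.gen
  have hNp : N ^ p = 1 := by rw [← map_pow, hg, map_one]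
  have hN0 : N ≠ 0 := by intro h; rw [h] at hNp; simp [hp.out.ne_zero] at hNp
  have hNr : N ^ (r - 1) = 1 := ZMod.pow_card_sub_one_eq_one hN0
  have hN1 : N = 1 := by
    have hco : Nat.gcd p (r - 1) = 1 := (Nat.Prime.coprime_iff_not_dvd hp.out).2 hnd
    have := pow_gcd_eq_one.2 ⟨hNp, hNr⟩
    rwa [hco, pow_one] at this
  rw [hN1] at hN
  have h2 : ((-1 : ZMod r) ^ (minpoly (ZMod r) x).natDegree) * (-1) ^ (minpoly (ZMod r) x).natDegree = 1 := by
    rw [← mul_pow]; simp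
  linear_combination (-(-1 : ZMod r) ^ (minpoly (ZMod r) x).natDegree) * hN  - (minpoly (ZMod r) x).coeff 0 * h2

structure StickMin (z : 𝓞 K) (I : Ideal (𝓞 K)) (r : ℕ) (g : (ZMod r)[X]) : Prop where
  prime : r.Prime
  monic : g.Monic
  mem : (r : 𝓞 K) ∈ I
  iff : ∀ h : ℤ[X], aeval z h ∈ I ↔ g ∣ h.map (Int.castRingHom (ZMod r))
  coeff : 1 < g.natDegree → g.coeff 0 = (-1) ^ g.natDegree
  norm : g.natDegree = 1 → Ideal.absNorm I = r
  pos : 0 < g.natDegree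

lemma stick_exists_min (I : Ideal (𝓞 K)) [I.IsPrime] (h0 : I ≠ ⊥) :
    ∃ (r : ℕ) (g : (ZMod r)[X]), StickMin hζ.toInteger I r g := by
  have hmax : I.IsMaximal := Ideal.IsPrime.isMaximal inferInstance h0
  let _ : Field (𝓞 K ⧸ I) := Ideal.Quotient.field I
  have : Finite (𝓞 K ⧸ I) := Ideal.finiteQuotientOfFreeOfNeBot I h0
  obtain ⟨r, hr⟩ := CharP.exists (𝓞 K ⧸ I)
  have hrp : r.Prime := CharP.char_is_prime (𝓞 K ⧸ I) r
  have : Fact r.Prime := ⟨hrp⟩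
  let _ : Algebra (ZMod r) (𝓞 K ⧸ I) := ZMod.algebra _ r
  set z := hζ.toInteger
  set x : 𝓞 K ⧸ I := Ideal.Quotient.mk I z
  have hint : IsIntegral (ZMod r) x := Algebra.IsIntegral.isIntegral x
  have key : ∀ h : ℤ[X], aeval x (h.map (Int.castRingHom (ZMod r))) =
      Ideal.Quotient.mk I (aeval z h) := by
    intro h
    rw [aeval_def, eval₂_map, aeval_def, hom_eval₂]
    congr 1
    exact RingHom.ext_int _ _
  refine ⟨r, minpoly (ZMod r) x, hrp, minpoly.monic hint, ?_, ?_, ?_, ?_, ?_⟩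
  · rw [← Ideal.Quotient.eq_zero_iff_mem, map_natCast, CharP.cast_eq_zero]
  · intro h
    rw [← Ideal.Quotient.eq_zero_iff_mem, ← key, minpoly.dvd_iff]
  · intro h1
    refine stick_coeff (p := p) x ?_ h1
    have := hζ.toInteger_isPrimitiveRoot.pow_eq_one
    simp only [x, z]
    rw [← map_pow, this, map_one]
  · intro h1
    have hx : x ∈ (algebraMap (ZMod r) (𝓞 K ⧸ I)).range := by
      rwa [← minpoly.natDegree_eq_one_iff]
    obtain ⟨a, ha⟩ := hx
    have hbij : Function.Bijective (algebraMap (ZMod r) (𝓞 K ⧸ I)) := by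
      refine ⟨(algebraMap (ZMod r) (𝓞 K ⧸ I)).injective, fun y => ?_⟩
      obtain ⟨y, rfl⟩ := Ideal.Quotient.mk_surjective y
      obtain ⟨h, rfl⟩ := stick_exists_poly hζ y
      rw [← key, ← ha]
      exact ⟨_, (aeval_algebraMap_apply_eq_algebraMap_eval _ _).symm⟩
    rw [Ideal.absNorm_apply, Submodule.cardQuot_apply, ← Nat.card_eq_of_bijective _ hbij]
    simp
  · exact minpoly.natDegree_pos hint

lemma stick_min_unique {I P : Ideal (𝓞 K)} {r : ℕ} {g : (ZMod r)[X]}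
    (hI : StickMin hζ.toInteger I r g) (hP : StickMin hζ.toInteger P r g) : I = P := by
  ext y
  obtain ⟨h, rfl⟩ := stick_exists_poly hζ y
  rw [hI.iff, hP.iff]

lemma stick_mk0_mem (H : Subgroup (ClassGroup (𝓞 K))) (J : Ideal (𝓞 K)) :
    (∀ P : Ideal (𝓞 K), Prime P → P ∣ J → ∀ h : P ∈ (Ideal (𝓞 K))⁰, ClassGroup.mk0 ⟨P, h⟩ ∈ H) →
    ∀ hJ : J ∈ (Ideal (𝓞 K))⁰, ClassGroup.mk0 ⟨J, hJ⟩ ∈ H := by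
  induction J using UniqueFactorizationMonoid.induction_on_prime with
  | h₁ => 
    intro _ hJ
    exact absurd rfl (nonZeroDivisors.ne_zero hJ)
  | h₂ x hx =>
    intro _ hJ
    have : x = 1 := by rwa [Ideal.isUnit_iff, ← Ideal.one_eq_top] at hx
    subst this
    have : (⟨1, hJ⟩ : (Ideal (𝓞 K))⁰) = 1 := rfl
    rw [this, map_one]
    exact H.one_mem
  | h₃ a P ha hP ih =>
    intro hdiv hJ
    have hP' : P ∈ (Ideal (𝓞 K))⁰ := mem_nonZeroDivisors_of_ne_zero hP.ne_zero
    have ha' : a ∈ (Ideal (𝓞 K))⁰ := mem_nonZeroDivisors_of_ne_zero ha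
    have : (⟨P * a, hJ⟩ : (Ideal (𝓞 K))⁰) = ⟨P, hP'⟩ * ⟨a, ha'⟩ := rfl
    rw [this, map_mul]
    exact H.mul_mem (hdiv P hP (dvd_mul_right _ _) _)
      (ih (fun Q hQ hQa => hdiv Q hQ (hQa.mul_left _)) _)

lemma stick_exists_B (I : Ideal (𝓞 K)) [I.IsPrime] (hpI : (p : 𝓞 K) ∉ I)
    {r : ℕ} {g : (ZMod r)[X]} (hg : StickMin hζ.toInteger I r g) (h1 : 1 < g.natDegree) :
    ∃ B : ℤ[X], B.Monic ∧ B.natDegree = g.natDegree ∧ B.map (Int.castRingHom (ZMod r)) = g ∧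
      B.coeff 0 = (-1) ^ g.natDegree + r ∧ aeval hζ.toInteger B ∉ I ^ 2 := by
  have : Fact r.Prime := ⟨hg.prime⟩
  obtain ⟨B0, hB0, hdeg, hmon⟩ := lifts_and_natDegree_eq_and_monic
    (f := Int.castRingHom (ZMod r)) (p := g)
    (by rw [lifts_iff_coeff_lifts]; exact fun n => ⟨_, (ZMod.intCast_zmod_cast _)⟩) hg.monic
  have hbase : ∀ c d : ℤ, (c : ZMod r) = 0 → (d : ZMod r) = 0 →
      (B0 + (C d * X + C c)).Monic ∧ (B0 + (C d * X + C c)).natDegree = g.natDegree ∧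
      (B0 + (C d * X + C c)).map (Int.castRingHom (ZMod r)) = g := by
    intro c d hc hd
    have hlt : (C d * X + C c).degree < B0.degree := by
      refine lt_of_le_of_lt degree_linear_le ?_
      rw [degree_eq_natDegree hmon.ne_zero, hdeg]
      exact_mod_cast h1
    refine ⟨hmon.add_of_left hlt, ?_, ?_⟩
    · rw [natDegree_add_eq_left_of_degree_lt hlt, hdeg]
    · simp only [Polynomial.map_add, Polynomial.map_mul, hB0, map_C,
        eq_intCast (Int.castRingHom (ZMod r)), hc, hd]
      simp
  have hc0 : (((-1) ^ g.natDegree + r - B0.coeff 0 : ℤ) : ZMod r) = 0 := by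
    have := hg.coeff h1
    rw [← hB0, coeff_map] at this
    simp only [eq_intCast] at this
    push_cast
    rw [this, hB0]
    simp
  by_cases hmem : aeval hζ.toInteger (B0 + (C 0 * X + C ((-1) ^ g.natDegree + r - B0.coeff 0 : ℤ))) ∈ I ^ 2
  · obtain ⟨h1, h2, h3⟩ := hbase _ (r : ℤ) hc0 (by simp)
    refine ⟨_, h1, h2, h3, by
      simp only [coeff_add, coeff_C_zero, mul_coeff_zero, coeff_X_zero]; ring, fun hmem' => ?_⟩
    have h4 := (I ^ 2).sub_mem hmem' hmem
    have h5 : (r : 𝓞 K) * hζ.toInteger ∈ I ^ 2 := by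
      convert h4 using 1
      simp
    have h6 : (r : 𝓞 K) ∈ I ^ 2 := by
      have := (I ^ 2).mul_mem_right (hζ.toInteger ^ (p - 1)) h5
      rwa [mul_assoc, ← pow_succ', Nat.sub_add_cancel hp.out.one_le,
        hζ.toInteger_isPrimitiveRoot.pow_eq_one, mul_one] at this
    exact stick_unram (p := p) r hg.prime (fun h => hpI (h ▸ hg.mem)) I hg.mem h6
  · obtain ⟨h1, h2, h3⟩ := hbase _ (0 : ℤ) hc0 (by simp)
    exact ⟨_, h1, h2, h3, by
      simp only [coeff_add, coeff_C_zero, mul_coeff_zero, coeff_X_zero]; ring, hmem⟩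

lemma stick_prime_mem (H : Subgroup (ClassGroup (𝓞 K)))
    (h1 : ∀ (I : Ideal (𝓞 K)) (hI : I ∈ (Ideal (𝓞 K))⁰), I.IsPrime → (Ideal.absNorm I).Prime →
      (p : 𝓞 K) ∉ I → ClassGroup.mk0 ⟨I, hI⟩ ∈ H) (n : ℕ) :
    ∀ (I : Ideal (𝓞 K)) (hI : I ∈ (Ideal (𝓞 K))⁰), I.IsPrime → 
      ∀ (r : ℕ) (g : (ZMod r)[X]), StickMin hζ.toInteger I r g → g.natDegree = n →
      ClassGroup.mk0 ⟨I, hI⟩ ∈ H := by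
  induction n using Nat.strong_induction_on with
  | _ n ih =>
  intro I hI hIp r g hg hn
  by_cases hpI : (p : 𝓞 K) ∈ I
  · have : ClassGroup.mk0 ⟨I, hI⟩ = 1 := by
      rw [ClassGroup.mk0_eq_one_iff]
      exact ⟨_, stick_above_p hζ I hpI⟩
    rw [this]; exact H.one_mem
  rcases Nat.lt_or_ge 1 g.natDegree with hlt | hle
  swap
  · have h2 := hg.norm (le_antisymm hle hg.pos)
    exact h1 I hI hIp (h2 ▸ hg.prime) hpI
  obtain ⟨B, hB, hBn, hBg, hB0, hBI⟩ := stick_exists_B hζ I hpI hg hlt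
  have hBmem : aeval hζ.toInteger B ∈ I := by rw [hg.iff, hBg]
  have hBne : aeval hζ.toInteger B ≠ 0 := fun h => hBI (h ▸ zero_mem _)
  obtain ⟨J, hJ⟩ : I ∣ Ideal.span {aeval hζ.toInteger B} := by
    rwa [Ideal.dvd_span_singleton]
  have hne : Ideal.span {aeval hζ.toInteger B} ≠ 0 := by
    simpa [Ideal.span_singleton_eq_bot] using hBne
  have hJ0 : J ∈ (Ideal (𝓞 K))⁰ := by
    apply mem_nonZeroDivisors_of_ne_zero
    rintro rfl
    rw [mul_zero] at hJ
    exact hne hJ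
  have hJH : ClassGroup.mk0 ⟨J, hJ0⟩ ∈ H := by
    refine stick_mk0_mem H J ?_ hJ0
    intro P hP hPJ hP0
    have hPI : P ≠ I := by
      rintro rfl
      apply hBI
      rw [← Ideal.dvd_span_singleton, hJ, pow_two]
      exact mul_dvd_mul_left _ hPJ
    have hPB : aeval hζ.toInteger B ∈ P := by
      rw [← Ideal.dvd_span_singleton, hJ]
      exact hPJ.mul_left _
    have hPp : P.IsPrime := Ideal.isPrime_of_prime hP
    obtain ⟨r', g', hg'⟩ := stick_exists_min hζ P hP.ne_zero
    have : Fact r'.Prime := ⟨hg'.prime⟩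
    have hdvd := (hg'.iff B).1 hPB
    have hBm : (B.map (Int.castRingHom (ZMod r'))).Monic := hB.map _
    have hBd : (B.map (Int.castRingHom (ZMod r'))).natDegree = n := by
      rw [hB.natDegree_map, hBn, hn]
    have hle := natDegree_le_of_dvd hdvd hBm.ne_zero
    rw [hBd] at hle
    rcases hle.lt_or_eq with hlt' | heq
    · exact ih _ hlt' P hP0 hPp r' g' hg' rfl
    exfalso
    have hgB : B.map (Int.castRingHom (ZMod r')) = g' :=
      eq_of_monic_of_dvd_of_natDegree_le hg'.monic hBm hdvd (by rw [hBd, heq])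
    have hc := hg'.coeff (by omega)
    rw [← hgB, coeff_map, hB0, hBd, hn] at hc
    have hr0 : ((r : ℕ) : ZMod r') = 0 := by
      simpa using hc
    rw [ZMod.natCast_eq_zero_iff, Nat.prime_dvd_prime_iff_eq hg'.prime hg.prime] at hr0
    subst hr0
    rw [hBg] at hgB
    subst hgB
    exact hPI (stick_min_unique hζ hg' hg)
  have hprod : ClassGroup.mk0 ⟨I, hI⟩ * ClassGroup.mk0 ⟨J, hJ0⟩ = 1 := by
    rw [← map_mul, ClassGroup.mk0_eq_one_iff]
    exact ⟨_, hJ.symm⟩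
  rw [eq_inv_of_mul_eq_one_left hprod]
  exact H.inv_mem hJH

lemma stick_gen {p : ℕ} [hp : Fact p.Prime] {K : Type*} [Field K] [NumberField K]
    [IsCyclotomicExtension {p} ℚ K] {ζ : K} (hζ : IsPrimitiveRoot ζ p) (H : Subgroup (ClassGroup (𝓞 K)))
    (h1 : ∀ (I : Ideal (𝓞 K)) (hI : I ∈ (Ideal (𝓞 K))⁰), I.IsPrime → (Ideal.absNorm I).Prime →
      (p : 𝓞 K) ∉ I → ClassGroup.mk0 ⟨I, hI⟩ ∈ H) (c : ClassGroup (𝓞 K)) : c ∈ H := by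
  obtain ⟨⟨J, hJ⟩, rfl⟩ := ClassGroup.mk0_surjective c
  refine stick_mk0_mem H J ?_ hJ
  intro P hP _ hP0
  have hPp : P.IsPrime := Ideal.isPrime_of_prime hP
  obtain ⟨r', g', hg'⟩ := stick_exists_min hζ P hP.ne_zero
  exact stick_prime_mem hζ H h1 _ P hP0 hPp r' g' hg' rfl
end gen
section deg

lemma stick_char {p : ℕ} [hp : Fact p.Prime] {O F : Type*} [CommRing O] [IsDomain O] [Field F]
    [Fintype F] (φ : O →+* F) (z : O) (hz : IsPrimitiveRoot z p) (hφ : IsPrimitiveRoot (φ z) p) :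
    ∃ (χ : MulChar F O) (m : ℕ), 0 < m ∧ p * m = Fintype.card F - 1 ∧ χ ^ p = 1 ∧
      (∀ x, φ (χ x) = x ^ m) ∧ ∀ x, x ≠ 0 → ∃ k : ℕ, χ x = z ^ k := by
  classical
  obtain ⟨g, hg⟩ := IsCyclic.exists_generator (α := Fˣ)
  have hcard : Fintype.card Fˣ = Fintype.card F - 1 := Fintype.card_units F
  have hdvd : p ∣ Fintype.card F - 1 := by
    have h0 : φ z ≠ 0 := hφ.ne_zero hp.out.ne_zero
    have := FiniteField.pow_card_sub_one_eq_one (φ z) h0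
    exact hφ.dvd_of_pow_eq_one _ this
  obtain ⟨m, hm⟩ := hdvd
  have hpos : 0 < Fintype.card F - 1 := by
    have := Fintype.one_lt_card (α := F); omega
  have hm0 : 0 < m := by
    rcases Nat.eq_zero_or_pos m with rfl | h
    · omega
    · exact h
  have hgp : ((g : F) ^ m) ^ p = 1 := by
    rw [← pow_mul, mul_comm, ← hm]
    exact FiniteField.pow_card_sub_one_eq_one _ g.ne_zero
  obtain ⟨j, hj, hjg⟩ := hφ.eq_pow_of_pow_eq_one hgp
  have hzu : IsUnit z := hz.isUnit hp.out.ne_zero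
  obtain ⟨u, rfl⟩ := hzu
  have hup : u ^ p = 1 := Units.ext (by simpa using hz.pow_eq_one)
  have hmem : u ^ j ∈ rootsOfUnity (Fintype.card Fˣ) O := by
    rw [mem_rootsOfUnity, hcard, hm, ← pow_mul, mul_comm, mul_assoc, pow_mul, hup, one_pow]
  let χ := MulChar.ofRootOfUnity hmem hg
  have hχg : χ g = (u : O) ^ j := by
    simp [χ, MulChar.ofRootOfUnity_spec]
  have hpowg : ∀ x : F, x ≠ 0 → ∃ n : ℕ, x = (g : F) ^ n := by
    intro x hx
    obtain ⟨n, hn⟩ := (mem_powers_iff_mem_zpowers (x := g)).2 (hg (Units.mk0 x hx))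
    refine ⟨n, ?_⟩
    have := congrArg Units.val hn
    simpa using this.symm
  refine ⟨χ, m, hm0, hm.symm, ?_, ?_, ?_⟩
  · rw [MulChar.eq_iff hg, MulChar.pow_apply_coe, hχg, MulChar.one_apply_coe, ← pow_mul, mul_comm,
      pow_mul, hz.pow_eq_one, one_pow]
  · intro x
    rcases eq_or_ne x 0 with rfl | hx
    · rw [MulChar.map_zero, map_zero, zero_pow hm0.ne']
    · obtain ⟨n, rfl⟩ := hpowg x hx
      rw [map_pow, hχg, map_pow, map_pow, hjg, ← pow_mul, ← pow_mul, mul_comm]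
  · intro x hx
    obtain ⟨n, rfl⟩ := hpowg x hx
    exact ⟨j * n, by rw [map_pow, hχg, pow_mul]⟩

lemma stick_sum_poly {F : Type*} [Field F] [Fintype F] (P : F[X])
    (h : P.natDegree < Fintype.card F - 1) : ∑ x : F, P.eval x = 0 := by
  simp_rw [eval_eq_sum_range]
  rw [Finset.sum_comm]
  refine Finset.sum_eq_zero fun i hi => ?_
  rw [← Finset.mul_sum, FiniteField.sum_pow_lt_card_sub_one, mul_zero]
  rw [Finset.mem_range] at hi
  omega

lemma stick_jacobi_mem {p : ℕ} {O F : Type*} [CommRing O] [IsDomain O] [Field F]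
    [Fintype F] (φ : O →+* F) (χ : MulChar F O) (m : ℕ) (hm0 : 0 < m)
    (hm : p * m = Fintype.card F - 1) (hχ : ∀ x, φ (χ x) = x ^ m) (a b : ℕ) (ha : 0 < a)
    (hb : 0 < b) (hab : a + b < p) : φ (jacobiSum (χ ^ a) (χ ^ b)) = 0 := by
  rw [jacobiSum, map_sum]
  have : ∀ x : F, φ ((χ ^ a) x * (χ ^ b) (1 - x)) =
      ((X ^ (m * a) * (1 - X) ^ (m * b) : F[X])).eval x := by
    intro x
    rw [map_mul, MulChar.pow_apply' _ ha.ne', MulChar.pow_apply' _ hb.ne', map_pow, map_pow,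
      hχ, hχ]
    simp [pow_mul]
  simp_rw [this]
  apply stick_sum_poly
  have h1 : ((X ^ (m * a) * (1 - X) ^ (m * b) : F[X])).natDegree ≤ m * a + m * b := by
    refine natDegree_mul_le.trans (Nat.add_le_add ?_ ?_)
    · simp
    · refine natDegree_pow_le.trans ?_
      have : (1 - X : F[X]).natDegree ≤ 1 := by
        refine (natDegree_sub_le _ _).trans ?_
        simp
      exact (Nat.mul_le_mul_left _ this).trans (mul_one _).le
  refine lt_of_le_of_lt h1 ?_
  rw [← hm, ← mul_add, mul_comm]
  exact Nat.mul_lt_mul_of_pos_right hab hm0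

lemma stick_char_order {p : ℕ} [hp : Fact p.Prime] {O F : Type*} [CommRing O] [IsDomain O]
    [Field F] [Fintype F] (φ : O →+* F) (χ : MulChar F O) (m : ℕ) (hm0 : 0 < m)
    (hm : p * m = Fintype.card F - 1) (hχ : ∀ x, φ (χ x) = x ^ m) (hχp : χ ^ p = 1) :
    orderOf χ = p := by
  refine orderOf_eq_prime hχp ?_
  rintro rfl
  obtain ⟨g, hg⟩ := IsCyclic.exists_generator (α := Fˣ)
  have hord : orderOf g = Fintype.card F - 1 := by
    classical
    rw [orderOf_eq_card_of_forall_mem_zpowers hg, Nat.card_eq_fintype_card, Fintype.card_units]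
  have h := hχ g
  rw [MulChar.one_apply_coe, map_one] at h
  have h2 : g ^ m = 1 := Units.ext (by simpa using h.symm)
  have h3 := Nat.le_of_dvd hm0 (orderOf_dvd_of_pow_eq_one h2)
  have := hp.out.two_le
  rw [hord, ← hm] at h3
  nlinarith

lemma stick_jacobi_mul {p : ℕ} {K : Type*} [Field K] [NumberField K] {F : Type*}
    [Field F] [Fintype F] (χ : MulChar F (𝓞 K)) (hχ : orderOf χ = p) (a b : ℕ)
    (ha : 0 < a) (hb : 0 < b) (hap : a < p) (hbp : b < p) (hab : a + b ≠ p) :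
    jacobiSum (χ ^ a) (χ ^ b) * jacobiSum (χ ^ (p - a)) (χ ^ (p - b)) = Fintype.card F := by
  have hinj : Function.Injective (algebraMap (𝓞 K) K) := RingOfIntegers.coe_injective
  have hne : ∀ n : ℕ, ¬ p ∣ n → χ ^ n ≠ 1 := by
    intro n hn h
    exact hn (hχ ▸ orderOf_dvd_of_pow_eq_one h)
  have hne' : ∀ ψ : MulChar F (𝓞 K), ψ ≠ 1 → ψ.ringHomComp (algebraMap (𝓞 K) K) ≠ 1 := by
    intro ψ hψ
    exact (MulChar.ringHomComp_ne_one_iff hinj).2 hψ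
  have hinv : ∀ n, n < p → χ ^ (p - n) = (χ ^ n)⁻¹ := by
    intro n hn
    rw [eq_inv_iff_mul_eq_one, ← pow_add, Nat.sub_add_cancel hn.le, ← hχ, pow_orderOf_eq_one]
  have hdvd : ∀ n, 0 < n → n < p → ¬ p ∣ n := fun n h1 h2 h => by
    have := Nat.le_of_dvd h1 h; omega
  have hchar : ringChar K ≠ ringChar F := by
    rw [ringChar.eq_zero]
    intro h
    exact (CharP.char_ne_zero_of_finite F (ringChar F)) h.symm
  have h := jacobiSum_mul_jacobiSum_inv (F := F) (F' := K) hchar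
    (hne' _ (hne a (hdvd a ha hap))) (hne' _ (hne b (hdvd b hb hbp))) (by
      rw [← MulChar.ringHomComp_mul]
      refine hne' _ ?_
      rw [← pow_add]
      refine hne _ ?_
      rintro ⟨c, hc⟩
      have h1 : c < 2 := by by_contra h; nlinarith
      interval_cases c <;> omega)
  rw [MulChar.ringHomComp_inv, MulChar.ringHomComp_inv, jacobiSum_ringHomComp,
    jacobiSum_ringHomComp, ← map_mul, ← hinv a hap, ← hinv b hbp] at h
  apply hinj
  rw [h]; simp

lemma stick_jacobi_conj {p : ℕ} {O F : Type*} [CommRing O] [Field F] [Fintype F]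
    (χ : MulChar F O) (z : O) (hz : ∀ x, x ≠ 0 → ∃ k : ℕ, χ x = z ^ k) (hχ : χ ^ p = 1)
    (τ : O →+* O) (a : ℕ) (hτ : τ z = z ^ a) (s t : ℕ) :
    τ (jacobiSum (χ ^ s) (χ ^ t)) = jacobiSum (χ ^ (a * s % p)) (χ ^ (a * t % p)) := by
  have hmod : ∀ n, χ ^ (n % p) = χ ^ n := by
    intro n
    conv_rhs => rw [← Nat.mod_add_div n p, pow_add, pow_mul, hχ, one_pow, mul_one]
  have hcomp : ∀ s, (χ ^ s).ringHomComp τ = χ ^ (a * s) := by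
    intro s
    ext x
    obtain ⟨k, hk⟩ := hz x x.ne_zero
    rw [MulChar.ringHomComp_apply, MulChar.pow_apply_coe, MulChar.pow_apply_coe, hk, map_pow,
      map_pow, hτ, ← pow_mul, ← pow_mul, ← pow_mul]
    congr 1; ring
  rw [hmod, hmod, ← hcomp, ← hcomp, jacobiSum_ringHomComp]

lemma stick_count {p : ℕ} [hp : Fact p.Prime] (a : ℕ) (ha : 0 < a) (hap : a < p) :
    ((Finset.Ico 2 p).filter (fun k => a * k % p < a)).card = a - 1 := by
  have ha0 : (a : ZMod p) ≠ 0 := by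
    rw [Ne, ZMod.natCast_eq_zero_iff]
    intro h; have := Nat.le_of_dvd ha h; omega
  have : a - 1 = (Finset.Ico 1 a).card := by simp
  rw [this]
  refine Finset.card_nbij' (fun k => a * k % p) (fun r => ((r : ZMod p) * (a : ZMod p)⁻¹).val)
    ?_ ?_ ?_ ?_
  · intro k hk
    simp only [Finset.coe_filter, Finset.mem_Ico, Set.mem_ofPred_eq, Finset.coe_Ico, Set.mem_Ico] at hk ⊢
    refine ⟨?_, hk.2⟩
    rw [Nat.one_le_iff_ne_zero]
    intro h
    rcases hp.out.dvd_mul.1 (Nat.dvd_of_mod_eq_zero h) with h | h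
    · have := Nat.le_of_dvd ha h; omega
    · have := Nat.le_of_dvd (by omega) h; omega
  · intro r hr
    simp only [Finset.coe_filter, Finset.mem_Ico, Set.mem_ofPred_eq, Finset.coe_Ico, Set.mem_Ico] at hr ⊢
    set k := ((r : ZMod p) * (a : ZMod p)⁻¹).val with hk
    have hkr : (a : ZMod p) * (k : ZMod p) = r := by
      rw [hk, ZMod.natCast_zmod_val]; field_simp
    have hkp : k < p := ZMod.val_lt _
    have hmod : a * k % p = r := by
      have : ((a * k : ℕ) : ZMod p) = (r : ℕ) := by push_cast; exact hkr
      rw [ZMod.natCast_eq_natCast_iff'] at this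
      rw [this, Nat.mod_eq_of_lt (by omega)]
    refine ⟨⟨?_, hkp⟩, by omega⟩
    by_contra hlt
    have : k = 0 ∨ k = 1 := by omega
    rcases this with h | h
    · rw [h] at hmod; simp at hmod; omega
    · rw [h, mul_one, Nat.mod_eq_of_lt hap] at hmod; omega
  · intro k hk
    simp only [Finset.coe_filter, Finset.mem_Ico, Set.mem_ofPred_eq] at hk
    have : (((a * k % p : ℕ) : ZMod p) * (a : ZMod p)⁻¹) = (k : ZMod p) := by
      rw [ZMod.natCast_mod]; push_cast; field_simp
    simp only [this]
    exact ZMod.val_cast_of_lt hk.1.2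
  · intro r hr
    simp only [Finset.coe_Ico, Set.mem_Ico] at hr
    have : ((a * ((r : ZMod p) * (a : ZMod p)⁻¹).val : ℕ) : ZMod p) = (r : ℕ) := by
      push_cast; rw [ZMod.natCast_zmod_val]; field_simp
    rw [ZMod.natCast_eq_natCast_iff'] at this
    simp only [this]
    exact Nat.mod_eq_of_lt (by omega)
end deg
section fin

lemma stick_mod_sub {p a k : ℕ} (hp : p.Prime) (ha : 0 < a) (hap : a < p) (hk : 2 ≤ k)
    (hkp : k < p) : 0 < a * k % p ∧ a * k % p < p ∧ a * k % p ≠ a ∧ a * (p - 1) % p = p - a ∧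
      a * (p - k) % p = p - a * k % p := by
  have h1 : ∀ j, 0 < j → j < p → 0 < a * j % p := by
    intro j hj hjp
    rw [Nat.pos_iff_ne_zero]
    intro h
    rcases hp.dvd_mul.1 (Nat.dvd_of_mod_eq_zero h) with h | h
    · have := Nat.le_of_dvd ha h; omega
    · have := Nat.le_of_dvd hj h; omega
  have h2 : ∀ j, 0 < j → j < p → a * (p - j) % p = p - a * j % p := by
    intro j hj hjp
    have hpos := h1 j hj hjp
    have hlt := Nat.mod_lt (a * j) hp.pos
    have hpos' := h1 (p - j) (by omega) (by omega)
    have hlt' := Nat.mod_lt (a * (p - j)) hp.pos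
    have hsum : a * (p - j) + a * j = a * p := by rw [← mul_add, Nat.sub_add_cancel hjp.le]
    have : p ∣ a * (p - j) % p + a * j % p := by
      rw [Nat.dvd_iff_mod_eq_zero, ← Nat.add_mod, hsum, Nat.mul_mod_left]
    obtain ⟨c, hc⟩ := this
    have hc1 : c = 1 := by
      have : c < 2 := by by_contra h; nlinarith
      have : c ≠ 0 := by rintro rfl; omega
      omega
    subst hc1
    omega
  refine ⟨h1 k (by omega) hkp, Nat.mod_lt _ hp.pos, ?_, ?_, h2 k (by omega) hkp⟩
  · intro h
    have h3 : a * k ≡ a * 1 [MOD p] := by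
      rw [Nat.ModEq, mul_one, h, Nat.mod_eq_of_lt hap]
    have hc : Nat.gcd p a = 1 := by
      rw [← Nat.coprime_iff_gcd_eq_one, hp.coprime_iff_not_dvd]
      intro h; have := Nat.le_of_dvd ha h; omega
    have h4 := Nat.ModEq.cancel_left_of_coprime hc h3
    rw [Nat.ModEq, Nat.mod_eq_of_lt hkp, Nat.mod_eq_of_lt (by omega)] at h4
    omega
  · have := h2 1 one_pos hp.one_lt
    rwa [mul_one, Nat.mod_eq_of_lt hap] at this

section
lemma stick_int {K : Type*} [Field K] [NumberField K] (I : Ideal (𝓞 K)) (hN : (Ideal.absNorm I).Prime) (x : 𝓞 K) :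
    ∃ n : ℕ, x - n ∈ I := by
  have : Fact (Ideal.absNorm I).Prime := ⟨hN⟩
  have hc : Nat.card (𝓞 K ⧸ I) = Ideal.absNorm I := by
    rw [Ideal.absNorm_apply, Submodule.cardQuot_apply]
  have : Finite (𝓞 K ⧸ I) := Nat.finite_of_card_ne_zero (by rw [hc]; exact hN.ne_zero)
  have : Fintype (𝓞 K ⧸ I) := Fintype.ofFinite _
  rw [Nat.card_eq_fintype_card] at hc
  let e := ZMod.ringEquivOfPrime (𝓞 K ⧸ I) hN hc
  refine ⟨(e.symm (Ideal.Quotient.mk I x)).val, ?_⟩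
  rw [← Ideal.Quotient.eq_zero_iff_mem, map_sub, sub_eq_zero, map_natCast]
  conv_lhs => rw [← e.apply_symm_apply (Ideal.Quotient.mk I x)]
  conv_lhs => rw [← ZMod.natCast_zmod_val (e.symm (Ideal.Quotient.mk I x)), map_natCast]

lemma stick_P_inj {p : ℕ} [hp : Fact p.Prime] {K : Type*} [Field K] [NumberField K]
    [IsCyclotomicExtension {p} ℚ K] {ζ : K} (hζ : IsPrimitiveRoot ζ p)
    (I : Ideal (𝓞 K)) [hI : I.IsPrime] (hN : (Ideal.absNorm I).Prime) (hpI : (p : 𝓞 K) ∉ I)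
    (a : ℕ → ℕ) (hap : ∀ j, a j < p)
    (hinj : Set.InjOn a (Finset.range (p - 1) : Set ℕ))
    (τ : ℕ → (𝓞 K ≃+* 𝓞 K)) (hτ : ∀ j, τ j hζ.toInteger = hζ.toInteger ^ a j)
    : Set.InjOn (fun j => I.comap (τ j)) (Finset.range (p - 1) : Set ℕ) := by
  intro i hi j hj hij
  apply hinj hi hj
  have hmax : I.IsMaximal := hI.isMaximal (by
    rintro rfl
    simp at hN
    exact absurd hN (by decide))
  let _ : Field (𝓞 K ⧸ I) := Ideal.Quotient.field I
  have hprim := stick_root_prim hζ (Ideal.Quotient.mk I) (by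
    intro h
    rw [← map_natCast (Ideal.Quotient.mk I), Ideal.Quotient.eq_zero_iff_mem] at h
    exact hpI h)
  obtain ⟨n, hn⟩ := stick_int I hN (hζ.toInteger ^ a i)
  have h1 : hζ.toInteger - n ∈ I.comap (τ i) := by
    rw [Ideal.mem_comap, map_sub, map_natCast, hτ]; exact hn
  have h2 : hζ.toInteger - n ∈ I.comap (τ j) := by
    have : I.comap (τ i) = I.comap (τ j) := hij
    rw [← this]; exact h1
  rw [Ideal.mem_comap, map_sub, map_natCast, hτ] at h2
  have h3 := I.sub_mem hn h2
  rw [sub_sub_sub_cancel_right, ← Ideal.Quotient.eq_zero_iff_mem, map_sub, sub_eq_zero, map_pow,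
    map_pow] at h3
  exact hprim.pow_inj (hap i) (hap j) h3

lemma stick_P_norm {K : Type*} [Field K] [NumberField K] (I : Ideal (𝓞 K)) (e : 𝓞 K ≃+* 𝓞 K) :
    Ideal.absNorm (I.comap e) = Ideal.absNorm I := by
  rw [Ideal.absNorm_apply, Ideal.absNorm_apply, Submodule.cardQuot_apply,
    Submodule.cardQuot_apply]
  refine Nat.card_congr (Ideal.quotientEquiv (I.comap e) I e ?_).toEquiv
  exact (Ideal.map_comap_of_surjective _ e.surjective I).symm

lemma stick_P_ne {K : Type*} [Field K] [NumberField K] (I : Ideal (𝓞 K)) (hN : (Ideal.absNorm I).Prime) (e : 𝓞 K ≃+* 𝓞 K) :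
    I.comap e ≠ ⊥ := by
  intro h
  have := stick_P_norm I e
  rw [h, Ideal.absNorm_bot] at this
  exact hN.ne_zero this.symm

lemma stick_dvd {p : ℕ} [hp : Fact p.Prime] {K : Type*} [Field K] [NumberField K]
    [IsCyclotomicExtension {p} ℚ K] {ζ : K} (hζ : IsPrimitiveRoot ζ p)
    (I : Ideal (𝓞 K)) [hI : I.IsPrime] (hN : (Ideal.absNorm I).Prime) (hpI : (p : 𝓞 K) ∉ I)
    (a : ℕ → ℕ) (hap : ∀ j, a j < p)
    (hinj : Set.InjOn a (Finset.range (p - 1) : Set ℕ))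
    (τ : ℕ → (𝓞 K ≃+* 𝓞 K)) (hτ : ∀ j, τ j hζ.toInteger = hζ.toInteger ^ a j)
    (s : Finset ℕ) (hs : s ⊆ Finset.range (p - 1)) (x : 𝓞 K)
    (h : ∀ j ∈ s, τ j x ∈ I) : ∏ j ∈ s, I.comap (τ j) ∣ Ideal.span {x} := by
  classical
  have hinj' := stick_P_inj hζ I hN hpI a hap hinj τ hτ
  have : ∏ j ∈ s, I.comap (τ j) = ∏ P ∈ s.image (fun j => I.comap (τ j)), P := by
    rw [Finset.prod_image]
    intro i hi j hj hij
    exact hinj' (hs hi) (hs hj) hij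
  rw [this]
  apply Finset.prod_primes_dvd
  · intro P hP
    obtain ⟨j, hj, rfl⟩ := Finset.mem_image.1 hP
    exact Ideal.prime_of_isPrime (stick_P_ne I hN _) (Ideal.comap_isPrime _ _)
  · intro P hP
    obtain ⟨j, hj, rfl⟩ := Finset.mem_image.1 hP
    rw [Ideal.dvd_span_singleton, Ideal.mem_comap]
    exact h j hj

lemma stick_full {p : ℕ} [hp : Fact p.Prime] {K : Type*} [Field K] [NumberField K]
    [IsCyclotomicExtension {p} ℚ K] {ζ : K} (hζ : IsPrimitiveRoot ζ p)
    (I : Ideal (𝓞 K)) [hI : I.IsPrime] (hN : (Ideal.absNorm I).Prime) (hpI : (p : 𝓞 K) ∉ I)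
    (a : ℕ → ℕ) (hap : ∀ j, a j < p)
    (hinj : Set.InjOn a (Finset.range (p - 1) : Set ℕ))
    (τ : ℕ → (𝓞 K ≃+* 𝓞 K)) (hτ : ∀ j, τ j hζ.toInteger = hζ.toInteger ^ a j)
    : ∏ j ∈ Finset.range (p - 1), I.comap (τ j) =
    Ideal.span {((Ideal.absNorm I : ℕ) : 𝓞 K)} := by
  have hdvd := stick_dvd hζ I hN hpI a hap hinj τ hτ (Finset.range (p - 1)) subset_rfl
    ((Ideal.absNorm I : ℕ) : 𝓞 K) (by
      intro j _
      rw [map_natCast]; exact Ideal.absNorm_mem I)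
  obtain ⟨J, hJ⟩ := hdvd
  have hn := congrArg Ideal.absNorm hJ
  rw [map_mul, map_prod] at hn
  simp only [stick_P_norm] at hn
  rw [Finset.prod_const, Finset.card_range, Ideal.absNorm_span_natCast, RingOfIntegers.rank,
    IsCyclotomicExtension.Rat.finrank p K, Nat.totient_prime hp.out] at hn
  have h1 : Ideal.absNorm J = 1 := by
    have hpos : 0 < Ideal.absNorm I ^ (p - 1) := pow_pos hN.pos _
    exact Nat.eq_of_mul_eq_mul_left hpos (by rw [mul_one]; exact hn.symm)
  rw [Ideal.absNorm_eq_one_iff] at h1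
  rw [hJ, h1, Ideal.mul_top]

lemma stick_part {p : ℕ} [hp : Fact p.Prime] {K : Type*} [Field K] [NumberField K]
    [IsCyclotomicExtension {p} ℚ K] {ζ : K} (hζ : IsPrimitiveRoot ζ p)
    (I : Ideal (𝓞 K)) [hI : I.IsPrime] (hN : (Ideal.absNorm I).Prime) (hpI : (p : 𝓞 K) ∉ I)
    (a : ℕ → ℕ) (ha : ∀ j, 0 < a j) (hap : ∀ j, a j < p)
    (hinj : Set.InjOn a (Finset.range (p - 1) : Set ℕ))
    (τ : ℕ → (𝓞 K ≃+* 𝓞 K)) (hτ : ∀ j, τ j hζ.toInteger = hζ.toInteger ^ a j)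
    (k : ℕ) (hk : 2 ≤ k) (hkp : k < p) : ∃ x : 𝓞 K,
    ∏ j ∈ (Finset.range (p - 1)).filter (fun j => a j * k % p < a j), I.comap (τ j) =
      Ideal.span {x} := by
  classical
  have hbot : I ≠ ⊥ := by
    rintro rfl
    simp at hN
    exact absurd hN (by decide)
  have hmax : I.IsMaximal := hI.isMaximal hbot
  let _ : Field (𝓞 K ⧸ I) := Ideal.Quotient.field I
  have hc : Nat.card (𝓞 K ⧸ I) = Ideal.absNorm I := by
    rw [Ideal.absNorm_apply, Submodule.cardQuot_apply]
  have : Finite (𝓞 K ⧸ I) := Nat.finite_of_card_ne_zero (by rw [hc]; exact hN.ne_zero)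
  let _ : Fintype (𝓞 K ⧸ I) := Fintype.ofFinite _
  rw [Nat.card_eq_fintype_card] at hc
  have hprim := stick_root_prim hζ (Ideal.Quotient.mk I) (by
    intro h
    rw [← map_natCast (Ideal.Quotient.mk I), Ideal.Quotient.eq_zero_iff_mem] at h
    exact hpI h)
  obtain ⟨χ, m, hm0, hm, hχp, hχ, hχz⟩ := stick_char (Ideal.Quotient.mk I) hζ.toInteger
    hζ.toInteger_isPrimitiveRoot hprim
  have hord := stick_char_order _ χ m hm0 hm hχ hχp
  have hp2 := hp.out.two_le
  set A := jacobiSum (χ ^ (p - 1)) (χ ^ k) with hA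
  set B := jacobiSum (χ ^ 1) (χ ^ (p - k)) with hB
  have hAB : A * B = (Ideal.absNorm I : ℕ) := by
    have := stick_jacobi_mul χ hord (p - 1) k (by omega) (by omega) (by omega) hkp (by omega)
    rw [hc, show p - (p - 1) = 1 by omega] at this
    exact this
  set s := (Finset.range (p - 1)).filter (fun j => a j * k % p < a j) with hs
  set t := (Finset.range (p - 1)).filter (fun j => ¬ a j * k % p < a j) with ht
  have hsA : ∏ j ∈ s, I.comap (τ j) ∣ Ideal.span {A} := by
    refine stick_dvd hζ I hN hpI a hap hinj τ hτ s (Finset.filter_subset _ _) A ?_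
    intro j hj
    have hlt := (Finset.mem_filter.1 hj).2
    obtain ⟨h1, h2, h3, h4, h5⟩ := stick_mod_sub hp.out (ha j) (hap j) hk hkp
    have h6 := stick_jacobi_conj χ _ hχz hχp (τ j : 𝓞 K →+* 𝓞 K) (a j) (hτ j) (p - 1) k
    rw [← hA] at h6
    rw [← Ideal.Quotient.eq_zero_iff_mem]
    change Ideal.Quotient.mk I ((τ j : 𝓞 K →+* 𝓞 K) A) = 0
    rw [h6, h4]
    have := hap j
    exact stick_jacobi_mem _ χ m hm0 hm hχ _ _ (by omega) h1 (by omega)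
  have htB : ∏ j ∈ t, I.comap (τ j) ∣ Ideal.span {B} := by
    refine stick_dvd hζ I hN hpI a hap hinj τ hτ t (Finset.filter_subset _ _) B ?_
    intro j hj
    have hlt := (Finset.mem_filter.1 hj).2
    obtain ⟨h1, h2, h3, h4, h5⟩ := stick_mod_sub hp.out (ha j) (hap j) hk hkp
    have h6 := stick_jacobi_conj χ _ hχz hχp (τ j : 𝓞 K →+* 𝓞 K) (a j) (hτ j) 1 (p - k)
    rw [← hB] at h6
    rw [← Ideal.Quotient.eq_zero_iff_mem]
    change Ideal.Quotient.mk I ((τ j : 𝓞 K →+* 𝓞 K) B) = 0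
    rw [h6, h5, mul_one, Nat.mod_eq_of_lt (hap j)]
    have := hap j
    exact stick_jacobi_mem _ χ m hm0 hm hχ _ _ (ha j) (by omega) (by omega)
  have hprod : (∏ j ∈ s, I.comap (τ j)) * (∏ j ∈ t, I.comap (τ j)) =
      Ideal.span {A} * Ideal.span {B} := by
    rw [Finset.prod_filter_mul_prod_filter_not, Ideal.span_singleton_mul_span_singleton, hAB]
    exact stick_full hζ I hN hpI a hap hinj τ hτ
  obtain ⟨X, hX⟩ := hsA
  obtain ⟨Y, hY⟩ := htB
  have hS0 : (∏ j ∈ s, I.comap (τ j)) * (∏ j ∈ t, I.comap (τ j)) ≠ 0 := by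
    refine mul_ne_zero ?_ ?_ <;> exact Finset.prod_ne_zero_iff.2 fun j _ => stick_P_ne I hN _
  have hXY : X * Y = 1 := by
    apply mul_left_cancel₀ hS0
    rw [mul_one, mul_mul_mul_comm, ← hX, ← hY, ← hprod]
  have hX1 : X = 1 := by
    rw [Ideal.one_eq_top, ← Ideal.isUnit_iff]
    exact IsUnit.of_mul_eq_one _ hXY
  exact ⟨A, by rw [hX, hX1, mul_one]⟩
end
end fin
end stickhelpers

open NumberField Finset nonZeroDivisors

theorem statement0
    (p : ℕ) (hp : p.Prime) (hp2 : p ≠ 2)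
    (v : ℕ) (hv1 : 1 ≤ v) (hv2 : v ≤ p - 1)
    (hv : orderOf (v : ZMod p) = p - 1)
    (vn : ℤ → ℕ)
    (hvn1 : ∀ n : ℤ, 1 ≤ vn n) (hvn2 : ∀ n : ℤ, vn n ≤ p - 1)
    (hvn0 : vn 0 = 1)
    (hvnrec : ∀ n : ℤ, (vn (n + 1) : ZMod p) = (v : ZMod p) * (vn n : ZMod p))
    (K : Type*) [Field K] [NumberField K]
    [IsCyclotomicExtension {p} ℚ K]
    (ζ : K) (hζ : IsPrimitiveRoot ζ p)
    (σ : K ≃ₐ[ℚ] K) (hσ : σ ζ = ζ ^ v)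
    (σ' : 𝓞 K ≃+* 𝓞 K)
    (hσ' : ∀ x : 𝓞 K, algebraMap (𝓞 K) K (σ' x) = σ (algebraMap (𝓞 K) K x))
    (T : MulAut (ClassGroup (𝓞 K)))
    (hT : ∀ I J : (Ideal (𝓞 K))⁰,
      Ideal.map σ' (I : Ideal (𝓞 K)) = (J : Ideal (𝓞 K)) →
      T (ClassGroup.mk0 I) = ClassGroup.mk0 J) :
    ∀ c : ClassGroup (𝓞 K),
      ∏ i ∈ Finset.range (p - 1), ((T ^ i) c) ^ (vn (-(i : ℤ))) = 1 := by
  classical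
  have hpf : Fact p.Prime := ⟨hp⟩
  have hp1 := hp.one_lt
  let a : ℕ → ℕ := fun j => vn (-(j : ℤ))
  have ha : ∀ j, 0 < a j := fun j => hvn1 _
  have hap : ∀ j, a j < p := fun j => by
    have := hvn2 (-(j : ℤ))
    change vn (-(j : ℤ)) < p
    omega
  have hstep : ∀ j, (a j : ZMod p) = (v : ZMod p) * (a (j + 1) : ZMod p) := by
    intro j
    have := hvnrec (-((j + 1 : ℕ) : ℤ))
    rw [show -((j + 1 : ℕ) : ℤ) + 1 = -(j : ℤ) by push_cast; ring] at this
    exact this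
  have hmul : ∀ j, (v : ZMod p) ^ j * (a j : ZMod p) = 1 := by
    intro j
    induction j with
    | zero => simp [a, hvn0]
    | succ j ih => rw [← ih, hstep j, pow_succ, mul_assoc]
  have hinj : Set.InjOn a (Finset.range (p - 1) : Set ℕ) := by
    intro i hi j hj hij
    have h1 := hmul i
    have h2 := hmul j
    rw [hij] at h1
    have hne : (a j : ZMod p) ≠ 0 := right_ne_zero_of_mul_eq_one h2
    have h3 : (v : ZMod p) ^ i = (v : ZMod p) ^ j := mul_right_cancel₀ hne (h1.trans h2.symm)
    refine pow_injOn_Iio_orderOf ?_ ?_ h3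
    · rw [hv]; simpa using hi
    · rw [hv]; simpa using hj
  -- the automorphisms
  let τ : ℕ → (𝓞 K ≃+* 𝓞 K) := fun j =>
    Nat.rec (RingEquiv.refl _) (fun _ e => e.trans σ'.symm) j
  have hτ0 : ∀ x, τ 0 x = x := fun x => rfl
  have hτs : ∀ j x, τ (j + 1) x = σ'.symm (τ j x) := fun j x => rfl
  have hτs' : ∀ j x, τ (j + 1) x = τ j (σ'.symm x) := by
    intro j
    induction j with
    | zero => intro x; rfl
    | succ j ih => intro x; rw [hτs (j + 1), ih, ← hτs]
  have hσz : σ' hζ.toInteger = hζ.toInteger ^ v := by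
    apply RingOfIntegers.coe_injective
    rw [hσ', map_pow]
    exact hσ
  have hτ : ∀ j, τ j hζ.toInteger = hζ.toInteger ^ a j := by
    intro j
    induction j with
    | zero => rw [hτ0]; simp [a, hvn0]
    | succ j ih =>
      rw [hτs, ih, RingEquiv.symm_apply_eq, map_pow, hσz, ← pow_mul]
      have h1 : a j ≡ v * a (j + 1) [MOD p] := by
        rw [← ZMod.natCast_eq_natCast_iff, hstep j]; push_cast; rfl
      have hz := hζ.toInteger_isPrimitiveRoot
      rw [← pow_mod_orderOf, ← pow_mod_orderOf (hζ.toInteger) (v * a (j + 1)), ← hz.eq_orderOf, h1]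
  let Φ : ClassGroup (𝓞 K) →* ClassGroup (𝓞 K) :=
    ∏ i ∈ Finset.range (p - 1), (powMonoidHom (vn (-(i : ℤ)))).comp (T ^ i).toMonoidHom
  have hΦ : ∀ c, Φ c = ∏ i ∈ Finset.range (p - 1), ((T ^ i) c) ^ (vn (-(i : ℤ))) := by
    intro c
    simp only [Φ, MonoidHom.finsetProd_apply]
    rfl
  intro c
  rw [← hΦ]
  change c ∈ Φ.ker
  refine stick_gen hζ Φ.ker ?_ c
  intro I hI0 hI hN hpI
  rw [MonoidHom.mem_ker, hΦ]
  have hP0 : ∀ j, I.comap (τ j) ∈ (Ideal (𝓞 K))⁰ := fun j =>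
    mem_nonZeroDivisors_of_ne_zero (stick_P_ne I hN (τ j))
  have hTj : ∀ j, (T ^ j) (ClassGroup.mk0 ⟨I, hI0⟩) = ClassGroup.mk0 ⟨I.comap (τ j), hP0 j⟩ := by
    intro j
    induction j with
    | zero => rfl
    | succ j ih =>
      rw [pow_succ', MulAut.mul_apply, ih]
      apply hT
      change Ideal.map σ' (I.comap (τ j)) = I.comap (τ (j + 1))
      rw [← Ideal.comap_symm]
      ext x
      rw [Ideal.mem_comap, Ideal.mem_comap, Ideal.mem_comap, hτs']
  have hprod : ∀ (s : Finset ℕ) (x : 𝓞 K), ∏ j ∈ s, I.comap (τ j) = Ideal.span {x} →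
      ∏ j ∈ s, (T ^ j) (ClassGroup.mk0 ⟨I, hI0⟩) = 1 := by
    intro s x hx
    simp only [hTj]
    rw [← map_prod, ClassGroup.mk0_eq_one_iff]
    have : ((∏ j ∈ s, (⟨I.comap (τ j), hP0 j⟩ : (Ideal (𝓞 K))⁰) : (Ideal (𝓞 K))⁰) :
        Ideal (𝓞 K)) = Ideal.span {x} := by
      rw [← hx]; simp
    rw [this]
    exact ⟨x, rfl⟩
  set d : ℕ → ClassGroup (𝓞 K) := fun j => (T ^ j) (ClassGroup.mk0 ⟨I, hI0⟩) with hd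
  have hfull : ∏ j ∈ Finset.range (p - 1), d j = 1 :=
    hprod _ _ (stick_full hζ I hN hpI a hap hinj τ hτ)
  have hpart : ∀ k ∈ Finset.Ico 2 p,
      ∏ j ∈ Finset.range (p - 1), (if a j * k % p < a j then d j else 1) = 1 := by
    intro k hk
    rw [Finset.mem_Ico] at hk
    obtain ⟨x, hx⟩ := stick_part hζ I hN hpI a ha hap hinj τ hτ k hk.1 hk.2
    rw [← Finset.prod_filter]
    exact hprod _ _ hx
  have hall := Finset.prod_eq_one hpart
  rw [Finset.prod_comm] at hall
  have hcount : ∀ j, ∏ k ∈ Finset.Ico 2 p, (if a j * k % p < a j then d j else 1) =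
      d j ^ (a j - 1) := by
    intro j
    rw [← Finset.prod_filter, Finset.prod_const, stick_count (a j) (ha j) (hap j)]
  simp only [hcount] at hall
  calc ∏ i ∈ Finset.range (p - 1), d i ^ (a i)
      = ∏ i ∈ Finset.range (p - 1), (d i ^ (a i - 1) * d i) := by
        refine Finset.prod_congr rfl fun i _ => ?_
        rw [← pow_succ, Nat.sub_add_cancel (ha i)]
    _ = 1 := by rw [Finset.prod_mul_distrib, hall, hfull, mul_one]
end

section
/- For every ideal class c of O_K with c^p = 1, one has ∏_{i=1}^{p-2} (σ^i(c))^{δ_i} = 1; that is, the polynomial Q(σ) = Σ_{i=1}^{p-2} δ_i·σ^i annihilates the p-class group of K (the subgroup of exponent p of the ideal class group Cl(K)). -/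
open NumberField Finset nonZeroDivisors



section
variable {K : Type*} [Field K] [NumberField K]

theorem stk_hom_ext {R : Type*} [CommRing R] {z : 𝓞 K} (hadj : Algebra.adjoin ℤ {z} = ⊤)
    (f g : 𝓞 K →+* R) (h : f z = g z) : f = g := by
  have : f.toIntAlgHom = g.toIntAlgHom := by
    apply AlgHom.ext_of_adjoin_eq_top hadj
    intro x hx
    simp only [Set.mem_singleton_iff] at hx
    subst hx
    exact h
  ext x
  exact DFunLike.congr_fun this x

theorem stk_pow_z {s : RingAut (𝓞 K)} {z : 𝓞 K} {v : ℕ} (hs : s z = z ^ v) (i : ℕ) :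
    (s ^ i) z = z ^ (v ^ i) := by
  induction i with
  | zero => simp
  | succ n ih => rw [pow_succ', RingAut.mul_apply, ih, map_pow, hs, ← pow_mul, pow_succ']

theorem stk_pow_congr {M : Type*} [Monoid M] {z : M} {p a b : ℕ} (hz : z ^ p = 1)
    (h : (a : ZMod p) = b) : z ^ a = z ^ b := by
  rw [ZMod.natCast_eq_natCast_iff] at h
  rw [pow_eq_pow_mod a hz, pow_eq_pow_mod b hz, h]

theorem stk_pow_inj {M : Type*} [CommMonoid M] {z : M} {p a b : ℕ} (hp : 0 < p)
    (hz : IsPrimitiveRoot z p) (h : z ^ a = z ^ b) : a ≡ b [MOD p] := by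
  rw [pow_eq_pow_mod a hz.pow_eq_one, pow_eq_pow_mod b hz.pow_eq_one] at h
  exact hz.pow_inj (Nat.mod_lt _ hp) (Nat.mod_lt _ hp) h

theorem stk_card_aux {F : Type*} [CommRing F] [IsDomain F] [Finite F] {l : ℕ} [hl : Fact l.Prime]
    [CharP F l] (hx : ∀ x : F, x ^ l = x) : Nat.card F = l := by
  haveI := Fintype.ofFinite F
  apply le_antisymm
  · rw [Nat.card_eq_fintype_card]
    classical
    have hdeg : (Polynomial.X ^ l - Polynomial.X : Polynomial F).natDegree = l := by
      rw [Polynomial.natDegree_sub_eq_left_of_natDegree_lt] <;>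
        simp [hl.out.one_lt]
    have hne : (Polynomial.X ^ l - Polynomial.X : Polynomial F) ≠ 0 := by
      intro h
      rw [h, Polynomial.natDegree_zero] at hdeg
      exact hl.out.ne_zero hdeg.symm
    have h1 := Polynomial.card_roots' (Polynomial.X ^ l - Polynomial.X : Polynomial F)
    rw [hdeg] at h1
    refine le_trans ?_ h1
    refine le_trans ?_ (Multiset.toFinset_card_le _)
    rw [← Finset.card_univ]
    apply Finset.card_le_card
    intro x _
    rw [Multiset.mem_toFinset, Polynomial.mem_roots hne]
    simp [hx x]
  · have := Nat.card_le_card_of_injective _ (ZMod.castHom_injective (n := l) F)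
    simpa using this

theorem stk_charP {l : ℕ} (hl : l.Prime) (Q : Ideal (𝓞 K)) [Q.IsPrime]
    (hlQ : (l : 𝓞 K) ∈ Q) : CharP (𝓞 K ⧸ Q) l := by
  refine ringChar.of_eq (CharP.ringChar_of_prime_eq_zero hl ?_)
  rw [← map_natCast (Ideal.Quotient.mk Q)]
  exact Ideal.Quotient.eq_zero_iff_mem.mpr hlQ

theorem stk_frob {s : RingAut (𝓞 K)} {z : 𝓞 K} {v : ℕ} (hs : s z = z ^ v)
    (hadj : Algebra.adjoin ℤ {z} = ⊤) {p : ℕ} (hz : IsPrimitiveRoot z p)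
    {l i : ℕ} (hl : l.Prime) (hi : ((v ^ i : ℕ) : ZMod p) = l) (Q : Ideal (𝓞 K)) [Q.IsPrime]
    (hlQ : (l : 𝓞 K) ∈ Q) (x : 𝓞 K) : (s ^ i) x - x ^ l ∈ Q := by
  haveI : Fact l.Prime := ⟨hl⟩
  haveI : CharP (𝓞 K ⧸ Q) l := stk_charP hl Q hlQ
  have := stk_hom_ext hadj ((Ideal.Quotient.mk Q).comp ((s ^ i : RingAut (𝓞 K)) : 𝓞 K →+* 𝓞 K))
    ((frobenius (𝓞 K ⧸ Q) l).comp (Ideal.Quotient.mk Q)) (by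
      simp only [RingHom.comp_apply, RingHom.coe_coe, frobenius_def, ← map_pow]
      rw [stk_pow_z hs]
      congr 1
      exact stk_pow_congr hz.pow_eq_one hi)
  have := DFunLike.congr_fun this x
  simp only [RingHom.comp_apply, RingHom.coe_coe, frobenius_def, ← map_pow] at this
  exact Ideal.Quotient.eq.mp this

theorem stk_prim {z : 𝓞 K} {p : ℕ} (hp : p.Prime) (hz : IsPrimitiveRoot z p)
    (Q : Ideal (𝓞 K)) [Q.IsPrime] (hpQ : (p : 𝓞 K) ∉ Q) :
    IsPrimitiveRoot (Ideal.Quotient.mk Q z) p := by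
  haveI : Fact p.Prime := ⟨hp⟩
  have h1 : Ideal.Quotient.mk Q z ≠ 1 := by
    intro h
    apply hpQ
    have := hz.geom_sum_eq_zero hp.one_lt
    apply_fun (Ideal.Quotient.mk Q) at this
    simp only [map_sum, map_pow, h, one_pow, map_zero, Finset.sum_const, card_range,
      nsmul_eq_mul, mul_one] at this
    rw [← map_natCast (Ideal.Quotient.mk Q)] at this
    exact Ideal.Quotient.eq_zero_iff_mem.mp this
  have h2 : (Ideal.Quotient.mk Q z) ^ p = 1 := by rw [← map_pow, hz.pow_eq_one, map_one]
  have := orderOf_eq_prime h2 h1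
  exact this ▸ IsPrimitiveRoot.orderOf _

theorem stk_card {z : 𝓞 K} (hadj : Algebra.adjoin ℤ {z} = ⊤)
    {p : ℕ} (hz : IsPrimitiveRoot z p)
    {l : ℕ} (hl : l.Prime) (hl1 : (l : ZMod p) = 1) (Q : Ideal (𝓞 K)) [Q.IsPrime] (hQ : Q ≠ ⊥)
    (hlQ : (l : 𝓞 K) ∈ Q) : Nat.card (𝓞 K ⧸ Q) = l := by
  haveI : Fact l.Prime := ⟨hl⟩
  haveI : CharP (𝓞 K ⧸ Q) l := stk_charP hl Q hlQ
  haveI : Finite (𝓞 K ⧸ Q) := Ring.HasFiniteQuotients.finiteQuotient hQ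
  apply stk_card_aux
  intro x
  obtain ⟨y, rfl⟩ := Ideal.Quotient.mk_surjective x
  have := stk_frob (s := 1) (v := 1) (z := z) (by simp) hadj hz (i := 1) hl (by simp [hl1]) Q hlQ y
  rw [← map_pow]
  symm
  rw [Ideal.Quotient.eq]
  exact this

theorem stk_map_prime (s : RingAut (𝓞 K)) (Q : Ideal (𝓞 K)) [Q.IsPrime] :
    (Ideal.map s Q).IsPrime := Ideal.map_isPrime_of_equiv s

theorem stk_distinct {s : RingAut (𝓞 K)} {z : 𝓞 K} {v : ℕ} (hs : s z = z ^ v)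
    (hadj : Algebra.adjoin ℤ {z} = ⊤)
    {p : ℕ} (hp : p.Prime) (hz : IsPrimitiveRoot z p) (hv : orderOf (v : ZMod p) = p - 1)
    {l : ℕ} (hl : l.Prime) (hl1 : (l : ZMod p) = 1) (Q : Ideal (𝓞 K)) [Q.IsPrime] (hQ : Q ≠ ⊥)
    (hlQ : (l : 𝓞 K) ∈ Q) (hpQ : (p : 𝓞 K) ∉ Q) :
    Set.InjOn (fun i : ℕ => Ideal.map (s ^ i) Q) (Finset.range (p - 1)) := by
  haveI : Fact l.Prime := ⟨hl⟩
  haveI : Fact p.Prime := ⟨hp⟩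
  haveI : CharP (𝓞 K ⧸ Q) l := stk_charP hl Q hlQ
  haveI : Finite (𝓞 K ⧸ Q) := Ring.HasFiniteQuotients.finiteQuotient hQ
  haveI := Fintype.ofFinite (𝓞 K ⧸ Q)
  have hc := stk_card hadj hz hl hl1 Q hQ hlQ
  have hbij : Function.Bijective (ZMod.castHom (dvd_refl l) (𝓞 K ⧸ Q)) := by
    rw [Fintype.bijective_iff_injective_and_card]
    refine ⟨ZMod.castHom_injective _, ?_⟩
    rw [ZMod.card, ← Nat.card_eq_fintype_card, hc]
  obtain ⟨a, ha⟩ := hbij.2 (Ideal.Quotient.mk Q z)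
  have ha' : z - (a.val : 𝓞 K) ∈ Q := by
    rw [← Ideal.Quotient.eq, ← ha, map_natCast]
    simp
  have hprim := stk_prim hp hz Q hpQ
  intro i hi j hj hij
  simp only [Finset.coe_range, Set.mem_Iio] at hi hj
  simp only at hij
  -- z^(v^i) - a and z^(v^j) - a lie in the same prime
  have hvi : (z ^ (v ^ i) - (a.val : 𝓞 K)) ∈ Ideal.map (s ^ i) Q := by
    have := Ideal.mem_map_of_mem (s ^ i) ha'
    rwa [map_sub, stk_pow_z hs, map_natCast] at this
  have hvj : (z ^ (v ^ j) - (a.val : 𝓞 K)) ∈ Ideal.map (s ^ i) Q := by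
    have := Ideal.mem_map_of_mem (s ^ j) ha'
    rw [hij]
    rwa [map_sub, stk_pow_z hs, map_natCast] at this
  haveI := stk_map_prime (s ^ i) Q
  have hpQ' : (p : 𝓞 K) ∉ Ideal.map (s ^ i) Q := by
    intro h
    rw [Ideal.mem_map_of_equiv] at h
    obtain ⟨x, hx, hx'⟩ := h
    rw [← map_natCast (s ^ i) p] at hx'
    rw [(s ^ i).injective hx'] at hx
    exact hpQ hx
  have hprim' := stk_prim hp hz _ hpQ'
  have h := sub_mem hvi hvj
  have h2 : z ^ (v ^ i) - z ^ (v ^ j) ∈ Ideal.map (s ^ i) Q := by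
    simpa using h
  rw [← Ideal.Quotient.eq, map_pow, map_pow] at h2
  have h3 := stk_pow_inj hp.pos hprim' h2
  rw [← ZMod.natCast_eq_natCast_iff, Nat.cast_pow, Nat.cast_pow] at h3
  have hvp : IsPrimitiveRoot (v : ZMod p) (p - 1) := hv ▸ IsPrimitiveRoot.orderOf _
  exact hvp.pow_inj hi hj h3

theorem stk_prod {s : RingAut (𝓞 K)} {z : 𝓞 K} {v : ℕ} (hs : s z = z ^ v)
    (hadj : Algebra.adjoin ℤ {z} = ⊤)
    {p : ℕ} (hp : p.Prime) (hz : IsPrimitiveRoot z p) (hv : orderOf (v : ZMod p) = p - 1)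
    (hrank : Module.finrank ℤ (𝓞 K) = p - 1)
    {l : ℕ} (hl : l.Prime) (hl1 : (l : ZMod p) = 1) (Q : Ideal (𝓞 K)) [Q.IsPrime] (hQ : Q ≠ ⊥)
    (hlQ : (l : 𝓞 K) ∈ Q) (hpQ : (p : 𝓞 K) ∉ Q) :
    ∏ i ∈ Finset.range (p - 1), Ideal.map (s ^ i) Q = Ideal.span {(l : 𝓞 K)} := by
  have hinj := stk_distinct hs hadj hp hz hv hl hl1 Q hQ hlQ hpQ
  have hc := stk_card hadj hz hl hl1 Q hQ hlQ
  have hdvd : ∏ i ∈ Finset.range (p - 1), Ideal.map (s ^ i) Q ∣ Ideal.span {(l : 𝓞 K)} := by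
    classical
    rw [← Finset.prod_image (f := fun I => I) hinj]
    apply Finset.prod_primes_dvd
    · intro a ha
      rw [Finset.mem_image] at ha
      obtain ⟨i, _, rfl⟩ := ha
      refine Ideal.prime_of_isPrime ?_ (stk_map_prime _ Q)
      rwa [Ne, Ideal.map_eq_bot_iff_of_injective (s ^ i).injective]
    · intro a ha
      rw [Finset.mem_image] at ha
      obtain ⟨i, _, rfl⟩ := ha
      rw [Ideal.dvd_span_singleton]
      have := Ideal.mem_map_of_mem (s ^ i) hlQ
      rwa [map_natCast] at this
  have hle := Ideal.le_of_dvd hdvd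
  symm
  have hnorm : ∀ i, Ideal.absNorm (Ideal.map (s ^ i) Q) = l := by
    intro i
    rw [Ideal.absNorm_apply, Submodule.cardQuot_apply, ← hc]
    exact (Nat.card_congr (Ideal.quotientEquiv Q _ (s ^ i) rfl).toEquiv).symm
  obtain ⟨C, hC⟩ := hdvd
  have h3 := congrArg Ideal.absNorm hC
  rw [Ideal.absNorm_span_natCast, map_mul, map_prod, Finset.prod_congr rfl (fun i _ => hnorm i),
    Finset.prod_const, Finset.card_range, hrank] at h3
  have h4 : Ideal.absNorm C = 1 := by
    have : 0 < l ^ (p - 1) := pow_pos hl.pos _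
    exact Nat.eq_of_mul_eq_mul_left this (by rw [← h3, mul_one])
  rw [Ideal.absNorm_eq_one_iff] at h4
  rw [hC, h4, Ideal.mul_top]

end



theorem stk_sum_zero {F : Type*} [Field F] [Fintype F] (A B : ℕ)
    (h : A + B < Fintype.card F - 1) : ∑ x : F, x ^ A * (1 - x) ^ B = 0 := by
  have key : ∀ f : Polynomial F, f.natDegree < Fintype.card F - 1 → ∑ x : F, f.eval x = 0 := by
    intro f hf
    simp_rw [Polynomial.eval_eq_sum_range]
    rw [Finset.sum_comm]
    apply Finset.sum_eq_zero
    intro i hi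
    rw [← Finset.mul_sum, FiniteField.sum_pow_lt_card_sub_one, mul_zero]
    rw [Finset.mem_range] at hi
    omega
  have := key (Polynomial.X ^ A * (1 - Polynomial.X) ^ B) (by
    refine lt_of_le_of_lt ?_ h
    compute_degree)
  simpa using this

theorem stk_char {F R : Type*} [Field F] [Fintype F] [CommRing R] [IsDomain R]
    (f : R →+* F) {p : ℕ} (hp : p.Prime) {z : R} (hz : IsPrimitiveRoot z p)
    (hfz : IsPrimitiveRoot (f z) p) :
    ∃ (χ : MulChar F R) (m : ℕ), p * m = Fintype.card F - 1 ∧ (∀ x, x ≠ 0 → f (χ x) = x ^ m) ∧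
      (∀ x, x ≠ 0 → ∃ k, χ x = z ^ k) := by
  classical
  haveI : NeZero p := ⟨hp.ne_zero⟩
  have hz0 : f z ≠ 0 := hfz.ne_zero hp.ne_zero
  have hdvd : p ∣ Fintype.card F - 1 :=
    hfz.dvd_of_pow_eq_one _ (FiniteField.pow_card_sub_one_eq_one _ hz0)
  obtain ⟨m, hm⟩ := hdvd
  obtain ⟨g, hg⟩ := IsCyclic.exists_generator (α := Fˣ)
  have hgm : ((g : F) ^ m) ^ p = 1 := by
    rw [← pow_mul, mul_comm, ← hm]
    exact FiniteField.pow_card_sub_one_eq_one _ g.ne_zero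
  obtain ⟨k, -, hk⟩ := hfz.eq_pow_of_pow_eq_one hgm
  let u : Rˣ := (hz.isUnit hp.ne_zero).unit
  have hu : (u : R) = z := rfl
  have hup : u ^ p = 1 := by
    ext
    rw [Units.val_pow_eq_pow_val, hu, hz.pow_eq_one, Units.val_one]
  have hmem : u ^ k ∈ rootsOfUnity (Fintype.card Fˣ) R := by
    rw [mem_rootsOfUnity, Fintype.card_units, hm, ← pow_mul, mul_comm, mul_assoc, pow_mul, hup,
      one_pow]
  let χ := MulChar.ofRootOfUnity hmem hg
  have hχg : χ g = z ^ k := by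
    have := MulChar.ofRootOfUnity_spec hmem hg
    rw [Units.val_pow_eq_pow_val, hu] at this
    exact this
  have hpw : ∀ x : F, x ≠ 0 → ∃ n : ℕ, x = (g : F) ^ n := by
    intro x hx
    obtain ⟨n, hn⟩ := (mem_powers_iff_mem_zpowers.mpr (hg (Units.mk0 x hx)))
    refine ⟨n, ?_⟩
    have := congrArg (Units.val) hn
    simpa using this.symm
  refine ⟨χ, m, hm.symm, ?_, ?_⟩
  · intro x hx
    obtain ⟨n, rfl⟩ := hpw x hx
    rw [map_pow, map_pow, hχg, map_pow, hk, ← pow_mul, ← pow_mul, mul_comm]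
  · intro x hx
    obtain ⟨n, rfl⟩ := hpw x hx
    exact ⟨k * n, by rw [map_pow, hχg, pow_mul]⟩

/-- The Jacobi sum with exponents. -/
noncomputable def stkJ {F R : Type*} [Field F] [Fintype F] [CommRing R] (χ : MulChar F R)
    (a b : ℕ) : R := ∑ x : F, χ x ^ a * χ (1 - x) ^ b

theorem stk_J_zero {F R : Type*} [Field F] [Fintype F] [CommRing R] [IsDomain R]
    (f : R →+* F) {p : ℕ} (hp : p.Prime) (χ : MulChar F R) (m : ℕ)
    (hm : p * m = Fintype.card F - 1) (hχ : ∀ x, x ≠ 0 → f (χ x) = x ^ m)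
    {a b : ℕ} (ha : 1 ≤ a) (hb : 1 ≤ b) (hab : a + b < p) : f (stkJ χ a b) = 0 := by
  have hcard : 1 < Fintype.card F := Fintype.one_lt_card
  have hm0 : 0 < m := by
    rcases Nat.eq_zero_or_pos m with h | h
    · subst h; omega
    · exact h
  have hχ' : ∀ x, f (χ x) = x ^ m := by
    intro x
    by_cases hx : x = 0
    · subst hx
      rw [MulChar.map_zero, map_zero, zero_pow hm0.ne']
    · exact hχ x hx
  unfold stkJ
  rw [map_sum, ← stk_sum_zero (F := F) (m * a) (m * b)]
  · apply Finset.sum_congr rfl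
    intro x _
    rw [map_mul, map_pow, map_pow, hχ', hχ', pow_mul, pow_mul]
  · rw [← hm, ← mul_add, mul_comm]
    exact Nat.mul_lt_mul_of_pos_right hab hm0

theorem stk_J_mul {F R K : Type*} [Field F] [Fintype F] [CommRing R] [IsDomain R] [Field K]
    [CharZero K] (ι : R →+* K) (hι : Function.Injective ι)
    (f : R →+* F) {p : ℕ} (hp : p.Prime) {z : R} (hz : IsPrimitiveRoot z p)
    (χ : MulChar F R) (m : ℕ)
    (hm : p * m = Fintype.card F - 1) (hχ : ∀ x, x ≠ 0 → f (χ x) = x ^ m)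
    (hχz : ∀ x, x ≠ 0 → ∃ k, χ x = z ^ k)
    {b : ℕ} (hb : 1 ≤ b) (hab : b + 1 < p) :
    stkJ χ 1 b * stkJ χ (p - 1) (p - b) = (Fintype.card F : R) := by
  have hcard : 1 < Fintype.card F := Fintype.one_lt_card
  have hm0 : 0 < m := by
    rcases Nat.eq_zero_or_pos m with h | h
    · subst h; omega
    · exact h
  have hχp : χ ^ p = 1 := by
    ext x
    obtain ⟨k, hk⟩ := hχz x x.ne_zero
    rw [MulChar.pow_apply_coe, hk, MulChar.one_apply_coe, ← pow_mul, mul_comm, pow_mul,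
      hz.pow_eq_one, one_pow]
  have hne : ∀ c : ℕ, 0 < c → c < p → χ ^ c ≠ 1 := by
    intro c hc0 hc h
    have h1 : ∀ x : Fˣ, x ^ (m * c) = 1 := by
      intro x
      ext
      have h2 := DFunLike.congr_fun h (x : F)
      rw [MulChar.pow_apply_coe, MulChar.one_apply_coe] at h2
      have h3 := congrArg f h2
      rw [map_pow, hχ _ x.ne_zero, map_one, ← pow_mul] at h3
      simpa using h3
    rw [FiniteField.forall_pow_eq_one_iff, ← hm, mul_comm] at h1
    exact absurd (Nat.le_of_dvd hc0 (Nat.dvd_of_mul_dvd_mul_left hm0 h1)) (by omega)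
  have hJ : ∀ a b : ℕ, 1 ≤ a → 1 ≤ b → ι (stkJ χ a b) =
      jacobiSum ((χ.ringHomComp ι) ^ a) ((χ.ringHomComp ι) ^ b) := by
    intro a b ha hb
    unfold stkJ jacobiSum
    rw [map_sum]
    apply Finset.sum_congr rfl
    intro x _
    rw [MulChar.pow_apply' _ (by omega), MulChar.pow_apply' _ (by omega),
      MulChar.ringHomComp_apply, MulChar.ringHomComp_apply, map_mul, map_pow, map_pow]
  have hpow : ∀ c : ℕ, (χ.ringHomComp ι) ^ c = (χ ^ c).ringHomComp ι := by
    intro c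
    rw [MulChar.ringHomComp_pow]
  have hne' : ∀ c : ℕ, 0 < c → c < p → (χ.ringHomComp ι) ^ c ≠ 1 := by
    intro c hc0 hc
    rw [hpow, MulChar.ringHomComp_ne_one_iff hι]
    exact hne c hc0 hc
  have hinv : ∀ c : ℕ, c ≤ p → (χ.ringHomComp ι) ^ (p - c) = ((χ.ringHomComp ι) ^ c)⁻¹ := by
    intro c hc
    rw [eq_inv_iff_mul_eq_one, ← pow_add, Nat.sub_add_cancel hc, hpow, hχp]
    exact MulChar.ringHomComp_one ι
  apply hι
  rw [map_mul, hJ 1 b le_rfl hb, hJ _ _ (by omega) (by omega), map_natCast, hinv 1 (by omega),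
    hinv b (by omega)]
  apply jacobiSum_mul_jacobiSum_inv
  · rw [ringChar.eq_zero]
    intro h
    exact (CharP.char_ne_zero_of_finite F (ringChar F)) h.symm
  · exact hne' 1 one_pos hp.one_lt
  · exact hne' b (by omega) (by omega)
  · rw [← pow_add]
    exact hne' _ (by omega) (by omega)

theorem stk_J_conj {K : Type*} [Field K] [NumberField K] {F : Type*} [Field F] [Fintype F]
    {s : RingAut (𝓞 K)} {z : 𝓞 K} {v : ℕ} (hs : s z = z ^ v) {p : ℕ}
    (hz : IsPrimitiveRoot z p)
    (χ : MulChar F (𝓞 K)) (hχz : ∀ x, x ≠ 0 → ∃ k, χ x = z ^ k) (i : ℕ)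
    {a b a' b' : ℕ} (ha : 1 ≤ a) (ha' : 1 ≤ a') (hb : 1 ≤ b) (hb' : 1 ≤ b')
    (haa : (a : ZMod p) * (v : ZMod p) ^ i = a') (hbb : (b : ZMod p) * (v : ZMod p) ^ i = b') :
    (s ^ i) (stkJ χ a b) = stkJ χ a' b' := by
  have key : ∀ (a a' : ℕ), 1 ≤ a → 1 ≤ a' → (a : ZMod p) * (v : ZMod p) ^ i = a' → ∀ x : F,
      (s ^ i) (χ x ^ a) = χ x ^ a' := by
    intro a a' ha ha' h x
    by_cases hx : x = 0
    · subst hx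
      rw [MulChar.map_zero, zero_pow (by omega), zero_pow (by omega), map_zero]
    · obtain ⟨k, hk⟩ := hχz x hx
      rw [hk, ← pow_mul, ← pow_mul, map_pow, stk_pow_z hs, ← pow_mul]
      apply stk_pow_congr hz.pow_eq_one
      push_cast
      rw [← h]; ring
  unfold stkJ
  rw [map_sum]
  apply Finset.sum_congr rfl
  intro x _
  rw [map_mul, key a a' ha ha' haa, key b b' hb hb' hbb]



section
variable {K : Type*} [Field K] [NumberField K]

theorem stk_good_b {s : RingAut (𝓞 K)} {z : 𝓞 K} {v : ℕ} (hs : s z = z ^ v)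
    (hadj : Algebra.adjoin ℤ {z} = ⊤)
    {p : ℕ} (hp : p.Prime) (hz : IsPrimitiveRoot z p) (hv : orderOf (v : ZMod p) = p - 1)
    (hrank : Module.finrank ℤ (𝓞 K) = p - 1)
    {l : ℕ} (hl : l.Prime) (hl1 : (l : ZMod p) = 1) (Q : Ideal (𝓞 K)) [Q.IsPrime] (hQ : Q ≠ ⊥)
    (hlQ : (l : 𝓞 K) ∈ Q) (hpQ : (p : 𝓞 K) ∉ Q)
    (t : ℕ → ℕ) (ht1 : ∀ i, 1 ≤ t i) (ht2 : ∀ i, t i < p)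
    (ht : ∀ i, (t i : ZMod p) * (v : ZMod p) ^ i = 1) {b : ℕ} (hb : 1 ≤ b) (hbp : b + 1 < p) :
    ∃ J : 𝓞 K, ∏ i ∈ Finset.range (p - 1) with p ≤ t i + (b * t i) % p, Ideal.map (s ^ i) Q
      = Ideal.span {J} := by
  classical
  haveI : Fact p.Prime := ⟨hp⟩
  haveI : Finite (𝓞 K ⧸ Q) := Ring.HasFiniteQuotients.finiteQuotient hQ
  haveI : Q.IsMaximal := Ideal.IsPrime.isMaximal ‹_› hQ
  letI : Field (𝓞 K ⧸ Q) := Ideal.Quotient.field Q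
  letI := Fintype.ofFinite (𝓞 K ⧸ Q)
  have hc := stk_card hadj hz hl hl1 Q hQ hlQ
  rw [Nat.card_eq_fintype_card] at hc
  have hprim := stk_prim hp hz Q hpQ
  obtain ⟨χ, m, hm, hχ, hχz⟩ := stk_char (Ideal.Quotient.mk Q) hp hz hprim
  have hmul := stk_J_mul (algebraMap (𝓞 K) K) RingOfIntegers.coe_injective (Ideal.Quotient.mk Q)
    hp hz χ m hm hχ hχz hb hbp
  rw [hc] at hmul
  have hprod := stk_prod hs hadj hp hz hv hrank hl hl1 Q hQ hlQ hpQ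
  have hinj := stk_distinct hs hadj hp hz hv hl hl1 Q hQ hlQ hpQ
  -- residues of b * t
  have hr : ∀ i, 1 ≤ (b * t i) % p ∧ (b * t i) % p < p := by
    intro i
    refine ⟨?_, Nat.mod_lt _ hp.pos⟩
    rw [Nat.one_le_iff_ne_zero, Ne, ← Nat.dvd_iff_mod_eq_zero, hp.dvd_mul]
    rintro (h | h)
    · exact absurd (Nat.le_of_dvd hb h) (by omega)
    · exact absurd (Nat.le_of_dvd (ht1 i) h) (by have := ht2 i; omega)
  have hrv : ∀ i, (((b * t i) % p : ℕ) : ZMod p) * (v : ZMod p) ^ i = b := by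
    intro i
    rw [ZMod.natCast_mod, Nat.cast_mul, mul_assoc, ht, mul_one]
  have hnep : ∀ i, t i + (b * t i) % p ≠ p := by
    intro i h
    have h1 : ((t i + (b * t i) % p : ℕ) : ZMod p) = 0 := by rw [h]; simp
    have h2 : ((b + 1 : ℕ) : ZMod p) = 0 := by
      have : ((b + 1 : ℕ) : ZMod p) =
          ((t i + (b * t i) % p : ℕ) : ZMod p) * (v : ZMod p) ^ i := by
        rw [Nat.cast_add, Nat.cast_add, add_mul, ht, hrv, Nat.cast_one, add_comm]
      rw [this, h1, zero_mul]
    rw [ZMod.natCast_eq_zero_iff] at h2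
    exact absurd (Nat.le_of_dvd (by omega) h2) (by omega)
  have hpm : ∀ I ∈ (Finset.range (p - 1)).image (fun i => Ideal.map (s ^ i) Q), Prime I := by
    intro a ha
    rw [Finset.mem_image] at ha
    obtain ⟨i, _, rfl⟩ := ha
    refine Ideal.prime_of_isPrime ?_ (stk_map_prime _ Q)
    rwa [Ne, Ideal.map_eq_bot_iff_of_injective (s ^ i).injective]
  have hdiv : ∀ (S : Finset ℕ) (x : 𝓞 K), S ⊆ Finset.range (p - 1) →
      (∀ i ∈ S, x ∈ Ideal.map (s ^ i) Q) → ∏ i ∈ S, Ideal.map (s ^ i) Q ∣ Ideal.span {x} := by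
    intro S x hS hx
    rw [← Finset.prod_image (f := fun I => I) (hinj.mono (by exact_mod_cast hS))]
    apply Finset.prod_primes_dvd
    · intro a ha
      exact hpm a (Finset.image_subset_image hS ha)
    · intro a ha
      rw [Finset.mem_image] at ha
      obtain ⟨i, hi, rfl⟩ := ha
      rw [Ideal.dvd_span_singleton]
      exact hx i hi
  have hA := hdiv ((Finset.range (p - 1)).filter (fun i => p ≤ t i + (b * t i) % p))
    (stkJ χ (p - 1) (p - b)) (Finset.filter_subset _ _) (by
      intro i hi
      rw [Finset.mem_filter] at hi
      have h1 := ht1 i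
      have h2 := ht2 i
      obtain ⟨h3, h4⟩ := hr i
      have h5 := hnep i
      have := stk_J_zero (Ideal.Quotient.mk Q) hp χ m hm hχ (a := p - t i) (b := p - (b * t i) % p)
        (by omega) (by omega) (by omega)
      rw [Ideal.Quotient.eq_zero_iff_mem] at this
      have h6 := Ideal.mem_map_of_mem (s ^ i) this
      rwa [stk_J_conj hs hz χ hχz i (a' := p - 1) (b' := p - b) (by omega) (by omega) (by omega)
        (by omega)] at h6
      · rw [Nat.cast_sub h2.le, Nat.cast_sub hp.one_le, sub_mul, ht]; simp
      · rw [Nat.cast_sub h4.le, Nat.cast_sub (by omega), sub_mul, hrv]; simp)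
  have hB := hdiv ((Finset.range (p - 1)).filter (fun i => ¬ p ≤ t i + (b * t i) % p))
    (stkJ χ 1 b) (Finset.filter_subset _ _) (by
      intro i hi
      rw [Finset.mem_filter] at hi
      have h1 := ht1 i
      have h2 := ht2 i
      obtain ⟨h3, h4⟩ := hr i
      have h5 := hnep i
      have := stk_J_zero (Ideal.Quotient.mk Q) hp χ m hm hχ (a := t i) (b := (b * t i) % p)
        (by omega) (by omega) (by omega)
      rw [Ideal.Quotient.eq_zero_iff_mem] at this
      have h6 := Ideal.mem_map_of_mem (s ^ i) this
      rwa [stk_J_conj hs hz χ hχz i (a' := 1) (b' := b) (by omega) (by omega) (by omega)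
        (by omega)] at h6
      · rw [ht]; simp
      · rw [hrv])
  refine ⟨stkJ χ (p - 1) (p - b), ?_⟩
  have hsplit := Finset.prod_filter_mul_prod_filter_not (Finset.range (p - 1))
    (fun i => p ≤ t i + (b * t i) % p) (fun i => Ideal.map (s ^ i) Q)
  rw [hprod, ← hmul, ← Ideal.span_singleton_mul_span_singleton] at hsplit
  obtain ⟨A', hA'⟩ := hA
  obtain ⟨B', hB'⟩ := hB
  rw [hA', hB'] at hsplit
  have hne : Ideal.span {(l : 𝓞 K)} ≠ 0 := by
    rw [Ne, Ideal.zero_eq_bot, Ideal.span_singleton_eq_bot]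
    exact_mod_cast hl.ne_zero
  have hne2 : (∏ i ∈ Finset.range (p - 1) with p ≤ t i + (b * t i) % p, Ideal.map (s ^ i) Q) *
    (∏ i ∈ Finset.range (p - 1) with ¬ p ≤ t i + (b * t i) % p, Ideal.map (s ^ i) Q) ≠ 0 := by
    rw [Finset.prod_filter_mul_prod_filter_not, hprod]
    exact hne
  have h1 : B' * A' = 1 := by
    apply mul_left_cancel₀ hne2
    rw [mul_one]
    conv_rhs => rw [hsplit]
    ring
  have h2 : A' = 1 := by
    have : IsUnit A' := IsUnit.of_mul_eq_one B' (by rw [mul_comm]; exact h1)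
    rw [Ideal.isUnit_iff] at this
    rw [this, Ideal.one_eq_top]
  rw [hA', h2, mul_one]

theorem stk_count (p t v : ℕ) (hp : 0 < p) (ht : t < p) (hv : 1 ≤ v) :
    ∑ b ∈ Finset.Ico 1 v, (if p ≤ t + (b * t) % p then 1 else 0) = (v * t) / p := by
  induction v, hv using Nat.le_induction with
  | base => simp [Nat.div_eq_of_lt ht]
  | succ n hn ih =>
    rw [Finset.sum_Ico_succ_top hn, ih, add_mul, one_mul, Nat.add_div hp, Nat.div_eq_of_lt ht,
      Nat.mod_eq_of_lt ht, add_comm (n * t % p) t, add_zero]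

theorem stk_good {s : RingAut (𝓞 K)} {z : 𝓞 K} {v : ℕ} (hs : s z = z ^ v)
    (hadj : Algebra.adjoin ℤ {z} = ⊤)
    {p : ℕ} (hp : p.Prime) (hz : IsPrimitiveRoot z p) (hv : orderOf (v : ZMod p) = p - 1)
    (hv1 : 1 ≤ v) (hv2 : v < p)
    (hrank : Module.finrank ℤ (𝓞 K) = p - 1)
    {l : ℕ} (hl : l.Prime) (hl1 : (l : ZMod p) = 1) (Q : Ideal (𝓞 K)) [Q.IsPrime] (hQ : Q ≠ ⊥)
    (hlQ : (l : 𝓞 K) ∈ Q) (hpQ : (p : 𝓞 K) ∉ Q)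
    (t : ℕ → ℕ) (ht1 : ∀ i, 1 ≤ t i) (ht2 : ∀ i, t i < p)
    (ht : ∀ i, (t i : ZMod p) * (v : ZMod p) ^ i = 1)
    (hmem : ∀ i, Ideal.map (s ^ i) Q ∈ (Ideal (𝓞 K))⁰) :
    ∏ i ∈ Finset.range (p - 1), (ClassGroup.mk0 ⟨Ideal.map (s ^ i) Q, hmem i⟩) ^ ((v * t i) / p)
      = 1 := by
  have hb : ∀ b ∈ Finset.Ico 1 v, ∏ i ∈ Finset.range (p - 1),
      (ClassGroup.mk0 ⟨Ideal.map (s ^ i) Q, hmem i⟩) ^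
        (if p ≤ t i + (b * t i) % p then 1 else 0) = 1 := by
    intro b hb
    rw [Finset.mem_Ico] at hb
    obtain ⟨J, hJ⟩ := stk_good_b hs hadj hp hz hv hrank hl hl1 Q hQ hlQ hpQ t ht1 ht2 ht hb.1
      (by omega)
    simp_rw [pow_ite, pow_one, pow_zero]
    rw [← Finset.prod_filter, ← map_prod]
    have : ∏ i ∈ Finset.range (p - 1) with p ≤ t i + (b * t i) % p,
      (⟨Ideal.map (s ^ i) Q, hmem i⟩ : (Ideal (𝓞 K))⁰) =
       ⟨∏ i ∈ Finset.range (p - 1) with p ≤ t i + (b * t i) % p, Ideal.map (s ^ i) Q,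
        prod_mem (fun i _ => hmem i)⟩ := by
      ext1
      simp
    rw [this, ClassGroup.mk0_eq_one_iff, hJ]
    exact ⟨⟨J, rfl⟩⟩
  have := Finset.prod_congr rfl hb
  rw [Finset.prod_comm, Finset.prod_const_one] at this
  rw [← this]
  apply Finset.prod_congr rfl
  intro i _
  rw [Finset.prod_pow_eq_pow_sum, stk_count p _ v hp.pos (ht2 i) hv1]
end



section
variable {K : Type*} [Field K] [NumberField K]

theorem stk_exists_l (Q : Ideal (𝓞 K)) [Q.IsPrime] (hQ : Q ≠ ⊥) :
    ∃ l : ℕ, l.Prime ∧ (l : 𝓞 K) ∈ Q := by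
  haveI : Finite (𝓞 K ⧸ Q) := Ring.HasFiniteQuotients.finiteQuotient hQ
  obtain ⟨l, hl⟩ := CharP.exists (𝓞 K ⧸ Q)
  refine ⟨l, CharP.char_is_prime (𝓞 K ⧸ Q) l, ?_⟩
  rw [← Ideal.Quotient.eq_zero_iff_mem, map_natCast]
  exact CharP.cast_eq_zero _ _

theorem stk_dvd {l : ℕ} (hl : l.Prime) (Q : Ideal (𝓞 K)) [Q.IsPrime]
    (hlQ : (l : 𝓞 K) ∈ Q) (n : ℕ) (hn : (n : 𝓞 K) ∈ Q) : l ∣ n := by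
  haveI := stk_charP hl Q hlQ
  rw [← CharP.cast_eq_zero_iff (𝓞 K ⧸ Q) l, ← map_natCast (Ideal.Quotient.mk Q)]
  exact Ideal.Quotient.eq_zero_iff_mem.mpr hn

theorem stk_of_dvd {l : ℕ} (Q : Ideal (𝓞 K))
    (hlQ : (l : 𝓞 K) ∈ Q) (n : ℕ) (hn : l ∣ n) : (n : 𝓞 K) ∈ Q := by
  obtain ⟨k, rfl⟩ := hn
  rw [Nat.cast_mul]
  exact Q.mul_mem_right _ hlQ

theorem stk_avoid {p l : ℕ} (hl : l.Prime) (hlp : p ≤ l) (hp0 : 0 < p)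
    (hrank : Module.finrank ℤ (𝓞 K) = p - 1)
    (α : 𝓞 K) : ∃ r : ℕ, ∀ Q : Ideal (𝓞 K), Q.IsPrime → (l : 𝓞 K) ∈ Q → α - (r : 𝓞 K) ∉ Q := by
  haveI : Fact l.Prime := ⟨hl⟩
  have hinteg : IsIntegral ℤ α := Algebra.IsIntegral.isIntegral α
  have hmon := minpoly.monic hinteg
  have hdeg : (minpoly ℤ α).natDegree ≤ p - 1 := by
    rw [← hrank]
    exact minpoly.natDegree_le α
  set g := (minpoly ℤ α).map (Int.castRingHom (ZMod l)) with hg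
  have hg0 : g ≠ 0 := (hmon.map _).ne_zero
  have hgd : g.natDegree < l := by
    rw [hg, hmon.natDegree_map]
    omega
  obtain ⟨a, ha⟩ : ∃ a, g.eval a ≠ 0 := by
    by_contra hcon
    push Not at hcon
    apply hg0
    apply Polynomial.eq_zero_of_natDegree_lt_card_of_eval_eq_zero g (f := (id : ZMod l → ZMod l))
      Function.injective_id
    · exact hcon
    · rwa [ZMod.card]
  refine ⟨a.val, fun Q hQ hlQ hmem => ha ?_⟩
  haveI := stk_charP hl Q hlQ
  have h1 : Ideal.Quotient.mk Q α = (((a.val : ℕ) : ℤ) : 𝓞 K ⧸ Q) := by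
    rw [← Ideal.Quotient.eq, map_natCast] at hmem
    rw [hmem, Int.cast_natCast]
  have h2 := congrArg (Ideal.Quotient.mk Q) (minpoly.aeval ℤ α)
  rw [map_zero, Polynomial.aeval_def, Polynomial.hom_eval₂, h1,
    RingHom.ext_int ((Ideal.Quotient.mk Q).comp (algebraMap ℤ (𝓞 K)))
      (Int.castRingHom (𝓞 K ⧸ Q))] at h2
  have h3 : (((minpoly ℤ α).eval ((a.val : ℕ) : ℤ) : ℤ) : 𝓞 K ⧸ Q) = 0 := by
    rw [← h2]
    have := Polynomial.hom_eval₂ (minpoly ℤ α) (RingHom.id ℤ) (Int.castRingHom (𝓞 K ⧸ Q)) ((a.val : ℕ) : ℤ)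
    simpa using this
  rw [CharP.intCast_eq_zero_iff (𝓞 K ⧸ Q) l, ← CharP.intCast_eq_zero_iff (ZMod l) l] at h3
  rw [← h3, hg]
  have := Polynomial.hom_eval₂ (minpoly ℤ α) (RingHom.id ℤ) (Int.castRingHom (ZMod l)) ((a.val : ℕ) : ℤ)
  simpa [Polynomial.eval_map] using this.symm

/-- choice of `α`. -/
theorem stk_alpha {s : RingAut (𝓞 K)} {z : 𝓞 K} {p : ℕ}
    (hsz : ∀ i, 0 < i → i < p - 1 → (s ^ i) z ≠ z)
    (P : Ideal (𝓞 K)) [P.IsPrime] (hP : P ≠ ⊥) {q : ℕ} (hq : q.Prime) (hqP : (q : 𝓞 K) ∈ P)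
    (N : ℕ) (hN0 : N ≠ 0) (hqN : q ∣ N) :
    ∃ α : 𝓞 K, α ∈ P ∧ α ∉ P ^ 2 ∧
      (∀ Q : Ideal (𝓞 K), Q.IsPrime → Q ≠ P → (q : 𝓞 K) ∈ Q → α - 1 ∈ Q) ∧
      (∀ Q : Ideal (𝓞 K), Q.IsPrime → (N : 𝓞 K) ∈ Q → (q : 𝓞 K) ∉ Q → α ∈ Q) ∧
      (∀ i, 0 < i → i < p - 1 → (s ^ i) α ≠ α) := by
  classical
  have hNK : (N : 𝓞 K) ≠ 0 := by exact_mod_cast hN0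
  have hspan : Ideal.span {(N : 𝓞 K)} ≠ ⊥ := by
    rwa [Ne, Ideal.span_singleton_eq_bot]
  set S := (UniqueFactorizationMonoid.normalizedFactors (Ideal.span {(N : 𝓞 K)})).toFinset with hS
  have hSmem : ∀ Q : Ideal (𝓞 K), Q ∈ S ↔ Q.IsPrime ∧ (N : 𝓞 K) ∈ Q := by
    intro Q
    rw [hS, Multiset.mem_toFinset, Ideal.mem_normalizedFactors_iff hspan,
      Ideal.span_singleton_le_iff_mem]
  have hSne : ∀ Q ∈ S, Q ≠ ⊥ := by
    intro Q hQ h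
    rw [hSmem, h] at hQ
    exact hNK hQ.2
  obtain ⟨π, hπ1, hπ2⟩ := Ideal.exists_mem_pow_notMem_pow_succ P hP (Ideal.IsPrime.ne_top ‹_›) 1
  rw [pow_one] at hπ1
  obtain ⟨y, hy⟩ := IsDedekindDomain.exists_forall_sub_mem_ideal (s := S) (fun I => I) (fun _ => 2)
    (fun Q hQ => Ideal.prime_of_isPrime (hSne Q hQ) ((hSmem Q).mp hQ).1)
    (fun _ _ _ _ h => h)
    (fun I => if I.1 = P then π else if (q : 𝓞 K) ∈ I.1 then 1 else 0)
  have hNP : (N : 𝓞 K) ∈ P := stk_of_dvd P hqP N hqN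
  have hPS : P ∈ S := (hSmem P).mpr ⟨‹_›, hNP⟩
  -- choose k
  let B : Set ℕ := ⋃ i ∈ Finset.Ico 1 (p - 1), {k : ℕ | (s ^ i) (y + (N : 𝓞 K) ^ 2 * k * z) =
    y + (N : 𝓞 K) ^ 2 * k * z}
  have hB : B.Finite := by
    apply Set.Finite.biUnion (Finset.finite_toSet _)
    intro i hi
    rw [Finset.mem_coe, Finset.mem_Ico] at hi
    apply Set.Subsingleton.finite
    intro k hk k' hk'
    simp only [Set.mem_ofPred_eq, map_add, map_mul, map_pow, map_natCast] at hk hk'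
    have hne := hsz i hi.1 hi.2
    have : (N : 𝓞 K) ^ 2 * ((k : 𝓞 K) - k') * ((s ^ i) z - z) = 0 := by
      linear_combination hk - hk'
    rw [mul_eq_zero, mul_eq_zero] at this
    rcases this with (h | h) | h
    · exact absurd h (pow_ne_zero 2 hNK)
    · exact_mod_cast sub_eq_zero.mp h
    · exact absurd (sub_eq_zero.mp h) hne
  obtain ⟨k, hk⟩ := hB.infinite_compl.nonempty
  have hP2 : (N : 𝓞 K) ^ 2 * k * z ∈ P ^ 2 := by
    rw [mul_assoc]
    exact Ideal.mul_mem_right _ _ (Ideal.pow_mem_pow hNP 2)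
  have hyP := hy P hPS
  simp only [if_true] at hyP
  have hαπ : (y + (N : 𝓞 K) ^ 2 * k * z) - π ∈ P ^ 2 := by
    have := add_mem hyP hP2
    convert this using 1
    ring
  have hgen : ∀ Q : Ideal (𝓞 K), Q ∈ S → Q ≠ P →
      (y + (N : 𝓞 K) ^ 2 * k * z) - (if (q : 𝓞 K) ∈ Q then 1 else 0) ∈ Q := by
    intro Q hQ hne
    have h1 := Ideal.pow_le_self two_ne_zero (hy Q hQ)
    simp only [hne, if_false] at h1
    have h2 : (N : 𝓞 K) ^ 2 * k * z ∈ Q := by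
      rw [pow_two, mul_assoc, mul_assoc]
      exact Ideal.mul_mem_right _ _ ((hSmem Q).mp hQ).2
    have := add_mem h1 h2
    convert this using 1
    ring
  refine ⟨y + (N : 𝓞 K) ^ 2 * k * z, ?_, ?_, ?_, ?_, ?_⟩
  · have := add_mem (Ideal.pow_le_self two_ne_zero hαπ) hπ1
    simpa using this
  · intro h
    apply hπ2
    have := sub_mem h hαπ
    simpa using this
  · intro Q hQ hne hqQ
    have := hgen Q ((hSmem Q).mpr ⟨hQ, stk_of_dvd Q hqQ N hqN⟩) hne
    rwa [if_pos hqQ] at this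
  · intro Q hQ hNQ hqQ
    have := hgen Q ((hSmem Q).mpr ⟨hQ, hNQ⟩) (by rintro rfl; exact hqQ hqP)
    rwa [if_neg hqQ, sub_zero] at this
  · intro i hi0 hi1 h
    apply hk
    simp only [B, Set.mem_iUnion]
    exact ⟨i, Finset.mem_Ico.mpr ⟨hi0, hi1⟩, h⟩

theorem stk_gen {s : RingAut (𝓞 K)} {z : 𝓞 K} {v : ℕ} (hs : s z = z ^ v)
    (hadj : Algebra.adjoin ℤ {z} = ⊤)
    {p : ℕ} (hp : p.Prime) (hz : IsPrimitiveRoot z p) (hv : orderOf (v : ZMod p) = p - 1)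
    (hrank : Module.finrank ℤ (𝓞 K) = p - 1)
    (P : Ideal (𝓞 K)) [P.IsPrime] (hP : P ≠ ⊥) :
    ∃ (β : 𝓞 K) (J : Ideal (𝓞 K)), β ≠ 0 ∧ Ideal.span {β} = P * J ∧
      ∀ Q : Ideal (𝓞 K), Q.IsPrime → J ≤ Q →
        ∃ l : ℕ, l.Prime ∧ (l : ZMod p) = 1 ∧ (l : 𝓞 K) ∈ Q ∧ (p : 𝓞 K) ∉ Q := by
  classical
  haveI : Fact p.Prime := ⟨hp⟩
  have hvp : IsPrimitiveRoot (v : ZMod p) (p - 1) := hv ▸ IsPrimitiveRoot.orderOf _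
  have hp1 : 0 < p - 1 := Nat.sub_pos_of_lt hp.one_lt
  have hsz : ∀ i, 0 < i → i < p - 1 → (s ^ i) z ≠ z := by
    intro i hi0 hi1 h
    rw [stk_pow_z hs] at h
    have h2 := stk_pow_inj hp.pos hz (a := v ^ i) (b := 1) (by rw [h, pow_one])
    rw [← ZMod.natCast_eq_natCast_iff, Nat.cast_pow, Nat.cast_one] at h2
    exact hvp.pow_ne_one_of_pos_of_lt hi0.ne' hi1 h2
  obtain ⟨q, hq, hqP⟩ := stk_exists_l P hP
  have hN0 : q * p.factorial ≠ 0 := mul_ne_zero hq.ne_zero (Nat.factorial_ne_zero p)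
  obtain ⟨α, hα1, hα2, hα3, hα4, hα5⟩ := stk_alpha (s := s) (z := z) hsz P hP hq hqP
    (q * p.factorial) hN0 (dvd_mul_right _ _)
  set Δ : 𝓞 K := ∏ i ∈ Finset.Ico 1 (p - 1), ((s ^ i) α - α) with hΔ
  have hΔ0 : Δ ≠ 0 := by
    rw [hΔ, Finset.prod_ne_zero_iff]
    intro i hi
    rw [Finset.mem_Ico] at hi
    exact sub_ne_zero.mpr (hα5 i hi.1 hi.2)
  set D : ℕ := Ideal.absNorm (Ideal.span {Δ}) with hD
  have hD0 : D ≠ 0 := by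
    rw [hD, Ne, Ideal.absNorm_eq_zero_iff, Ideal.span_singleton_eq_bot]
    exact hΔ0
  have hDmem : (D : 𝓞 K) ∈ Ideal.span {Δ} := Ideal.absNorm_mem _
  have hM0 : D * (q * p.factorial) ≠ 0 := mul_ne_zero hD0 hN0
  have hr : ∀ l : ℕ, ∃ r : ℕ, l.Prime → l ≠ q →
      ∀ Q : Ideal (𝓞 K), Q.IsPrime → (l : 𝓞 K) ∈ Q → α - (r : 𝓞 K) ∉ Q := by
    intro l
    by_cases hl : l.Prime
    swap
    · exact ⟨0, fun h => absurd h hl⟩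
    rcases le_total p l with h | h
    · obtain ⟨r, hr⟩ := stk_avoid hl h hp.pos hrank α
      exact ⟨r, fun _ _ => hr⟩
    · refine ⟨1, fun _ hlq Q hQ hlQ hmem => ?_⟩
      have hqQ : (q : 𝓞 K) ∉ Q := fun hqQ =>
        hlq ((Nat.prime_dvd_prime_iff_eq hl hq).mp (stk_dvd hl Q hlQ q hqQ))
      have h1 := hα4 Q hQ (stk_of_dvd Q hlQ _
        (dvd_mul_of_dvd_right (Nat.dvd_factorial hl.pos h) q)) hqQ
      apply hQ.ne_top
      rw [Ideal.eq_top_iff_one]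
      have := sub_mem h1 hmem
      simpa using this
  choose r hr using hr
  obtain ⟨n, hn⟩ := Nat.chineseRemainderOfFinset (fun l => if l = q then 0 else r l)
    (fun l => l ^ 2) (D * (q * p.factorial)).primeFactors
    (fun l hl => pow_ne_zero 2 (Nat.prime_of_mem_primeFactors hl).ne_zero)
    (fun l hl l' hl' hne => Nat.Coprime.pow 2 2
      ((Nat.coprime_primes (Nat.prime_of_mem_primeFactors hl)
        (Nat.prime_of_mem_primeFactors hl')).mpr hne))
  have hnq : q ^ 2 ∣ n := by
    have := hn q (Nat.mem_primeFactors.mpr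
      ⟨hq, dvd_mul_of_dvd_right (dvd_mul_right _ _) _, hM0⟩)
    simp only [if_true] at this
    exact (Nat.modEq_zero_iff_dvd).mp this
  have hnP : (n : 𝓞 K) ∈ P ^ 2 := by
    refine stk_of_dvd (l := q ^ 2) _ ?_ n hnq
    rw [Nat.cast_pow]
    exact Ideal.pow_mem_pow hqP 2
  have hβP2 : α - (n : 𝓞 K) ∉ P ^ 2 := by
    intro h
    apply hα2
    have := add_mem h hnP
    simpa using this
  have hβP : α - (n : 𝓞 K) ∈ P := sub_mem hα1 (Ideal.pow_le_self two_ne_zero hnP)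
  have hβ0 : α - (n : 𝓞 K) ≠ 0 := by
    intro h
    rw [h] at hβP2
    exact hβP2 (zero_mem _)
  obtain ⟨J, hJ⟩ := (Ideal.dvd_span_singleton).mpr hβP
  have hβPJ : α - (n : 𝓞 K) ∈ P * J := by
    rw [← hJ]
    exact Ideal.mem_span_singleton_self _
  refine ⟨α - n, J, hβ0, hJ, ?_⟩
  intro Q hQ hJQ
  have hβQ : α - (n : 𝓞 K) ∈ Q := by
    apply hJQ
    exact (Ideal.mul_le_right : P * J ≤ J) hβPJ
  have hQ0 : Q ≠ ⊥ := by
    rintro rfl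
    exact hβ0 hβQ
  obtain ⟨l, hl, hlQ⟩ := stk_exists_l Q hQ0
  have hlq : l ≠ q := by
    rintro rfl
    have hnQ : (n : 𝓞 K) ∈ Q := stk_of_dvd Q hlQ n ((dvd_pow_self _ two_ne_zero).trans hnq)
    by_cases hQP : Q = P
    · subst hQP
      apply hβP2
      rw [pow_two]
      exact Ideal.mul_mono_right hJQ hβPJ
    · have h1 := hα3 Q hQ hQP hlQ
      apply hQ.ne_top
      rw [Ideal.eq_top_iff_one]
      have := sub_mem (add_mem hβQ hnQ) h1
      simpa using this
  have hlM : ¬ l ∣ D * (q * p.factorial) := by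
    intro h
    have h1 := hn l (Nat.mem_primeFactors.mpr ⟨hl, h, hM0⟩)
    simp only [hlq, if_false] at h1
    have h2 : n ≡ r l [MOD l] := h1.of_dvd (dvd_pow_self _ two_ne_zero)
    apply hr l hl hlq Q hQ hlQ
    haveI := stk_charP hl Q hlQ
    rw [← Ideal.Quotient.eq] at hβQ ⊢
    rw [hβQ, map_natCast, map_natCast]
    exact (CharP.natCast_eq_natCast (𝓞 K ⧸ Q) l).mpr h2
  have hpQ : (p : 𝓞 K) ∉ Q := by
    intro hpQ
    apply hlM
    apply dvd_mul_of_dvd_right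
    apply dvd_mul_of_dvd_right
    exact (stk_dvd hl Q hlQ p hpQ).trans (Nat.dvd_factorial hp.pos le_rfl)
  refine ⟨l, hl, ?_, hlQ, hpQ⟩
  have hl0 : (l : ZMod p) ≠ 0 := by
    rw [Ne, ZMod.natCast_eq_zero_iff, Nat.prime_dvd_prime_iff_eq hp hl]
    rintro rfl
    exact hpQ hlQ
  haveI : NeZero (p - 1) := ⟨hp1.ne'⟩
  obtain ⟨i, hi, hil⟩ := hvp.eq_pow_of_pow_eq_one (ZMod.pow_card_sub_one_eq_one hl0)
  rcases Nat.eq_zero_or_pos i with h0 | h0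
  · rw [← hil, h0, pow_zero]
  exfalso
  apply hlM
  apply dvd_mul_of_dvd_left
  apply stk_dvd hl Q hlQ
  have hΔQ : Δ ∈ Q := by
    have h1 := stk_frob hs hadj hz hl (i := i) (by rw [Nat.cast_pow, hil]) Q hlQ α
    have h2 : (s ^ i) α - α ∈ Q := by
      haveI : Fact l.Prime := ⟨hl⟩
      haveI := stk_charP hl Q hlQ
      rw [← Ideal.Quotient.eq] at h1 hβQ ⊢
      rw [h1, map_pow, hβQ, map_natCast]
      exact map_natCast (frobenius (𝓞 K ⧸ Q) l) n
    rw [hΔ]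
    exact Ideal.mem_of_dvd _ (Finset.dvd_prod_of_mem _ (Finset.mem_Ico.mpr ⟨h0, hi⟩)) h2
  exact (Ideal.span_singleton_le_iff_mem Q).mpr hΔQ hDmem
end


theorem stk_ind {K : Type*} [Field K] [NumberField K] {G : Type*} [CommGroup G]
    (Φ : ClassGroup (𝓞 K) →* G) (I : Ideal (𝓞 K)) (hI : I ∈ (Ideal (𝓞 K))⁰)
    (h : ∀ (Q : Ideal (𝓞 K)) (hQ : Q ∈ (Ideal (𝓞 K))⁰), Q.IsPrime → I ≤ Q →
      Φ (ClassGroup.mk0 ⟨Q, hQ⟩) = 1) : Φ (ClassGroup.mk0 ⟨I, hI⟩) = 1 := by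
  induction I using UniqueFactorizationMonoid.induction_on_prime with
  | h₁ => exact absurd rfl (nonZeroDivisors.ne_zero hI)
  | h₂ x hx =>
    have : ClassGroup.mk0 ⟨x, hI⟩ = 1 := by
      rw [ClassGroup.mk0_eq_one_iff, Ideal.isUnit_iff.mp hx]
      exact ⟨⟨1, by simp⟩⟩
    rw [this, map_one]
  | h₃ a P ha hP ih =>
    have ha' : a ∈ (Ideal (𝓞 K))⁰ := mem_nonZeroDivisors_of_ne_zero ha
    have hP' : P ∈ (Ideal (𝓞 K))⁰ := mem_nonZeroDivisors_of_ne_zero hP.ne_zero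
    have : (⟨P * a, hI⟩ : (Ideal (𝓞 K))⁰) = ⟨P, hP'⟩ * ⟨a, ha'⟩ := rfl
    rw [this, map_mul, map_mul, h P hP' (Ideal.isPrime_of_prime hP) Ideal.mul_le_left,
      ih ha' (fun Q hQ hQp hle => h Q hQ hQp (Ideal.mul_le_right.trans hle)), mul_one]

theorem statement1
    (p : ℕ) (hp : p.Prime) (hp2 : p ≠ 2)
    (v : ℕ) (hv1 : 1 ≤ v) (hv2 : v ≤ p - 1)
    (hv : orderOf (v : ZMod p) = p - 1)
    (vn : ℤ → ℕ)
    (hvn1 : ∀ n : ℤ, 1 ≤ vn n) (hvn2 : ∀ n : ℤ, vn n ≤ p - 1)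
    (hvn0 : vn 0 = 1)
    (hvnrec : ∀ n : ℤ, (vn (n + 1) : ZMod p) = (v : ZMod p) * (vn n : ZMod p))
    (K : Type*) [Field K] [NumberField K]
    [IsCyclotomicExtension {p} ℚ K]
    (ζ : K) (hζ : IsPrimitiveRoot ζ p)
    (σ : K ≃ₐ[ℚ] K) (hσ : σ ζ = ζ ^ v)
    (σ' : 𝓞 K ≃+* 𝓞 K)
    (hσ' : ∀ x : 𝓞 K, algebraMap (𝓞 K) K (σ' x) = σ (algebraMap (𝓞 K) K x))
    (T : MulAut (ClassGroup (𝓞 K)))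
    (hT : ∀ I J : (Ideal (𝓞 K))⁰,
      Ideal.map σ' (I : Ideal (𝓞 K)) = (J : Ideal (𝓞 K)) →
      T (ClassGroup.mk0 I) = ClassGroup.mk0 J)
    (δ : ℕ → ℤ)
    (hδ : ∀ i : ℕ, (p : ℤ) * δ i = (vn (1 - (i : ℤ)) : ℤ) - (v : ℤ) * (vn (-(i : ℤ)) : ℤ)) :
    ∀ c : ClassGroup (𝓞 K), c ^ p = 1 →
      ∏ i ∈ Finset.Icc 1 (p - 2), ((T ^ i) c) ^ (δ i) = 1 := by
  haveI : Fact p.Prime := ⟨hp⟩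
  haveI : NeZero p := ⟨hp.ne_zero⟩
  have hp3 : 2 < p := lt_of_le_of_ne hp.two_le (Ne.symm hp2)
  let z : 𝓞 K := hζ.toInteger
  let s : RingAut (𝓞 K) := σ'
  have hzK : algebraMap (𝓞 K) K z = ζ := rfl
  have hz : IsPrimitiveRoot z p := hζ.toInteger_isPrimitiveRoot
  have hs : s z = z ^ v := by
    apply RingOfIntegers.coe_injective
    rw [map_pow, hzK, ← hσ, ← hzK]
    exact hσ' z
  have hadj : Algebra.adjoin ℤ {z} = ⊤ := by
    have := hζ.integralPowerBasis.adjoin_gen_eq_top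
    rwa [hζ.integralPowerBasis_gen] at this
  have hrank : Module.finrank ℤ (𝓞 K) = p - 1 := by
    rw [RingOfIntegers.rank, IsCyclotomicExtension.finrank (n := p) K
      (Polynomial.cyclotomic.irreducible_rat hp.pos), Nat.totient_prime hp]
  let t : ℕ → ℕ := fun i => vn (-(i : ℤ))
  have ht1 : ∀ i, 1 ≤ t i := fun i => hvn1 _
  have ht2 : ∀ i, t i < p := fun i => lt_of_le_of_lt (hvn2 _) (Nat.sub_lt hp.pos one_pos)
  have ht : ∀ i, (t i : ZMod p) * (v : ZMod p) ^ i = 1 := by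
    intro i
    induction i with
    | zero => simp [t, hvn0]
    | succ n ih =>
      have := hvnrec (-((n + 1 : ℕ) : ℤ))
      rw [show -((n + 1 : ℕ) : ℤ) + 1 = -(n : ℤ) by push_cast; ring] at this
      simp only [t] at ih ⊢
      rw [this] at ih
      rw [← ih]
      ring
  have hδ' : ∀ i, δ i = -(((v * t i) / p : ℕ) : ℤ) := by
    intro i
    have h1 := hvnrec (-(i : ℤ))
    rw [show -(i : ℤ) + 1 = 1 - (i : ℤ) by ring, ← Nat.cast_mul,
      ZMod.natCast_eq_natCast_iff'] at h1
    have h2 : vn (1 - (i : ℤ)) < p := lt_of_le_of_lt (hvn2 _) (Nat.sub_lt hp.pos one_pos)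
    rw [Nat.mod_eq_of_lt h2] at h1
    have h3 := hδ i
    have h4 := Nat.div_add_mod (v * vn (-(i : ℤ))) p
    rw [← h1] at h4
    have h5 : (p : ℤ) * ((v * vn (-(i : ℤ)) / p : ℕ) : ℤ) + (vn (1 - (i : ℤ)) : ℤ)
      = (v : ℤ) * (vn (-(i : ℤ)) : ℤ) := by exact_mod_cast h4
    have hp0 : (p : ℤ) ≠ 0 := by exact_mod_cast hp.ne_zero
    apply mul_left_cancel₀ hp0
    simp only [t]
    linarith
  have hmem : ∀ (Q : Ideal (𝓞 K)) (_ : Q ∈ (Ideal (𝓞 K))⁰) (i : ℕ),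
      Ideal.map (s ^ i) Q ∈ (Ideal (𝓞 K))⁰ := by
    intro Q hQ i
    apply mem_nonZeroDivisors_of_ne_zero
    rw [Ideal.zero_eq_bot, Ne, Ideal.map_eq_bot_iff_of_injective (s ^ i).injective]
    exact nonZeroDivisors.ne_zero hQ
  have hTi : ∀ (Q : Ideal (𝓞 K)) (hQ : Q ∈ (Ideal (𝓞 K))⁰) (i : ℕ),
      (T ^ i) (ClassGroup.mk0 ⟨Q, hQ⟩) = ClassGroup.mk0 ⟨Ideal.map (s ^ i) Q, hmem Q hQ i⟩ := by
    intro Q hQ i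
    induction i with
    | zero =>
      have : Ideal.map (s ^ 0) Q = Q := by
        rw [pow_zero]
        exact Ideal.map_id Q
      rw [pow_zero, MulAut.one_apply]
      congr 1
      exact Subtype.ext this.symm
    | succ n ih =>
      rw [pow_succ', MulAut.mul_apply, ih]
      apply hT
      change Ideal.map (s : 𝓞 K →+* 𝓞 K) (Ideal.map ((s ^ n : RingAut (𝓞 K)) : 𝓞 K →+* 𝓞 K) Q) =
        Ideal.map ((s ^ (n + 1) : RingAut (𝓞 K)) : 𝓞 K →+* 𝓞 K) Q
      rw [Ideal.map_map, pow_succ']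
      rfl
  let Φ : ClassGroup (𝓞 K) →* ClassGroup (𝓞 K) :=
    ∏ i ∈ Finset.range (p - 1), (T ^ i).toMonoidHom ^ ((v * t i) / p)
  have hΦ : ∀ c, Φ c = ∏ i ∈ Finset.range (p - 1), ((T ^ i) c) ^ ((v * t i) / p) := by
    intro c
    simp [Φ, MonoidHom.finsetProd_apply]
  have hgood : ∀ (Q : Ideal (𝓞 K)) (hQ : Q ∈ (Ideal (𝓞 K))⁰), Q.IsPrime →
      (∃ l : ℕ, l.Prime ∧ (l : ZMod p) = 1 ∧ (l : 𝓞 K) ∈ Q ∧ (p : 𝓞 K) ∉ Q) →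
      Φ (ClassGroup.mk0 ⟨Q, hQ⟩) = 1 := by
    rintro Q hQ hQp ⟨l, hl, hl1, hlQ, hpQ⟩
    rw [hΦ]
    simp_rw [hTi]
    exact stk_good hs hadj hp hz hv hv1 (lt_of_le_of_lt hv2 (Nat.sub_lt hp.pos one_pos)) hrank hl
      hl1 Q (nonZeroDivisors.ne_zero hQ) hlQ hpQ t ht1 ht2 ht (hmem Q hQ)
  have hprime : ∀ (P : Ideal (𝓞 K)) (hP : P ∈ (Ideal (𝓞 K))⁰), P.IsPrime →
      Φ (ClassGroup.mk0 ⟨P, hP⟩) = 1 := by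
    intro P hP hPp
    obtain ⟨β, J, hβ, hβJ, hJ⟩ := stk_gen hs hadj hp hz hv hrank P (nonZeroDivisors.ne_zero hP)
    have hJ0 : J ∈ (Ideal (𝓞 K))⁰ := by
      apply mem_nonZeroDivisors_of_ne_zero
      rintro rfl
      rw [mul_zero, Ideal.zero_eq_bot, Ideal.span_singleton_eq_bot] at hβJ
      exact hβ hβJ
    have h1 : Φ (ClassGroup.mk0 ⟨J, hJ0⟩) = 1 :=
      stk_ind Φ J hJ0 (fun Q hQ hQp hle => hgood Q hQ hQp (hJ Q hQp hle))
    have h2 : ClassGroup.mk0 ⟨P, hP⟩ * ClassGroup.mk0 ⟨J, hJ0⟩ = 1 := by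
      rw [← map_mul]
      have : (⟨P, hP⟩ * ⟨J, hJ0⟩ : (Ideal (𝓞 K))⁰) = ⟨P * J, mul_mem hP hJ0⟩ := rfl
      rw [this, ClassGroup.mk0_eq_one_iff, ← hβJ]
      exact ⟨⟨β, rfl⟩⟩
    have h3 := congrArg Φ h2
    rwa [map_mul, h1, mul_one, map_one] at h3
  intro c _
  have hc : Φ c = 1 := by
    obtain ⟨⟨I, hI⟩, rfl⟩ := ClassGroup.mk0_surjective c
    exact stk_ind Φ I hI (fun Q hQ hQp _ => hprime Q hQ hQp)
  rw [hΦ] at hc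
  have hδ0 : (v * t 0) / p = 0 := by
    simp only [t, Nat.cast_zero, neg_zero, hvn0, mul_one]
    exact Nat.div_eq_of_lt (lt_of_le_of_lt hv2 (Nat.sub_lt hp.pos one_pos))
  have hrange : Finset.range (p - 1) = insert 0 (Finset.Icc 1 (p - 2)) := by
    ext i
    simp only [Finset.mem_range, Finset.mem_insert, Finset.mem_Icc]
    omega
  rw [hrange, Finset.prod_insert (by simp), hδ0, pow_zero, one_mul] at hc
  rw [← inv_eq_one, ← hc, ← Finset.prod_inv_distrib]
  apply Finset.prod_congr rfl
  intro i _
  rw [hδ' i, zpow_neg, inv_inv, zpow_natCast]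
end

section
/- Let p and q be distinct odd primes with q ≢ 1 (mod p). Regard K = ℚ(ζ_p) as a subfield of L = ℚ(ζ_{pq}). If g ∈ L is nonzero and g^p ∈ K, then g ∈ K. (In particular, for a prime ideal 𝔮 of the ring of integers of K lying over q, the Gauss sum g(𝔮) ∈ ℚ(ζ_{pq}), whose p-th power lies in K, itself lies in K.) -/
theorem statement2
    (p q : ℕ) (hp : p.Prime) (hq : q.Prime) (hpodd : p ≠ 2) (hqodd : q ≠ 2)
    (hpq : p ≠ q) (hq1 : ¬ q ≡ 1 [MOD p])
    (L : Type*) [Field L] [NumberField L]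
    [IsCyclotomicExtension {p * q} ℚ L]
    (K : IntermediateField ℚ L)
    [IsCyclotomicExtension {p} ℚ K] :
    ∀ g : L, g ≠ 0 → g ^ p ∈ K → g ∈ K := by
  intro g hg hgp
  have : NeZero p := ⟨hp.ne_zero⟩
  have : NeZero q := ⟨hq.ne_zero⟩
  have : NeZero (p * q) := ⟨mul_ne_zero hp.ne_zero hq.ne_zero⟩
  have hGal : IsGalois ℚ L := IsCyclotomicExtension.isGalois {p * q} ℚ L
  have hGalK : IsGalois K L := IsGalois.tower_top_of_isGalois ℚ K L
  have hL : Module.finrank ℚ L = (p - 1) * (q - 1) := by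
    rw [IsCyclotomicExtension.finrank (n := p * q) L
      (Polynomial.cyclotomic.irreducible_rat (Nat.pos_of_ne_zero (NeZero.ne _))),
      Nat.totient_mul ((Nat.coprime_primes hp hq).2 hpq),
      Nat.totient_prime hp, Nat.totient_prime hq]
  have hK : Module.finrank ℚ K = p - 1 := by
    rw [IsCyclotomicExtension.finrank (n := p) K
      (Polynomial.cyclotomic.irreducible_rat hp.pos), Nat.totient_prime hp]
  have hKL : Module.finrank K L = q - 1 := by
    have h := Module.finrank_mul_finrank ℚ K L
    rw [hL, hK] at h
    exact Nat.eq_of_mul_eq_mul_left (by have := hp.two_le; omega) h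
  have hcard : Nat.card (L ≃ₐ[K] L) = q - 1 := by
    rw [IsGalois.card_aut_eq_finrank, hKL]
  have hcop : Nat.Coprime p (q - 1) := by
    rw [hp.coprime_iff_not_dvd]
    intro h
    exact hq1 ((Nat.modEq_iff_dvd' hq.one_lt.le).2 h).symm
  have hfix : ∀ σ : L ≃ₐ[K] L, σ g = g := by
    intro σ
    have hσp : (σ g) ^ p = g ^ p := by
      rw [← map_pow]
      exact σ.commutes ⟨g ^ p, hgp⟩
    have hω : (σ g / g) ^ p = 1 := by
      rw [div_pow, hσp, div_self (pow_ne_zero _ hg)]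
    have hζ := IsCyclotomicExtension.zeta_spec p ℚ K
    have hζL : IsPrimitiveRoot (algebraMap K L (IsCyclotomicExtension.zeta p ℚ K)) p :=
      hζ.map_of_injective (algebraMap K L).injective
    obtain ⟨i, -, hi⟩ := hζL.eq_pow_of_pow_eq_one hω
    have hσω : σ (σ g / g) = σ g / g := by
      rw [← hi, ← map_pow, σ.commutes]
    have hiter : ∀ n : ℕ, (σ ^ n) g = (σ g / g) ^ n * g := by
      intro n
      induction n with
      | zero => simp
      | succ n ih =>
        rw [pow_succ', AlgEquiv.mul_apply, ih, map_mul, map_pow, hσω, pow_succ, mul_assoc,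
          div_mul_cancel₀ _ hg]
    have h1 : (σ g / g) ^ (q - 1) = 1 := by
      have h := hiter (q - 1)
      rw [← hcard, pow_card_eq_one', AlgEquiv.one_apply] at h
      rw [← hcard]
      exact (mul_eq_right₀ hg).1 h.symm
    have h2 : σ g / g = 1 := by
      have h3 := Nat.dvd_gcd (orderOf_dvd_of_pow_eq_one hω) (orderOf_dvd_of_pow_eq_one h1)
      rw [hcop.gcd_eq_one, Nat.dvd_one, orderOf_eq_one_iff] at h3
      exact h3
    exact (div_eq_one_iff_eq hg).1 h2
  obtain ⟨x, hx⟩ := (IsGalois.mem_range_algebraMap_iff_fixed (F := K) g).2 hfix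
  rw [← hx]
  exact x.2
end

section
/- Suppose there exists a nontrivial ideal class c of O_K of order p such that σ(c) = c^{v_{2m+1}} for some integer m with 1 ≤ m ≤ (p−3)/2. Then Q(v_{2m+1}) = Σ_{i=1}^{p-2} v_{(2m+1)·i} · ((v_{-(i-1)} − v·v_{-i})/p) ≡ 0 (mod p). -/
open NumberField Finset nonZeroDivisors

section Basics
variable {R : Type*} [CommRing R] {ζ : R}

theorem ringHom_ext_zeta (hadj : Algebra.adjoin ℤ {ζ} = ⊤) {S : Type*} [CommRing S]
    (f g : R →+* S) (h : f ζ = g ζ) : f = g := by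
  have : f.toIntAlgHom = g.toIntAlgHom := by
    apply AlgHom.ext_of_adjoin_eq_top hadj
    intro x hx
    rw [Set.mem_singleton_iff] at hx
    subst hx
    exact h
  ext x
  exact DFunLike.congr_fun this x

theorem frob_mem (hadj : Algebra.adjoin ℤ {ζ} = ⊤) (Q : Ideal R) [Q.IsPrime] {l : ℕ}
    (hl : l.Prime) (hlQ : (l : R) ∈ Q) (f : R →+* R) (hf : f ζ = ζ ^ l) (a : R) :
    f a - a ^ l ∈ Q := by
  have : Fact l.Prime := ⟨hl⟩
  have hz : (l : R ⧸ Q) = 0 := by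
    rw [← map_natCast (Ideal.Quotient.mk Q)]
    exact Ideal.Quotient.eq_zero_iff_mem.mpr hlQ
  have : CharP (R ⧸ Q) l := by
    have := CharP.ringChar_of_prime_eq_zero hl hz
    exact ringChar.of_eq this
  have := ringHom_ext_zeta hadj ((Ideal.Quotient.mk Q).comp f)
    ((frobenius (R ⧸ Q) l).comp (Ideal.Quotient.mk Q)) (by simp [hf, frobenius_def])
  have h2 := DFunLike.congr_fun this a
  simp only [RingHom.comp_apply, frobenius_def] at h2
  rw [← Ideal.Quotient.eq_zero_iff_mem, map_sub, map_pow, h2, sub_self]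

theorem card_of_pow {F : Type*} [CommRing F] [IsDomain F] [Finite F] {l : ℕ} [CharP F l]
    (hl : l.Prime) (key : ∀ x : F, x ^ l = x) : Nat.card F = l := by
  classical
  have := Fintype.ofFinite F
  rw [Nat.card_eq_fintype_card]
  apply le_antisymm
  · have hne : (Polynomial.X ^ l - Polynomial.X : Polynomial F) ≠ 0 := by
      rw [Ne, sub_eq_zero]
      intro h
      have := congrArg Polynomial.natDegree h
      rw [Polynomial.natDegree_X_pow, Polynomial.natDegree_X] at this
      exact hl.one_lt.ne' this
    have := Polynomial.card_le_degree_of_subset_roots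
      (p := (Polynomial.X ^ l - Polynomial.X : Polynomial F)) (Z := Finset.univ) (by
      intro x _
      rw [Multiset.mem_toFinset.symm, Multiset.mem_toFinset, Polynomial.mem_roots hne]
      simp [key])
    refine this.trans ?_
    refine (Polynomial.natDegree_sub_le _ _).trans ?_
    simp [hl.one_lt.le]
  · apply Nat.le_of_dvd Fintype.card_pos
    rw [← CharP.cast_eq_zero_iff F l]
    exact Nat.cast_card_eq_zero F

theorem card_quot (hadj : Algebra.adjoin ℤ {ζ} = ⊤) {p : ℕ} (hζ : ζ ^ p = 1)
    (Q : Ideal R) [Q.IsPrime] [Finite (R ⧸ Q)] {l : ℕ}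
    (hl : l.Prime) (hlQ : (l : R) ∈ Q) (hlp : l % p = 1) : Nat.card (R ⧸ Q) = l := by
  classical
  have : Fact l.Prime := ⟨hl⟩
  have hz : (l : R ⧸ Q) = 0 := by
    rw [← map_natCast (Ideal.Quotient.mk Q)]
    exact Ideal.Quotient.eq_zero_iff_mem.mpr hlQ
  have : CharP (R ⧸ Q) l := ringChar.of_eq (CharP.ringChar_of_prime_eq_zero hl hz)
  have hζl : ζ = ζ ^ l := by
    conv_rhs => rw [← Nat.div_add_mod l p, hlp, pow_add, pow_mul, hζ]
    simp
  have key : ∀ x : R ⧸ Q, x ^ l = x := by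
    intro x
    obtain ⟨a, rfl⟩ := Ideal.Quotient.mk_surjective x
    have := frob_mem hadj Q hl hlQ (RingHom.id R) hζl a
    rw [← Ideal.Quotient.eq_zero_iff_mem, map_sub, sub_eq_zero, map_pow] at this
    exact this.symm
  exact card_of_pow hl key
theorem zeta_pow_eq_iff {p : ℕ} (hp : p ≠ 0) (hζ : IsPrimitiveRoot ζ p) (a b : ℕ) :
    ζ ^ a = ζ ^ b ↔ (a : ZMod p) = (b : ZMod p) := by
  rw [ZMod.natCast_eq_natCast_iff]
  have hu := hζ.isUnit hp
  have h2 : IsPrimitiveRoot hu.unit p := by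
    rw [← IsPrimitiveRoot.coe_units_iff]; simpa using hζ
  have : ζ ^ a = ζ ^ b ↔ hu.unit ^ a = hu.unit ^ b := by
    rw [← Units.val_inj]; simp
  rw [this, pow_eq_pow_iff_modEq, ← h2.eq_orderOf]
end Basics


section LemmaA
set_option linter.unusedSectionVars false
variable {R : Type*} [CommRing R] [IsDedekindDomain R] [Module.Free ℤ R] [Module.Finite ℤ R]
  [CharZero R] {ζ : R}

/-- a prime ideal containing `l` and `a` forces `l ∣ N(a)` -/
theorem dvd_norm_of_mem (Q : Ideal R) [hQ : Q.IsPrime] {l : ℕ} (hl : l.Prime) (hlQ : (l : R) ∈ Q)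
    {a : R} (ha : a ∈ Q) : (l : ℤ) ∣ Algebra.norm ℤ a := by
  have h1 := Ideal.absNorm_dvd_norm_of_mem ha
  have h2 := Ideal.absNorm_dvd_norm_of_mem hlQ
  have h3 : Ideal.absNorm Q ∣ l ^ Module.finrank ℤ R := by
    have : Algebra.norm ℤ (l : R) = (l : ℤ) ^ Module.finrank ℤ R := by
      have := Algebra.norm_algebraMap (S := R) (l : ℤ)
      simpa using this
    rw [this] at h2
    exact_mod_cast h2
  obtain ⟨k, _, hk⟩ := (Nat.dvd_prime_pow hl).mp h3
  have hk0 : k ≠ 0 := by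
    rintro rfl
    rw [pow_zero, Ideal.absNorm_eq_one_iff] at hk
    exact hQ.ne_top hk
  refine dvd_trans ?_ h1
  rw [hk]
  push_cast
  exact dvd_pow_self _ hk0

theorem exists_residue {l n : ℕ} (hl : l.Prime) (hln : ¬ l ∣ n) (hd : Module.finrank ℤ R < l)
    (b : R) : ∃ x : ℕ, ∀ y : ℕ, y ≡ x [MOD l] →
      ¬ (l : ℤ) ∣ Algebra.norm ℤ ((n : R) * (y : R) + b) := by
  classical
  have : Fact l.Prime := ⟨hl⟩
  let f : Polynomial ℤ := (Algebra.lmul ℤ R (-b)).charpoly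
  have hf : ∀ t : ℤ, f.eval t = Algebra.norm ℤ ((t : R) + b) := by
    intro t
    rw [LinearMap.eval_charpoly, Algebra.norm_apply]
    congr 1
    ext x
    simp [sub_eq_add_neg]
  have hmonic : f.Monic := LinearMap.charpoly_monic _
  let g := f.map (Int.castRingHom (ZMod l))
  have hg : g.Monic := hmonic.map _
  have hgd : g.natDegree < l := by
    rw [hmonic.natDegree_map, LinearMap.charpoly_natDegree]
    exact hd
  obtain ⟨z, hz⟩ : ∃ z : ZMod l, g.eval z ≠ 0 := by
    by_contra! hcon
    have := Polynomial.card_le_degree_of_subset_roots (p := g) (Z := Finset.univ) (by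
      intro x _
      rw [Multiset.mem_toFinset.symm, Multiset.mem_toFinset, Polynomial.mem_roots hg.ne_zero]
      exact hcon x)
    rw [Finset.card_univ, ZMod.card] at this
    omega
  have hn0 : (n : ZMod l) ≠ 0 := by
    rwa [Ne, ZMod.natCast_eq_zero_iff]
  refine ⟨(z / n).val, fun y hy hdiv => hz ?_⟩
  have hy' : (n : ZMod l) * y = z := by
    rw [(ZMod.natCast_eq_natCast_iff _ _ _).mpr hy, ZMod.natCast_val, ZMod.cast_id]
    field_simp
  have h1 := hf ((n * y : ℕ) : ℤ)
  rw [← hy']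
  have h2 : g.eval (Int.castRingHom (ZMod l) ((n * y : ℕ) : ℤ)) = 0 := by
    rw [Polynomial.eval_map, Polynomial.eval₂_at_apply, h1]
    simp only [eq_intCast]
    rw [ZMod.intCast_zmod_eq_zero_iff_dvd]
    push_cast
    exact hdiv
  simpa using h2

theorem exists_good {n M : ℕ} (hM : M ≠ 0) (b : R)
    (hn : ∀ l : ℕ, l.Prime → ¬ l ∣ n → Module.finrank ℤ R < l) :
    ∃ x : ℕ, ∀ l : ℕ, l.Prime → l ∣ M → ¬ l ∣ n →
      ¬ (l : ℤ) ∣ Algebra.norm ℤ ((n : R) * (x : R) + b) := by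
  classical
  choose! x hx using fun (l : ℕ) (h : l.Prime ∧ ¬ l ∣ n) =>
    exists_residue (R := R) h.1 h.2 (hn l h.1 h.2) b
  let t := M.primeFactors
  obtain ⟨k, hk⟩ := Nat.chineseRemainderOfFinset x id t
    (fun i hi => (Nat.prime_of_mem_primeFactors hi).ne_zero) (by
      intro i hi j hj hij
      exact (Nat.coprime_primes (Nat.prime_of_mem_primeFactors hi)
        (Nat.prime_of_mem_primeFactors hj)).mpr hij)
  refine ⟨k, fun l hl hlM hln => hx l ⟨hl, hln⟩ k (hk l ?_)⟩
  exact Nat.mem_primeFactors.mpr ⟨hl, hlM, hM⟩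

theorem exists_shift {ι : Type*} (s : Finset ι) (f : ι → R →+* R) (hf : ∀ i ∈ s, f i ζ ≠ ζ)
    (b : R) {n : ℕ} (hn : n ≠ 0) :
    ∃ k : ℕ, ∀ i ∈ s, f i (b + n * k * ζ) ≠ b + n * k * ζ := by
  classical
  have hfin : (⋃ i ∈ s, {k : ℕ | f i (b + n * k * ζ) = b + n * k * ζ}).Finite := by
    refine Set.Finite.biUnion s.finite_toSet fun i hi => Set.Subsingleton.finite ?_
    intro k hk k' hk'
    simp only [Set.mem_ofPred_eq, map_add, map_mul, map_natCast] at hk hk'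
    have : ((k : R) - k') * (n * (f i ζ - ζ)) = 0 := by linear_combination hk - hk'
    have hne : (n : R) * (f i ζ - ζ) ≠ 0 :=
      mul_ne_zero (Nat.cast_ne_zero.mpr hn) (sub_ne_zero.mpr (hf i hi))
    have := (mul_eq_zero.mp this).resolve_right hne
    exact_mod_cast sub_eq_zero.mp this
  obtain ⟨k, hk⟩ := hfin.infinite_compl.nonempty
  refine ⟨k, fun i hi h => hk ?_⟩
  simp only [Set.mem_iUnion]
  exact ⟨i, hi, h⟩

set_option maxHeartbeats 1000000 in
/-- Every ideal `I` has a multiple `I * J = (α)` with `J` only divisible by primes of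
residue characteristic `1` modulo `p`. -/
theorem exists_split_rep (hadj : Algebra.adjoin ℤ {ζ} = ⊤) {p : ℕ} (hp : p.Prime)
    (hp2 : p ≠ 2)
    (hζ : IsPrimitiveRoot ζ p) (hd : Module.finrank ℤ R = p - 1)
    {v : ℕ} (hv : orderOf (v : ZMod p) = p - 1) (s : R ≃+* R) (hs : ∀ i : ℕ, (s ^ i) ζ = ζ ^ v ^ i)
    (I : Ideal R) (hI : I ≠ ⊥) :
    ∃ (α : R) (J : Ideal R), α ≠ 0 ∧ Ideal.span {α} = I * J ∧
      ∀ Q : Ideal R, Q.IsPrime → J ≤ Q → ∀ l : ℕ, l.Prime → (l : R) ∈ Q → l % p = 1 := by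
  classical
  have : Fact p.Prime := ⟨hp⟩
  have hp3 : 3 ≤ p := by have := hp.two_le; omega
  set N := Ideal.absNorm I with hN
  have hN0 : N ≠ 0 := by rw [hN, Ne, Ideal.absNorm_eq_zero_iff]; exact hI
  set n0 := p.factorial * N with hn0
  set n := n0 * N with hn
  have hn00 : n0 ≠ 0 := mul_ne_zero p.factorial_ne_zero hN0
  have hnne : n ≠ 0 := mul_ne_zero hn00 hN0
  have hprim : ∀ l : ℕ, l.Prime → (l ∣ n ↔ l ∣ n0) := by
    intro l hl
    rw [hn, hl.dvd_mul, hn0, hl.dvd_mul]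
    tauto
  have hNI : (N : R) ∈ I := Ideal.absNorm_mem I
  -- approximate
  have hle : Ideal.span {(n0 : R)} * I ≤ I := Ideal.mul_le_right
  have hne : Ideal.span {(n0 : R)} * I ≠ 0 := by
    refine mul_ne_zero ?_ hI
    rw [Ideal.zero_eq_bot, Ne, Ideal.span_singleton_eq_bot]
    exact Nat.cast_ne_zero.mpr hn00
  obtain ⟨b0, hb0⟩ := IsDedekindDomain.exists_sup_span_eq hle hne
  -- the automorphisms
  have hunit : IsUnit (v : ZMod p) := by
    rw [isUnit_iff_ne_zero]
    intro h0
    rw [h0, orderOf_zero] at hv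
    omega
  have hvinj : ∀ i j : ℕ, ζ ^ v ^ i = ζ ^ v ^ j ↔ (v : ZMod p) ^ i = (v : ZMod p) ^ j := by
    intro i j
    rw [zeta_pow_eq_iff hp.ne_zero hζ]
    push_cast
    rfl
  obtain ⟨k, hk⟩ := exists_shift (ζ := ζ) (Finset.Ioo 0 (p - 1))
    (fun i => ((s ^ i : R ≃+* R) : R →+* R)) (by
      intro i hi
      rw [Finset.mem_Ioo] at hi
      simp only [RingHom.coe_coe]
      rw [hs i]
      intro h
      have h2 := (hvinj i 0).mp (by simpa using h)
      rw [pow_zero] at h2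
      have := orderOf_dvd_of_pow_eq_one h2
      rw [hv] at this
      have := Nat.le_of_dvd hi.1 this
      omega) b0 hnne
  set b := b0 + n * k * ζ with hb
  set M : ℕ := ∏ i ∈ Finset.Ioo 0 (p - 1), (Algebra.norm ℤ ((s ^ i) b - b)).natAbs with hM
  have hM0 : M ≠ 0 := by
    rw [hM, Finset.prod_ne_zero_iff]
    intro i hi
    rw [Int.natAbs_ne_zero, Algebra.norm_ne_zero_iff]
    exact sub_ne_zero.mpr (hk i hi)
  obtain ⟨x, hx⟩ := exists_good (n := n) hM0 b (by
    intro l hl hln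
    rw [hd]
    by_contra! hcon
    apply hln
    rw [hprim l hl, hn0]
    exact Dvd.dvd.mul_right ((hl.dvd_factorial).mpr (by omega)) _)
  set α := (n : R) * x + b with hα
  have hnI : ∀ r : R, (n : R) * r ∈ Ideal.span {(n0 : R)} * I := by
    intro r
    rw [hn]
    push_cast
    rw [mul_assoc]
    exact Ideal.mul_mem_mul (Ideal.mem_span_singleton_self _) (I.mul_mem_right _ hNI)
  have hsup : Ideal.span {(n0 : R)} * I ⊔ Ideal.span {α} = I := by
    have hαb : α = b0 + n * (x + k * ζ) := by rw [hα, hb]; ring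
    refine Eq.trans ?_ hb0
    apply le_antisymm
    · refine sup_le le_sup_left ?_
      rw [Ideal.span_singleton_le_iff_mem, hαb]
      exact Ideal.add_mem _ (Ideal.mem_sup_right (Ideal.mem_span_singleton_self _))
        (Ideal.mem_sup_left (hnI _))
    · refine sup_le le_sup_left ?_
      rw [Ideal.span_singleton_le_iff_mem]
      have : b0 = α - n * (x + k * ζ) := by rw [hαb]; ring
      rw [this]
      exact Ideal.sub_mem _ (Ideal.mem_sup_right (Ideal.mem_span_singleton_self _))
        (Ideal.mem_sup_left (hnI _))
  have hαI : Ideal.span {α} ≤ I := by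
    conv_rhs => rw [← hsup]
    exact le_sup_right
  obtain ⟨J, hJ⟩ := Ideal.dvd_iff_le.mpr hαI
  have hcop : ∀ Q : Ideal R, Q.IsPrime → J ≤ Q → (n0 : R) ∉ Q := by
    intro Q hQ hJQ hn0Q
    have h1 : I * (Ideal.span {(n0 : R)} ⊔ J) = I * 1 := by
      rw [Ideal.mul_sup, ← hJ, mul_comm, hsup, mul_one]
    have h2 := mul_left_cancel₀ (show I ≠ 0 from hI) h1
    apply hQ.ne_top
    rw [Ideal.one_eq_top] at h2
    rw [eq_top_iff, ← h2]
    refine sup_le ?_ hJQ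
    rwa [Ideal.span_singleton_le_iff_mem]
  have h1mem : 1 ∈ Finset.Ioo 0 (p - 1) := by rw [Finset.mem_Ioo]; omega
  refine ⟨α, J, ?_, hJ, ?_⟩
  · intro h0
    apply hk 1 h1mem
    have : b = - (n * x : R) := by linear_combination h0
    simp only [RingHom.coe_coe]
    rw [this]
    simp
  · intro Q hQ hJQ l hl hlQ
    have hln0 : ¬ l ∣ n0 := by
      rintro ⟨c, hc⟩
      apply hcop Q hQ hJQ
      rw [hc]
      push_cast
      exact Q.mul_mem_right _ hlQ
    have hαQ : α ∈ Q := by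
      apply hJQ
      have : α ∈ I * J := hJ ▸ Ideal.mem_span_singleton_self α
      exact Ideal.mul_le_right this
    have hndvd := dvd_norm_of_mem Q hl hlQ hαQ
    have hlM : ¬ l ∣ M := fun h => hx l hl h (by rwa [hprim l hl]) hndvd
    have hlp : ¬ l ∣ p := by
      intro h
      exact hln0 (Dvd.dvd.mul_right (h.trans (Nat.dvd_factorial hp.pos le_rfl)) _)
    have hl0 : (l : ZMod p) ≠ 0 := by
      rw [Ne, ZMod.natCast_eq_zero_iff]
      intro h
      exact hlp ((Nat.prime_dvd_prime_iff_eq hp hl).mp h ▸ dvd_rfl)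
    -- discrete log
    obtain ⟨i, hi, hiv⟩ : ∃ i < p - 1, (v : ZMod p) ^ i = (l : ZMod p) := by
      have hprv : IsPrimitiveRoot (v : ZMod p) (p - 1) := hv ▸ IsPrimitiveRoot.orderOf _
      have : NeZero (p - 1) := ⟨by omega⟩
      exact hprv.eq_pow_of_pow_eq_one (ZMod.pow_card_sub_one_eq_one hl0)
    by_cases hi0 : i = 0
    · rw [hi0, pow_zero] at hiv
      have : ((1 : ℕ) : ZMod p) = (l : ZMod p) := by simpa using hiv
      rw [ZMod.natCast_eq_natCast_iff'] at this
      rw [← this, Nat.mod_eq_of_lt (by omega)]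
    · exfalso
      apply hlM
      have himem : i ∈ Finset.Ioo 0 (p - 1) := by rw [Finset.mem_Ioo]; omega
      refine dvd_trans ?_ (Finset.dvd_prod_of_mem _ himem)
      rw [← Int.natCast_dvd]
      apply dvd_norm_of_mem Q hl hlQ
      have hfr := frob_mem hadj Q hl hlQ ((s ^ i : R ≃+* R) : R →+* R) (by
        simp only [RingHom.coe_coe]
        rw [hs i, zeta_pow_eq_iff hp.ne_zero hζ]
        push_cast
        exact hiv) α
      have h1 : (s ^ i) α ∈ Q := by
        have := Q.add_mem hfr (Q.pow_mem_of_mem hαQ l hl.pos)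
        simpa using this
      have h2 : (s ^ i) α - α = (s ^ i) b - b := by
        rw [hα, map_add, map_mul, map_natCast, map_natCast]; ring
      rw [← h2]
      exact Q.sub_mem h1 hαQ
end LemmaA

section Jacobi
set_option linter.unusedSectionVars false
variable {R : Type*} [CommRing R] [IsDomain R] {ζ : R} {F : Type*} [Field F] [Fintype F]

theorem zetaBar_prim {p : ℕ} (hp : p.Prime) (hζ : IsPrimitiveRoot ζ p) (π : R →+* F)
    (hpF : (p : F) ≠ 0) : IsPrimitiveRoot (π ζ) p := by
  have : Fact p.Prime := ⟨hp⟩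
  have h1 : π ζ ≠ 1 := by
    intro h
    have := congrArg π (hζ.geom_sum_eq_zero hp.one_lt)
    simp [h] at this
    exact hpF this
  have h2 : orderOf (π ζ) = p :=
    orderOf_eq_prime (by rw [← map_pow, hζ.pow_eq_one, map_one]) h1
  exact h2 ▸ IsPrimitiveRoot.orderOf _

theorem exists_char {p e : ℕ} (hp : p.Prime) (hζ : IsPrimitiveRoot ζ p) (π : R →+* F)
    (hpF : (p : F) ≠ 0) (hcard : Fintype.card F = e * p + 1) :
    ∃ χ : MulChar F R, (∀ x, x ≠ 0 → π (χ x) = x ^ (e * (p - 1))) ∧ χ ^ p = 1 ∧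
      (∀ x, x ≠ 0 → ∃ k : ℕ, χ x = ζ ^ k) := by
  classical
  have hbar := zetaBar_prim hp hζ π hpF
  have : NeZero p := ⟨hp.ne_zero⟩
  obtain ⟨g, hg⟩ := IsCyclic.exists_generator (α := Fˣ)
  have hcu : Fintype.card Fˣ = e * p := by rw [Fintype.card_units, hcard]; simp
  have hgp : ∀ x : F, x ≠ 0 → x ^ (e * p) = 1 := by
    intro x hx
    have := FiniteField.pow_card_sub_one_eq_one x hx
    rwa [hcard, Nat.add_sub_cancel] at this
  obtain ⟨k, -, hk⟩ := hbar.eq_pow_of_pow_eq_one (ξ := (g : F) ^ (e * (p - 1))) (by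
    rw [← pow_mul, show e * (p - 1) * p = e * p * (p - 1) by ring, pow_mul, hgp _ g.ne_zero,
      one_pow])
  have hu := hζ.isUnit hp.ne_zero
  have hmem : hu.unit ^ k ∈ rootsOfUnity (Fintype.card Fˣ) R := by
    rw [mem_rootsOfUnity, hcu]
    ext
    push_cast
    rw [IsUnit.unit_spec, ← pow_mul, show k * (e * p) = p * (k * e) by ring, pow_mul,
      hζ.pow_eq_one, one_pow]
  let χ := MulChar.ofRootOfUnity hmem hg
  have hχg : χ g = ζ ^ k := by
    have := MulChar.ofRootOfUnity_spec hmem hg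
    simpa using this
  have hpow : ∀ x : F, x ≠ 0 → ∃ j : ℕ, x = (g : F) ^ j := by
    intro x hx
    obtain ⟨j, hj⟩ := (mem_powers_iff_mem_zpowers).mpr (hg (Units.mk0 x hx))
    refine ⟨j, ?_⟩
    have := congrArg Units.val hj
    simpa using this.symm
  refine ⟨χ, ?_, ?_, ?_⟩
  · intro x hx
    obtain ⟨j, rfl⟩ := hpow x hx
    rw [map_pow, hχg, map_pow, map_pow, hk, ← pow_mul, ← pow_mul, mul_comm]
  · ext x
    obtain ⟨j, hj⟩ := hpow x x.ne_zero
    rw [MulChar.pow_apply_coe, hj, map_pow, hχg, ← pow_mul, ← pow_mul,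
      show k * (j * p) = p * (k * j) by ring, pow_mul, hζ.pow_eq_one, one_pow, ← hj,
      MulChar.one_apply_coe]
  · intro x hx
    obtain ⟨j, rfl⟩ := hpow x hx
    exact ⟨k * j, by rw [map_pow, hχg, ← pow_mul]⟩

theorem jacobi_galois (χ : MulChar F R) (hχ : ∀ x, x ≠ 0 → ∃ k : ℕ, χ x = ζ ^ k)
    (f : R →+* R) {t : ℕ} (ht : t ≠ 0) (hf : f ζ = ζ ^ t) (a b : ℕ) (ha : a ≠ 0) (hb : b ≠ 0) :
    f (jacobiSum (χ ^ a) (χ ^ b)) = jacobiSum (χ ^ (a * t)) (χ ^ (b * t)) := by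
  have key : ∀ x, f (χ x) = χ x ^ t := by
    intro x
    by_cases hx : x = 0
    · subst hx
      rw [χ.map_zero, map_zero, zero_pow ht]
    · obtain ⟨k, hk⟩ := hχ x hx
      rw [hk, map_pow, hf, ← pow_mul, ← pow_mul, mul_comm]
  rw [jacobiSum, jacobiSum, map_sum]
  refine Finset.sum_congr rfl fun x _ => ?_
  rw [map_mul, MulChar.pow_apply' _ ha, MulChar.pow_apply' _ hb,
    MulChar.pow_apply' _ (mul_ne_zero ha ht),
    MulChar.pow_apply' _ (mul_ne_zero hb ht), map_pow, map_pow, key, key]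
  ring

theorem sum_poly_zero (P : Polynomial F) (h : P.natDegree < Fintype.card F - 1) :
    ∑ x : F, P.eval x = 0 := by
  simp_rw [Polynomial.eval_eq_sum_range]
  rw [Finset.sum_comm]
  refine Finset.sum_eq_zero fun i hi => ?_
  rw [← Finset.mul_sum, FiniteField.sum_pow_lt_card_sub_one, mul_zero]
  rw [Finset.mem_range] at hi
  omega

theorem jacobi_mod {p e : ℕ} (hp : p.Prime) (he : 0 < e) (π : R →+* F)
    (hcard : Fintype.card F = e * p + 1) (χ : MulChar F R)
    (hχ : ∀ x, x ≠ 0 → π (χ x) = x ^ (e * (p - 1))) (a b : ℕ) (hab : p < a % p + b % p) :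
    π (jacobiSum (χ ^ a) (χ ^ b)) = 0 := by
  have hgp : ∀ x : F, x ≠ 0 → x ^ (e * p) = 1 := by
    intro x hx
    have := FiniteField.pow_card_sub_one_eq_one x hx
    rwa [hcard, Nat.add_sub_cancel] at this
  have key : ∀ a : ℕ, a % p ≠ 0 → ∀ x : F, π ((χ ^ a) x) = x ^ (e * (p - a % p)) := by
    intro a ha x
    have hap := Nat.mod_lt a hp.pos
    have ha0 : a ≠ 0 := by rintro rfl; simp at ha
    by_cases hx : x = 0
    · subst hx
      rw [MulChar.map_zero, map_zero, zero_pow]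
      exact mul_ne_zero he.ne' (by omega)
    · rw [MulChar.pow_apply' _ ha0, map_pow, hχ x hx]
      obtain ⟨c, hc⟩ : ∃ c, p = c + 1 := ⟨p - 1, by have := hp.pos; omega⟩
      have h1 : x ^ (e * a) ≠ 0 := pow_ne_zero _ hx
      apply mul_right_cancel₀ h1
      rw [← pow_mul, ← pow_add, ← pow_add]
      have e1 : e * (p - 1) * a + e * a = e * p * a := by
        rw [hc, Nat.add_sub_cancel]; ring
      have e2 : e * (p - a % p) + e * a = e * p * (1 + a / p) := by
        rw [← mul_add, mul_assoc]
        congr 1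
        have := Nat.div_add_mod a p
        rw [mul_add, mul_one]
        omega
      rw [e1, e2, pow_mul _ (e * p), pow_mul _ (e * p), hgp x hx, one_pow, one_pow]
  have ha := Nat.mod_lt a hp.pos
  have hb := Nat.mod_lt b hp.pos
  rw [jacobiSum, map_sum]
  have : ∀ x : F, π ((χ ^ a) x * (χ ^ b) (1 - x)) =
      ((Polynomial.X ^ (e * (p - a % p)) * (1 - Polynomial.X) ^ (e * (p - b % p)) :
        Polynomial F)).eval x := by
    intro x
    rw [map_mul, key a (by omega), key b (by omega)]
    simp
  rw [Finset.sum_congr rfl fun x _ => this x]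
  apply sum_poly_zero
  have hd1 : (1 - Polynomial.X : Polynomial F).natDegree ≤ 1 := by
    refine (Polynomial.natDegree_sub_le _ _).trans ?_
    simp
  calc _ ≤ _ := Polynomial.natDegree_mul_le
    _ ≤ e * (p - a % p) + e * (p - b % p) := by
        apply add_le_add
        · rw [Polynomial.natDegree_X_pow]
        · refine Polynomial.natDegree_pow_le.trans ?_
          calc _ ≤ e * (p - b % p) * 1 := Nat.mul_le_mul_left _ hd1
            _ = _ := mul_one _
    _ < Fintype.card F - 1 := by
        rw [hcard, Nat.add_sub_cancel, ← mul_add]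
        exact Nat.mul_lt_mul_of_pos_left (by omega) he

theorem jacobi_norm [CharZero R] {p e : ℕ} (hp : p.Prime) (π : R →+* F)
    (χ : MulChar F R)
    (hχ : ∀ x, x ≠ 0 → π (χ x) = x ^ (e * (p - 1))) (hχp : χ ^ p = 1)
    (hcard : Fintype.card F = e * p + 1) (b : ℕ) (hb1 : 1 ≤ b) (hb2 : b + 1 < p) :
    jacobiSum (χ ^ 1) (χ ^ b) * jacobiSum (χ ^ (p - 1)) (χ ^ (b * (p - 1))) = Fintype.card F := by
  classical
  have : Fact p.Prime := ⟨hp⟩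
  have he : 0 < e := by
    rcases Nat.eq_zero_or_pos e with h | h
    · have := Fintype.one_lt_card (α := F)
      rw [hcard, h] at this
      simp at this
    · exact h
  have hχ1 : χ ≠ 1 := by
    rintro rfl
    obtain ⟨g, hg⟩ := IsCyclic.exists_generator (α := Fˣ)
    have h1 := hχ g g.ne_zero
    rw [MulChar.one_apply_coe, map_one] at h1
    have h2 : g ^ (e * (p - 1)) = 1 := by
      ext; push_cast; exact h1.symm
    have h3 := orderOf_dvd_of_pow_eq_one h2
    rw [orderOf_eq_card_of_forall_mem_zpowers hg, Nat.card_eq_fintype_card, Fintype.card_units,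
      hcard, Nat.add_sub_cancel] at h3
    have h4 := Nat.le_of_dvd (Nat.mul_pos he (by omega)) h3
    have := Nat.le_of_mul_le_mul_left h4 he
    omega
  have hord : orderOf χ = p := orderOf_eq_prime hχp hχ1
  have hne : ∀ a : ℕ, 0 < a → a < p → χ ^ a ≠ 1 := by
    intro a h1 h2
    exact pow_ne_one_of_lt_orderOf h1.ne' (hord ▸ h2)
  have hinv : ∀ a : ℕ, χ ^ (a * (p - 1)) = (χ ^ a)⁻¹ := by
    intro a
    rw [eq_inv_iff_mul_eq_one, ← pow_add]
    have : a * (p - 1) + a = p * a := by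
      obtain ⟨c, hc⟩ : ∃ c, p = c + 1 := ⟨p - 1, by omega⟩
      rw [hc, Nat.add_sub_cancel]; ring
    rw [this, pow_mul, hχp, one_pow]
  let ι := algebraMap R (FractionRing R)
  have hι : Function.Injective ι := IsFractionRing.injective R (FractionRing R)
  have hchar : ringChar (FractionRing R) ≠ ringChar F := by
    have : CharZero (FractionRing R) := IsFractionRing.charZero_of_isFractionRing R 
    rw [ringChar.eq_zero]
    intro h
    exact CharP.ringChar_ne_zero_of_finite F h.symm
  apply hι
  rw [map_mul, ← jacobiSum_ringHomComp, ← jacobiSum_ringHomComp]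
  have h1 := hinv 1
  rw [one_mul] at h1
  rw [h1, hinv b, ← MulChar.ringHomComp_inv, ← MulChar.ringHomComp_inv,
    jacobiSum_mul_jacobiSum_inv hchar, map_natCast]
  · exact (MulChar.ringHomComp_ne_one_iff hι).mpr (hne 1 one_pos (by omega))
  · exact (MulChar.ringHomComp_ne_one_iff hι).mpr (hne b hb1 (by omega))
  · rw [← MulChar.ringHomComp_mul, ← pow_add]
    exact (MulChar.ringHomComp_ne_one_iff hι).mpr (hne _ (by omega) (by omega))

end Jacobi

section Kummer
set_option linter.unusedSectionVars false
variable {R : Type*} [CommRing R] [IsDedekindDomain R] [Module.Free ℤ R] [Module.Finite ℤ R]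
  [CharZero R] {ζ : R}

theorem absNorm_ker {F : Type*} [Field F] [Fintype F] (ρ : R →+* F)
    (hρ : Function.Surjective ρ) : Ideal.absNorm (RingHom.ker ρ) = Fintype.card F := by
  rw [Ideal.absNorm_apply, Submodule.cardQuot_apply, ← Nat.card_eq_fintype_card]
  exact Nat.card_congr (RingHom.quotientKerEquivOfSurjective hρ).toEquiv

theorem span_natCast_norm (l : ℕ) :
    Ideal.absNorm (Ideal.span {(l : R)}) = l ^ Module.finrank ℤ R := by
  rw [Ideal.absNorm_span_singleton]
  have := Algebra.norm_algebraMap (S := R) (l : ℤ)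
  have h2 : Algebra.norm ℤ (l : R) = (l : ℤ) ^ Module.finrank ℤ R := by simpa using this
  rw [h2, Int.natAbs_pow, Int.natAbs_natCast]

/-- A product of coprime kernels dividing `A`, with complementary product dividing `B`,
where `A B = l`. -/
theorem span_eq_prod {F : Type*} [Field F] [Fintype F] {n l : ℕ} (hl : l ≠ 0)
    (hcard : Fintype.card F = l) (hd : Module.finrank ℤ R = n)
    (ρ : ℕ → R →+* F) (hρ : ∀ i, Function.Surjective (ρ i))
    (hinj : ∀ i ∈ range n, ∀ j ∈ range n, i ≠ j → RingHom.ker (ρ i) ≠ RingHom.ker (ρ j))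
    (P : ℕ → Prop) [DecidablePred P] (A B : R) (hAB : A * B = l)
    (hA : ∀ i ∈ range n, P i → ρ i A = 0) (hB : ∀ i ∈ range n, ¬ P i → ρ i B = 0) :
    Ideal.span {A} = ∏ i ∈ (range n).filter P, RingHom.ker (ρ i) := by
  classical
  have hmax : ∀ i, (RingHom.ker (ρ i)).IsMaximal := fun i =>
    RingHom.ker_isMaximal_of_surjective _ (hρ i)
  have hcop : ∀ i ∈ range n, ∀ j ∈ range n, i ≠ j →
      IsCoprime (RingHom.ker (ρ i)) (RingHom.ker (ρ j)) := by
    intro i hi j hj hij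
    have := hmax i
    have := hmax j
    rw [Ideal.isCoprime_iff_sup_eq]
    exact Ideal.IsMaximal.coprime_of_ne (hmax i) (hmax j) (hinj i hi j hj hij)
  have h1 : ∏ i ∈ (range n).filter P, RingHom.ker (ρ i) ∣ Ideal.span {A} := by
    apply Finset.prod_dvd_of_coprime
    · intro i hi j hj hij
      exact hcop i (Finset.mem_filter.mp hi).1 j (Finset.mem_filter.mp hj).1 hij
    · intro i hi
      rw [Ideal.dvd_iff_le, Ideal.span_singleton_le_iff_mem, RingHom.mem_ker]
      exact hA i (Finset.mem_filter.mp hi).1 (Finset.mem_filter.mp hi).2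
  have h2 : ∏ i ∈ (range n).filter (fun i => ¬ P i), RingHom.ker (ρ i) ∣ Ideal.span {B} := by
    apply Finset.prod_dvd_of_coprime
    · intro i hi j hj hij
      exact hcop i (Finset.mem_filter.mp hi).1 j (Finset.mem_filter.mp hj).1 hij
    · intro i hi
      rw [Ideal.dvd_iff_le, Ideal.span_singleton_le_iff_mem, RingHom.mem_ker]
      exact hB i (Finset.mem_filter.mp hi).1 (Finset.mem_filter.mp hi).2
  obtain ⟨X, hX⟩ := h1
  obtain ⟨Y, hY⟩ := h2
  have h3 : Ideal.span {(l : R)} = (∏ i ∈ range n, RingHom.ker (ρ i)) * (X * Y) := by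
    rw [← hAB, ← Ideal.span_singleton_mul_span_singleton, hX, hY,
      ← Finset.prod_filter_mul_prod_filter_not (range n) P]
    ring
  have h4 := congrArg Ideal.absNorm h3
  rw [span_natCast_norm, map_mul, map_prod, Finset.prod_congr rfl
    (fun i _ => (absNorm_ker (ρ i) (hρ i)).trans hcard), Finset.prod_const, Finset.card_range, hd,
    map_mul] at h4
  have h5 : Ideal.absNorm X * Ideal.absNorm Y = 1 :=
    Nat.eq_of_mul_eq_mul_left (pow_pos (Nat.pos_of_ne_zero hl) n) (by rw [← h4, mul_one])
  have h6 : X = ⊤ := Ideal.absNorm_eq_one_iff.mp (Nat.eq_one_of_mul_eq_one_right h5)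
  rw [hX, h6, ← Ideal.one_eq_top, mul_one]

theorem kummer_aux {p : ℕ} (hp : p.Prime)
    (hζ : IsPrimitiveRoot ζ p) (hd : Module.finrank ℤ R = p - 1)
    {v : ℕ} (hv : orderOf (v : ZMod p) = p - 1) (s : R ≃+* R) (hs : ∀ i : ℕ, (s ^ i) ζ = ζ ^ v ^ i)
    (t : ℕ → ℕ) (ht : ∀ i, (t i : ZMod p) * (v : ZMod p) ^ i = 1) (ht1 : ∀ i, 1 ≤ t i)
    (ht2 : ∀ i, t i < p)
    {F : Type*} [Field F] [Fintype F] (π : R →+* F) (hπ : Function.Surjective π)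
    {l : ℕ} (hl : l.Prime) (hcard : Fintype.card F = l) (hlp : l % p = 1)
    {b : ℕ} (hb1 : 1 ≤ b) (hb2 : b + 1 < p) :
    ∃ A : R, Ideal.span {A} = ∏ i ∈ (range (p - 1)).filter (fun i => p < t i + (b * t i) % p),
      RingHom.ker (π.comp ((s ^ i : R ≃+* R).symm : R →+* R)) := by
  classical
  have : Fact p.Prime := ⟨hp⟩
  have : Fact l.Prime := ⟨hl⟩
  have hchar : CharP F l := by
    have h0 : (l : F) = 0 := by rw [← hcard]; exact Nat.cast_card_eq_zero F
    exact ringChar.of_eq (CharP.ringChar_of_prime_eq_zero hl h0)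
  have hpF : (p : F) ≠ 0 := by
    rw [Ne, CharP.cast_eq_zero_iff F l]
    intro h
    rw [(Nat.prime_dvd_prime_iff_eq hl hp).mp h, Nat.mod_self] at hlp
    exact zero_ne_one hlp
  have hbar := zetaBar_prim hp hζ π hpF
  have hcard' : Fintype.card F = l / p * p + 1 := by
    rw [hcard]
    conv_lhs => rw [← Nat.div_add_mod l p, hlp, mul_comm]
  have he : 0 < l / p := by
    rcases Nat.eq_zero_or_pos (l / p) with h | h
    · rw [hcard, h] at hcard'
      have := hl.one_lt
      omega
    · exact h
  obtain ⟨χ, hχ1, hχ2, hχ3⟩ := exists_char hp hζ π hpF hcard'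
  have hsymm : ∀ i, (s ^ i : R ≃+* R).symm ζ = ζ ^ t i := by
    intro i
    rw [RingEquiv.symm_apply_eq, map_pow, hs i, ← pow_mul]
    conv_lhs => rw [← pow_one ζ]
    rw [zeta_pow_eq_iff hp.ne_zero hζ]
    push_cast
    rw [mul_comm, ht i]
  have hbt : ∀ i, (b * t i) % p ≠ 0 ∧ t i + (b * t i) % p ≠ p := by
    intro i
    have h1 : ∀ c : ℕ, 0 < c → c < p → ¬ p ∣ c * t i := by
      intro c hc1 hc2 h
      rcases (hp.dvd_mul).mp h with h | h
      · have := Nat.le_of_dvd hc1 h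
        omega
      · have := Nat.le_of_dvd (ht1 i) h
        have := ht2 i
        omega
    refine ⟨fun h => h1 b hb1 (by omega) (Nat.dvd_of_mod_eq_zero h), fun h => ?_⟩
    apply h1 (b + 1) (by omega) hb2
    have h3 := Nat.div_add_mod (b * t i) p
    refine ⟨b * t i / p + 1, ?_⟩
    rw [add_mul, mul_add, one_mul]
    omega
  refine ⟨jacobiSum (χ ^ 1) (χ ^ b), ?_⟩
  refine span_eq_prod hl.ne_zero hcard hd
    (fun i => π.comp ((s ^ i : R ≃+* R).symm : R →+* R)) ?_ ?_
    (fun i => p < t i + (b * t i) % p) _ (jacobiSum (χ ^ (p - 1)) (χ ^ (b * (p - 1)))) ?_ ?_ ?_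
  · intro i
    exact hπ.comp (s ^ i).symm.surjective
  · intro i hi j hj hij hker
    rw [Finset.mem_range] at hi hj
    obtain ⟨c, hc⟩ : ∃ c : ℕ, (c : F) = π ζ := by
      have hbij := ZMod.castHom_bijective F (n := l) hcard
      obtain ⟨z, hz⟩ := hbij.2 (π ζ)
      refine ⟨z.val, ?_⟩
      rw [← hz, ← map_natCast (ZMod.castHom (dvd_refl l) F), ZMod.natCast_val, ZMod.cast_id]
    have hm : ∀ k, ζ ^ v ^ k - (c : R) ∈
        RingHom.ker (π.comp ((s ^ k : R ≃+* R).symm : R →+* R)) := by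
      intro k
      rw [RingHom.mem_ker, RingHom.comp_apply, ← hs k, RingHom.coe_coe, map_sub,
        RingEquiv.symm_apply_apply, map_natCast, map_sub, map_natCast, hc, sub_self]
    have h1 := hm i
    have h2 := hm j
    rw [← hker] at h2
    have h3 := Ideal.sub_mem _ h1 h2
    rw [sub_sub_sub_cancel_right, RingHom.mem_ker, RingHom.comp_apply, RingHom.coe_coe, map_sub,
      map_pow, map_pow, hsymm i, map_sub, sub_eq_zero, ← pow_mul, ← pow_mul, map_pow, map_pow,
      zeta_pow_eq_iff hp.ne_zero hbar] at h3
    push_cast at h3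
    have ht0 : (t i : ZMod p) ≠ 0 := left_ne_zero_of_mul_eq_one (ht i)
    have h4 := mul_left_cancel₀ ht0 h3
    exact hij (pow_injOn_Iio_orderOf (by simpa [hv] using hi) (by simpa [hv] using hj) h4)
  · rw [jacobi_norm hp π χ hχ1 hχ2 hcard' b hb1 hb2, hcard]
  · intro i _ hPi
    rw [RingHom.comp_apply, jacobi_galois χ hχ3 _ (Nat.one_le_iff_ne_zero.mp (ht1 i))
      (by simpa using hsymm i) 1 b one_ne_zero (by omega)]
    apply jacobi_mod hp he π hcard' χ hχ1
    rw [one_mul, Nat.mod_eq_of_lt (ht2 i)]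
    exact hPi
  · intro i _ hPi
    rw [RingHom.comp_apply, jacobi_galois χ hχ3 _ (Nat.one_le_iff_ne_zero.mp (ht1 i))
      (by simpa using hsymm i) (p - 1) (b * (p - 1)) (by omega)
      (mul_ne_zero (by omega) (by omega))]
    apply jacobi_mod hp he π hcard' χ hχ1
    have hneg : ∀ c : ℕ, c % p ≠ 0 → ((p - 1) * c) % p = p - c % p := by
      intro c hc
      have hcp := Nat.mod_lt c hp.pos
      have h5 : ((p - 1) * c) % p = (p - c % p) % p := by
        rw [← ZMod.natCast_eq_natCast_iff', Nat.cast_mul, Nat.cast_sub hp.one_le,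
          Nat.cast_sub hcp.le]
        simp
      rw [h5, Nat.mod_eq_of_lt (by omega)]
    have e1 : b * (p - 1) * t i = (p - 1) * (b * t i) := by ring
    have e2 : t i % p = t i := Nat.mod_eq_of_lt (ht2 i)
    have := hbt i
    have := ht1 i
    have := ht2 i
    rw [e1, hneg _ (hbt i).1, hneg _ (by omega), e2]
    have := Nat.mod_lt (b * t i) hp.pos
    omega

theorem ker_eq_map {F : Type*} [Field F] (π : R →+* F) (f : R ≃+* R) :
    RingHom.ker (π.comp (f.symm : R →+* R)) = (RingHom.ker π).map f := by
  rw [← RingHom.comap_ker]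
  exact Ideal.comap_symm f

theorem kummer {p : ℕ} (hp : p.Prime) (hadj : Algebra.adjoin ℤ {ζ} = ⊤)
    (hζ : IsPrimitiveRoot ζ p) (hd : Module.finrank ℤ R = p - 1)
    {v : ℕ} (hv : orderOf (v : ZMod p) = p - 1) (s : R ≃+* R) (hs : ∀ i : ℕ, (s ^ i) ζ = ζ ^ v ^ i)
    (t : ℕ → ℕ) (ht : ∀ i, (t i : ZMod p) * (v : ZMod p) ^ i = 1) (ht1 : ∀ i, 1 ≤ t i)
    (ht2 : ∀ i, t i < p) (Q : Ideal R) [hQ : Q.IsPrime]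
    {l : ℕ} (hl : l.Prime) (hlQ : (l : R) ∈ Q) (hlp : l % p = 1)
    {b : ℕ} (hb1 : 1 ≤ b) (hb2 : b + 1 < p) :
    ∃ A : R, Ideal.span {A} = ∏ i ∈ (range (p - 1)).filter (fun i => p < t i + (b * t i) % p),
      Q.map (s ^ i : R ≃+* R) := by
  have hQ0 : Q ≠ ⊥ := by
    rintro rfl
    rw [Ideal.mem_bot] at hlQ
    exact hl.ne_zero (by exact_mod_cast hlQ)
  have hmax : Q.IsMaximal := hQ.isMaximal hQ0
  have : Finite (R ⧸ Q) := Ideal.finiteQuotientOfFreeOfNeBot Q hQ0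
  have hc := card_quot hadj hζ.pow_eq_one Q hl hlQ hlp
  let _ : Field (R ⧸ Q) := Ideal.Quotient.field Q
  let _ : Fintype (R ⧸ Q) := Fintype.ofFinite _
  obtain ⟨A, hA⟩ := kummer_aux hp hζ hd hv s hs t ht ht1 ht2 (Ideal.Quotient.mk Q)
    Ideal.Quotient.mk_surjective hl (by rw [← Nat.card_eq_fintype_card, hc]) hlp hb1 hb2
  refine ⟨A, hA.trans (Finset.prod_congr rfl fun i _ => ?_)⟩
  rw [ker_eq_map, Ideal.mk_ker]

end Kummer

section Annihilate
variable {R : Type*} [CommRing R] [IsDedekindDomain R] [Module.Free ℤ R] [Module.Finite ℤ R]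
  [CharZero R] {ζ : R}

theorem map_ne_zero_ideal (f : R ≃+* R) {I : Ideal R} (hI : I ∈ (Ideal R)⁰) :
    I.map f ∈ (Ideal R)⁰ := by
  rw [mem_nonZeroDivisors_iff_ne_zero] at hI ⊢
  intro h
  exact hI ((Ideal.map_eq_bot_iff_of_injective f.injective).mp h)

theorem T_pow (s : R ≃+* R) (T : MulAut (ClassGroup R))
    (hT : ∀ I J : (Ideal R)⁰, Ideal.map s (I : Ideal R) = (J : Ideal R) →
      T (ClassGroup.mk0 I) = ClassGroup.mk0 J) (i : ℕ) (I : (Ideal R)⁰) :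
    (T ^ i) (ClassGroup.mk0 I) =
      ClassGroup.mk0 ⟨(I : Ideal R).map (s ^ i : R ≃+* R), map_ne_zero_ideal _ I.2⟩ := by
  induction i with
  | zero =>
    simp only [pow_zero, MulAut.one_apply]
    congr 1
    ext1
    exact (Ideal.map_id _).symm
  | succ i ih =>
    rw [pow_succ', MulAut.mul_apply, ih]
    apply hT
    simp only
    rw [pow_succ']
    exact Ideal.map_map (I := (I : Ideal R)) ((s ^ i : R ≃+* R) : R →+* R) (s : R →+* R)

theorem mk0_eq_one_of (X : (Ideal R)⁰) (A : R) (h : (X : Ideal R) = Ideal.span {A}) :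
    ClassGroup.mk0 X = 1 := by
  obtain ⟨X, hX⟩ := X
  rw [ClassGroup.mk0_eq_one_iff]
  exact ⟨A, h⟩

set_option maxHeartbeats 1000000 in
theorem annihilate {p : ℕ} (hp : p.Prime) (hp2 : p ≠ 2) (hadj : Algebra.adjoin ℤ {ζ} = ⊤)
    (hζ : IsPrimitiveRoot ζ p) (hd : Module.finrank ℤ R = p - 1)
    {v : ℕ} (hv : orderOf (v : ZMod p) = p - 1) (s : R ≃+* R) (hs : ∀ i : ℕ, (s ^ i) ζ = ζ ^ v ^ i)
    (t : ℕ → ℕ) (ht : ∀ i, (t i : ZMod p) * (v : ZMod p) ^ i = 1) (ht1 : ∀ i, 1 ≤ t i)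
    (ht2 : ∀ i, t i < p) (T : MulAut (ClassGroup R))
    (hT : ∀ I J : (Ideal R)⁰, Ideal.map s (I : Ideal R) = (J : Ideal R) →
      T (ClassGroup.mk0 I) = ClassGroup.mk0 J)
    {b : ℕ} (hb1 : 1 ≤ b) (hb2 : b + 1 < p) (C : ClassGroup R) :
    ∏ i ∈ (range (p - 1)).filter (fun i => p < t i + (b * t i) % p), (T ^ i) C = 1 := by
  classical
  have key : ∀ J : Ideal R, (∀ Q : Ideal R, Q.IsPrime → J ≤ Q → ∀ l : ℕ, l.Prime →
      (l : R) ∈ Q → l % p = 1) → ∀ hJ : J ∈ (Ideal R)⁰,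
      ∏ i ∈ (range (p - 1)).filter (fun i => p < t i + (b * t i) % p),
        (T ^ i) (ClassGroup.mk0 ⟨J, hJ⟩) = 1 := by
    intro J
    induction J using UniqueFactorizationMonoid.induction_on_prime with
    | h₁ =>
      intro _ hJ
      exact absurd rfl (mem_nonZeroDivisors_iff_ne_zero.mp hJ)
    | h₂ x hx =>
      intro _ hJ
      have h1 : ClassGroup.mk0 ⟨x, hJ⟩ = 1 := by
        rw [ClassGroup.mk0_eq_one_iff, Ideal.isUnit_iff.mp hx]
        exact top_isPrincipal
      rw [h1]
      simp
    | h₃ a Q ha hQ ih =>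
      intro hgood hJ
      have hQ0 : Q ∈ (Ideal R)⁰ := mem_nonZeroDivisors_iff_ne_zero.mpr hQ.ne_zero
      have ha0 : a ∈ (Ideal R)⁰ := mem_nonZeroDivisors_iff_ne_zero.mpr ha
      have h1 : ClassGroup.mk0 ⟨Q * a, hJ⟩ =
          ClassGroup.mk0 ⟨Q, hQ0⟩ * ClassGroup.mk0 ⟨a, ha0⟩ := by
        rw [← map_mul]; rfl
      have hQp : Q.IsPrime := Ideal.isPrime_of_prime hQ
      have hih := ih (fun P hP haP => hgood P hP (Ideal.mul_le_right.trans haP)) ha0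
      simp_rw [h1, map_mul]
      rw [Finset.prod_mul_distrib, hih, mul_one]
      -- the prime below
      obtain ⟨l, hl, hlQ⟩ : ∃ l : ℕ, l.Prime ∧ (l : R) ∈ Q := by
        have hmem := Ideal.absNorm_mem Q
        have hn0 : Ideal.absNorm Q ≠ 0 := by
          rw [Ne, Ideal.absNorm_eq_zero_iff]; exact hQ.ne_zero
        have hind : ∀ n : ℕ, n ≠ 0 → (n : R) ∈ Q → ∃ l : ℕ, l.Prime ∧ (l : R) ∈ Q := by
          intro n
          induction n using Nat.recOnMul with
          | zero => intro h; exact absurd rfl h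
          | one =>
            intro _ h
            exact absurd ((Ideal.eq_top_iff_one _).mpr (by simpa using h)) hQp.ne_top
          | prime q hq => intro _ h; exact ⟨q, hq, h⟩
          | mul a b iha ihb =>
            intro hab h
            push_cast at h
            rcases hQp.mem_or_mem h with h | h
            · exact iha (left_ne_zero_of_mul hab) h
            · exact ihb (right_ne_zero_of_mul hab) h
        exact hind _ hn0 hmem
      have hlp := hgood Q hQp Ideal.mul_le_left l hl hlQ
      obtain ⟨A, hA⟩ := kummer hp hadj hζ hd hv s hs t ht ht1 ht2 Q hl hlQ hlp hb1 hb2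
      rw [Finset.prod_congr rfl fun i _ => T_pow s T hT i ⟨Q, hQ0⟩, ← map_prod]
      generalize hX : (∏ i ∈ (range (p - 1)).filter (fun i => p < t i + (b * t i) % p),
        (⟨Q.map (s ^ i : R ≃+* R), map_ne_zero_ideal _ hQ0⟩ : (Ideal R)⁰)) = X
      have hX2 : (X : Ideal R) = Ideal.span {A} := by
        rw [hA, ← hX, Submonoid.coe_finsetProd]
      exact mk0_eq_one_of X A hX2
  obtain ⟨I, hI⟩ := ClassGroup.mk0_surjective C⁻¹
  obtain ⟨α, J, hα, hIJ, hgood⟩ := exists_split_rep hadj hp hp2 hζ hd hv s hs (I : Ideal R)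
    (mem_nonZeroDivisors_iff_ne_zero.mp I.2)
  have hJ0 : J ∈ (Ideal R)⁰ := by
    rw [mem_nonZeroDivisors_iff_ne_zero]
    rintro rfl
    rw [mul_zero, Ideal.zero_eq_bot, Ideal.span_singleton_eq_bot] at hIJ
    exact hα hIJ
  have hC : C = ClassGroup.mk0 ⟨J, hJ0⟩ := by
    have h1 : ClassGroup.mk0 I * ClassGroup.mk0 ⟨J, hJ0⟩ = 1 := by
      rw [← map_mul]
      exact mk0_eq_one_of _ α (by rw [Submonoid.coe_mul]; exact hIJ.symm)
    rw [hI] at h1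
    exact (inv_mul_eq_one.mp h1)
  rw [hC]
  exact key J hgood hJ0
end Annihilate

theorem count_eq {p : ℕ} (hp : p.Prime) (t : ℕ) (ht1 : 1 ≤ t) (ht2 : t < p) (v : ℕ)
    (hv1 : 1 ≤ v) (hv2 : v < p) :
    p * (∑ b ∈ Finset.Ico 1 v, if p < t + (b * t) % p then 1 else 0) + (v * t) % p = v * t := by
  induction v, hv1 using Nat.le_induction with
  | base => simp [Nat.mod_eq_of_lt ht2]
  | succ n hn ih =>
    have ih := ih (by omega)
    rw [Finset.sum_Ico_succ_top hn, mul_add]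
    have hlt := Nat.mod_lt (n * t) hp.pos
    have h0 : ¬ p ∣ (n + 1) * t := by
      intro h
      rcases (hp.dvd_mul).mp h with h | h
      · have := Nat.le_of_dvd (by omega) h
        omega
      · have := Nat.le_of_dvd ht1 h
        omega
    have h0' : ((n + 1) * t) % p ≠ 0 := fun h => h0 (Nat.dvd_of_mod_eq_zero h)
    have hstep : ((n + 1) * t) % p = (n * t % p + t) % p := by
      rw [add_mul, one_mul, Nat.add_mod, Nat.mod_eq_of_lt ht2]
    rw [hstep] at h0' ⊢
    rw [add_mul, one_mul]
    split_ifs with h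
    · rw [Nat.mod_eq_sub_mod (by omega), Nat.mod_eq_of_lt (by omega)]
      omega
    · have hne : n * t % p + t ≠ p := by
        intro h2
        rw [h2, Nat.mod_self] at h0'
        exact h0' rfl
      rw [Nat.mod_eq_of_lt (a := n * t % p + t) (by omega)]
      omega

theorem final_ann {p : ℕ} {G : Type*} [CommGroup G] (T : MulAut G) (c : G) (hc : orderOf c = p)
    {g : ℕ} (hTc : T c = c ^ g) (w : ℕ → ℕ → Prop) [∀ i b, Decidable (w i b)] (s : Finset ℕ)
    (n : ℕ) (h : ∀ b ∈ s, ∏ i ∈ (range n).filter (fun i => w i b), (T ^ i) c = 1) :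
    p ∣ ∑ i ∈ range n, g ^ i * ∑ b ∈ s, if w i b then 1 else 0 := by
  have hTi : ∀ i : ℕ, (T ^ i) c = c ^ g ^ i := by
    intro i
    induction i with
    | zero => simp
    | succ i ih => rw [pow_succ', MulAut.mul_apply, ih, map_pow, hTc, ← pow_mul, ← pow_succ']
  rw [← hc]
  apply orderOf_dvd_of_pow_eq_one
  simp_rw [Finset.mul_sum]
  rw [Finset.sum_comm, ← Finset.prod_pow_eq_pow_sum]
  refine Finset.prod_eq_one fun b hb => ?_
  rw [← h b hb, Finset.prod_filter, ← Finset.prod_pow_eq_pow_sum]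
  refine Finset.prod_congr rfl fun i _ => ?_
  split_ifs
  · rw [mul_one, hTi]
  · simp

theorem statement6
    (p : ℕ) (hp : p.Prime) (hp2 : p ≠ 2)
    (v : ℕ) (hv1 : 1 ≤ v) (hv2 : v ≤ p - 1)
    (hv : orderOf (v : ZMod p) = p - 1)
    (vn : ℤ → ℕ)
    (hvn1 : ∀ n : ℤ, 1 ≤ vn n) (hvn2 : ∀ n : ℤ, vn n ≤ p - 1)
    (hvn0 : vn 0 = 1)
    (hvnrec : ∀ n : ℤ, (vn (n + 1) : ZMod p) = (v : ZMod p) * (vn n : ZMod p))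
    (K : Type*) [Field K] [NumberField K]
    [IsCyclotomicExtension {p} ℚ K]
    (ζ : K) (hζ : IsPrimitiveRoot ζ p)
    (σ : K ≃ₐ[ℚ] K) (hσ : σ ζ = ζ ^ v)
    (σ' : 𝓞 K ≃+* 𝓞 K)
    (hσ' : ∀ x : 𝓞 K, algebraMap (𝓞 K) K (σ' x) = σ (algebraMap (𝓞 K) K x))
    (T : MulAut (ClassGroup (𝓞 K)))
    (hT : ∀ I J : (Ideal (𝓞 K))⁰,
      Ideal.map σ' (I : Ideal (𝓞 K)) = (J : Ideal (𝓞 K)) →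
      T (ClassGroup.mk0 I) = ClassGroup.mk0 J)
    (δ : ℕ → ℤ)
    (hδ : ∀ i : ℕ, (p : ℤ) * δ i = (vn (1 - (i : ℤ)) : ℤ) - (v : ℤ) * (vn (-(i : ℤ)) : ℤ))
    (m : ℕ) (hm1 : 1 ≤ m) (hm2 : m ≤ (p - 3) / 2)
    (c : ClassGroup (𝓞 K)) (hc : orderOf c = p)
    (hTc : T c = c ^ (vn ((2 * m + 1 : ℕ) : ℤ))) :
    (p : ℤ) ∣ ∑ i ∈ Finset.Icc 1 (p - 2), (vn (((2 * m + 1) * i : ℕ) : ℤ) : ℤ) * δ i := by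
  classical
  have : Fact p.Prime := ⟨hp⟩
  have : NeZero p := ⟨hp.ne_zero⟩
  have hp3 : 3 ≤ p := by have := hp.two_le; omega
  have hv0 : (v : ZMod p) ≠ 0 := by
    intro h0
    rw [h0, orderOf_zero] at hv
    omega
  have hvz : ∀ n : ℤ, (vn n : ZMod p) = (v : ZMod p) ^ n := by
    intro n
    induction n using Int.induction_on with
    | zero => simp [hvn0]
    | succ i ih => rw [hvnrec, ih, zpow_add₀ hv0, zpow_one, mul_comm]
    | pred i ih =>
      have h1 := hvnrec (-(i : ℤ) - 1)
      rw [sub_add_cancel, ih] at h1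
      apply mul_left_cancel₀ hv0
      rw [← h1, ← zpow_one_add₀ hv0]
      congr 1
      ring
  -- the integral setting
  let z : 𝓞 K := hζ.toInteger
  have hz : IsPrimitiveRoot z p := hζ.toInteger_isPrimitiveRoot
  have hadj : Algebra.adjoin ℤ {z} = ⊤ := by
    have := hζ.integralPowerBasis.adjoin_gen_eq_top
    rwa [IsPrimitiveRoot.integralPowerBasis_gen] at this
  have hd : Module.finrank ℤ (𝓞 K) = p - 1 := by
    rw [RingOfIntegers.rank, IsCyclotomicExtension.finrank (n := p) K
      (Polynomial.cyclotomic.irreducible_rat hp.pos), Nat.totient_prime hp]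
  have hs1 : σ' z = z ^ v := by
    apply RingOfIntegers.coe_injective
    rw [hσ', map_pow]
    exact hσ
  have hs : ∀ i : ℕ, (σ' ^ i) z = z ^ v ^ i := by
    intro i
    induction i with
    | zero => simp
    | succ i ih => rw [pow_succ', RingAut.mul_apply, ih, map_pow, hs1, ← pow_mul, ← pow_succ']
  let t : ℕ → ℕ := fun i => vn (-(i : ℤ))
  have ht1 : ∀ i, 1 ≤ t i := fun i => hvn1 _
  have ht2 : ∀ i, t i < p := fun i => by have := hvn2 (-(i : ℤ)); show vn _ < p; omega
  have ht : ∀ i, (t i : ZMod p) * (v : ZMod p) ^ i = 1 := by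
    intro i
    show (vn (-(i : ℤ)) : ZMod p) * _ = 1
    rw [hvz, zpow_neg, zpow_natCast]
    exact inv_mul_cancel₀ (pow_ne_zero _ hv0)
  have hann := final_ann T c hc hTc (fun i b => p < t i + (b * t i) % p) (Finset.Ico 1 v) (p - 1)
    (by
      intro b hb
      rw [Finset.mem_Ico] at hb
      exact annihilate hp hp2 hadj hz hd hv σ' hs t ht ht1 ht2 T hT hb.1 (by omega) c)
  have hE : ∀ i : ℕ, δ i =
      - ((∑ b ∈ Finset.Ico 1 v, if p < t i + (b * t i) % p then 1 else 0 : ℕ) : ℤ) := by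
    intro i
    have h1 := count_eq hp (t i) (ht1 i) (ht2 i) v hv1 (by omega)
    have h2 : vn (1 - (i : ℤ)) = (v * t i) % p := by
      have h3 : (vn (1 - (i : ℤ)) : ZMod p) = ((v * t i : ℕ) : ZMod p) := by
        push_cast
        show _ = (v : ZMod p) * (vn (-(i : ℤ)) : ZMod p)
        rw [← hvnrec]
        congr 2
        ring
      rw [ZMod.natCast_eq_natCast_iff'] at h3
      rw [← h3, Nat.mod_eq_of_lt]
      have := hvn2 (1 - (i : ℤ))
      omega
    have h4 := hδ i
    rw [h2] at h4
    have hp0 : (p : ℤ) ≠ 0 := by exact_mod_cast hp.ne_zero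
    apply mul_left_cancel₀ hp0
    rw [h4]
    have h5 := congrArg (Nat.cast : ℕ → ℤ) h1
    rw [Nat.cast_add, Nat.cast_mul, Nat.cast_mul] at h5
    show _ - (v : ℤ) * (t i : ℤ) = _
    linear_combination h5
  have hδ0 : δ 0 = 0 := by
    rw [hE 0]
    have : ∀ b ∈ Finset.Ico 1 v, (if p < t 0 + (b * t 0) % p then 1 else 0 : ℕ) = 0 := by
      intro b hb
      rw [Finset.mem_Ico] at hb
      have h0 : t 0 = 1 := by show vn _ = 1; simpa using hvn0
      rw [h0, mul_one, Nat.mod_eq_of_lt (by omega), if_neg (by omega)]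
    rw [Finset.sum_eq_zero this]
    simp
  rw [← ZMod.intCast_zmod_eq_zero_iff_dvd]
  rw [← ZMod.natCast_eq_zero_iff] at hann
  have hrange : range (p - 1) = insert 0 (Finset.Icc 1 (p - 2)) := by
    ext i
    simp only [Finset.mem_range, Finset.mem_insert, Finset.mem_Icc]
    omega
  rw [Nat.cast_sum, hrange, Finset.sum_insert (by simp)] at hann
  rw [Int.cast_sum, ← neg_eq_zero, ← Finset.sum_neg_distrib, ← hann]
  have hcast : ∀ i : ℕ, ((∑ b ∈ Finset.Ico 1 v,
      if p < t i + (b * t i) % p then 1 else 0 : ℕ) : ZMod p) = - ((δ i : ℤ) : ZMod p) := by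
    intro i
    rw [hE i, Int.cast_neg, neg_neg, Int.cast_natCast]
  rw [Nat.cast_mul, hcast 0, hδ0, Int.cast_zero, neg_zero, mul_zero, zero_add]
  refine Finset.sum_congr rfl fun i _ => ?_
  rw [Nat.cast_mul (vn ((2 * m + 1 : ℕ) : ℤ) ^ i) _, hcast i, Int.cast_mul, Int.cast_natCast,
    hvz, Nat.cast_pow, hvz, zpow_natCast, zpow_natCast, ← pow_mul, mul_neg]
end
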